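/- arXiv:0709.0988 — 2 statements merged into one kernel-verified Lean document; each statement's English description precedes it below -/
import Mathlib

section
/- For every integer d ≥ 0 and every continuous map f : X_d → S^{2d}, where X_d := { x ∈ ℝ^{2d+3} : x_i ≥ 0 for all i, ∑_i x_i = 1, and at most d+1 coordinates of x are nonzero } and S^{2d} is the unit sphere of ℝ^{2d+1}, there exist nonempty disjoint subsets σ, τ of the coordinate index set {1, …, 2d+3} with |σ| ≤ d+1 and |τ| ≤ d+1 such that f(‖σ‖) ∩ f(‖τ‖) ≠ ∅, where ‖σ‖ := { x ∈ X_d : x_i = 0 for all i ∉ σ }. -/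
/-- The geometric realization of the `d`-skeleton of the `(2d+2)`-dimensional simplex:
the set of points of the standard simplex in `ℝ^{2d+3}` having at most `d+1` nonzero
(barycentric) coordinates, with the subspace topology. -/
def VKskel (d : ℕ) : Type :=
  {x : Fin (2 * d + 3) → ℝ // (∀ i, 0 ≤ x i) ∧ (∑ i, x i) = 1 ∧
    (Finset.univ.filter fun i => x i ≠ 0).card ≤ d + 1}

instance (d : ℕ) : TopologicalSpace (VKskel d) :=
  instTopologicalSpaceSubtype

/-- Chains with coefficients in `ZMod 2` of ordered simplices with vertices in `V`; the empty list
is the generator of degree `-1`. -/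
abbrev OrderedChain (V : Type*) := List V →₀ ZMod 2

namespace OrderedChain

open Finsupp

variable {V W : Type*}

/-- The cone with apex `v`. -/
noncomputable def cone (v : V) : OrderedChain V →ₗ[ZMod 2] OrderedChain V :=
  lmapDomain _ _ (List.cons v)

/-- The augmented boundary of a simplex. -/
noncomputable def boundaryList : List V → OrderedChain V
  | [] => 0
  | v :: l => single l 1 + cone v (boundaryList l)

/-- The augmented boundary operator. -/
noncomputable def boundary : OrderedChain V →ₗ[ZMod 2] OrderedChain V :=
  linearCombination _ boundaryList

/-- The chain map induced by a map of vertices. -/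
noncomputable def push (f : V → W) : OrderedChain V →ₗ[ZMod 2] OrderedChain W :=
  lmapDomain _ _ (List.map f)

/-- The prism over a simplex, joining its image under `f` to its image under `g`. -/
noncomputable def prismList (f g : V → W) : List V → OrderedChain W
  | [] => 0
  | v :: l => single (f v :: g v :: l.map g) 1 + cone (f v) (prismList f g l)

/-- The prism operator, a chain homotopy from `push f` to `push g`. -/
noncomputable def prism (f g : V → W) : OrderedChain V →ₗ[ZMod 2] OrderedChain W :=
  linearCombination _ (prismList f g)

@[simp] lemma cone_single (v : V) (l : List V) (a : ZMod 2) :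
    cone v (single l a) = single (v :: l) a := by simp [cone]

@[simp] lemma push_single (f : V → W) (l : List V) (a : ZMod 2) :
    push f (single l a) = single (l.map f) a := by simp [push]

@[simp] lemma boundary_single (l : List V) : boundary (single l 1) = boundaryList l := by
  simp [boundary]

@[simp] lemma prism_single (f g : V → W) (l : List V) :
    prism f g (single l 1) = prismList f g l := by simp [prism]

lemma add_self (c : OrderedChain V) : c + c = 0 := ZModModule.add_self c

lemma linearMap_ext {M : Type*} [AddCommMonoid M] [Module (ZMod 2) M]
    {φ ψ : OrderedChain V →ₗ[ZMod 2] M} (h : ∀ l, φ (single l 1) = ψ (single l 1)) : φ = ψ :=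
  Finsupp.lhom_ext' fun l => LinearMap.ext_ring (h l)

lemma boundary_cone (v : V) (c : OrderedChain V) :
    boundary (cone v c) = c + cone v (boundary c) := by
  have : boundary ∘ₗ cone v = LinearMap.id + cone v ∘ₗ boundary :=
    linearMap_ext fun l => by simp [boundaryList]
  exact LinearMap.congr_fun this c

lemma push_cone (f : V → W) (v : V) (c : OrderedChain V) :
    push f (cone v c) = cone (f v) (push f c) := by
  have : push f ∘ₗ cone v = cone (f v) ∘ₗ push f := linearMap_ext fun l => by simp
  exact LinearMap.congr_fun this c

lemma boundary_boundaryList (l : List V) : boundary (boundaryList l) = 0 := by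
  induction l with
  | nil => simp [boundaryList]
  | cons v l ih => simp [boundaryList, boundary_cone, ih, add_self]

lemma boundaryList_map (f : V → W) (l : List V) :
    boundaryList (l.map f) = push f (boundaryList l) := by
  induction l with
  | nil => simp [boundaryList]
  | cons v l ih => simp [boundaryList, push_cone, ih]

lemma boundary_push (f : V → W) (c : OrderedChain V) :
    boundary (push f c) = push f (boundary c) := by
  have : boundary ∘ₗ push f = push f ∘ₗ boundary :=
    linearMap_ext fun l => by simp [boundaryList_map]
  exact LinearMap.congr_fun this c

lemma prism_cone (f g : V → W) (v : V) (c : OrderedChain V) :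
    prism f g (cone v c) = cone (f v) (cone (g v) (push g c)) + cone (f v) (prism f g c) := by
  have : prism f g ∘ₗ cone v
      = cone (f v) ∘ₗ cone (g v) ∘ₗ push g + cone (f v) ∘ₗ prism f g :=
    linearMap_ext fun l => by simp [prismList]
  exact LinearMap.congr_fun this c

lemma boundary_prismList (f g : V → W) (l : List V) :
    boundary (prismList f g l) + prism f g (boundaryList l)
      = single (l.map f) 1 + single (l.map g) 1 := by
  induction l with
  | nil => simp [boundaryList, prismList, add_self]
  | cons v l ih =>
    have ih' := congrArg (cone (f v)) ih
    simp only [map_add, cone_single] at ih'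
    simp only [prismList, boundaryList, map_add, boundary_single, boundary_cone, prism_single,
      prism_cone, List.map_cons, boundaryList_map, cone_single]
    linear_combination (norm := module) ih' + add_self (prismList f g l) +
      add_self (single (f v :: l.map g) 1)
      + add_self (cone (f v) (cone (g v) (push g (boundaryList l))))

lemma boundary_prism (f g : V → W) (c : OrderedChain V) :
    boundary (prism f g c) + prism f g (boundary c) = push f c + push g c := by
  have : boundary ∘ₗ prism f g + prism f g ∘ₗ boundary = push f + push g :=
    linearMap_ext fun l => by simp [boundary_prismList]
  exact LinearMap.congr_fun this c

lemma map_mem_supported {S : Set (List V)} {T : Set (List W)}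
    {φ : OrderedChain V →ₗ[ZMod 2] OrderedChain W}
    (h : ∀ l ∈ S, φ (single l 1) ∈ supported (ZMod 2) (ZMod 2) T) {c : OrderedChain V}
    (hc : c ∈ supported (ZMod 2) (ZMod 2) S) : φ c ∈ supported (ZMod 2) (ZMod 2) T := by
  rw [supported_eq_span_single] at hc
  refine Submodule.span_le (p := (supported (ZMod 2) (ZMod 2) T).comap φ).2 ?_ hc
  rintro _ ⟨l, hl, rfl⟩
  exact h l hl

lemma prismList_mem_supported (f g : V → W) (l : List V) :
    prismList f g l ∈ supported (ZMod 2) (ZMod 2)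
      {l' : List W | ∀ x ∈ l', ∃ v ∈ l, x = f v ∨ x = g v} := by
  induction l with
  | nil => simp [prismList]
  | cons v l ih =>
    refine add_mem (single_mem_supported _ _ ?_) (map_mem_supported ?_ ih)
    · simp only [List.mem_cons, List.mem_map, Set.mem_ofPred_eq]
      rintro x (rfl | rfl | ⟨w, hw, rfl⟩)
      exacts [⟨v, by simp⟩, ⟨v, by simp⟩, ⟨w, by simp [hw]⟩]
    · intro l' hl'
      rw [cone_single]
      refine single_mem_supported _ _ ?_
      simp only [List.mem_cons, Set.mem_ofPred_eq]
      rintro x (rfl | hx)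
      · exact ⟨v, by simp⟩
      · obtain ⟨w, hw, h⟩ := hl' x hx
        exact ⟨w, Or.inr hw, h⟩

/-- The cup product of the coboundaries of the `0`-cochains in `ss`. -/
def cup : List (V → ZMod 2) → List V → ZMod 2
  | [], [_] => 1
  | s :: ss, u :: v :: l => (s u + s v) * cup ss (v :: l)
  | _, _ => 0

/-- The value of `s` at the first vertex. -/
def lead (s : V → ZMod 2) : List V → ZMod 2
  | [] => 0
  | v :: _ => s v

/-- Evaluation of `cup ss` on chains. -/
noncomputable def evalCup (ss : List (V → ZMod 2)) : OrderedChain V →ₗ[ZMod 2] ZMod 2 :=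
  linearCombination _ (cup ss)

/-- Evaluation on chains of the cup product of `s` with `cup ss`. -/
noncomputable def evalLeadCup (s : V → ZMod 2) (ss : List (V → ZMod 2)) :
    OrderedChain V →ₗ[ZMod 2] ZMod 2 :=
  linearCombination _ fun l => lead s l * cup ss l

@[simp] lemma evalCup_single (ss : List (V → ZMod 2)) (l : List V) :
    evalCup ss (single l 1) = cup ss l := by simp [evalCup]

@[simp] lemma evalLeadCup_single (s : V → ZMod 2) (ss : List (V → ZMod 2)) (l : List V) :
    evalLeadCup s ss (single l 1) = lead s l * cup ss l := by simp [evalLeadCup]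

lemma evalLeadCup_cone (s : V → ZMod 2) (ss : List (V → ZMod 2)) (v : V) (c : OrderedChain V) :
    evalLeadCup s ss (cone v c) = s v * evalCup ss (cone v c) := by
  have : evalLeadCup s ss ∘ₗ cone v = s v • (evalCup ss ∘ₗ cone v) :=
    linearMap_ext fun l => by simp [lead]
  exact LinearMap.congr_fun this c

lemma evalLeadCup_boundaryList {s : V → ZMod 2} {ss : List (V → ZMod 2)}
    (h : ∀ l, evalCup ss (boundaryList l) = 0) (l : List V) :
    evalLeadCup s ss (boundaryList l) = cup (s :: ss) l := by
  match l with
  | [] => simp [boundaryList, cup]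
  | [u] => simp [boundaryList, cup, lead]
  | u :: v :: l =>
    have h' := h (u :: v :: l)
    rw [boundaryList, map_add, evalCup_single] at h'
    rw [boundaryList, map_add, evalLeadCup_cone, evalLeadCup_single, lead, cup]
    linear_combination s u * h' - s u * CharTwo.add_self_eq_zero (cup ss (v :: l))

lemma evalCup_boundaryList (ss : List (V → ZMod 2)) (l : List V) :
    evalCup ss (boundaryList l) = 0 := by
  induction ss generalizing l with
  | nil =>
    match l with
    | [] => simp [boundaryList]
    | [u] => simp [boundaryList, cup]
    | [u, v] => simp [boundaryList, cup, CharTwo.add_self_eq_zero]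
    | u :: v :: w :: l =>
      have : evalCup ([] : List (V → ZMod 2)) ∘ₗ cone u ∘ₗ cone v = 0 :=
        linearMap_ext fun l => by simp [cup]
      have h := LinearMap.congr_fun this (boundaryList (w :: l))
      simp only [LinearMap.comp_apply, LinearMap.zero_apply] at h
      simp [boundaryList, cup] at h ⊢
      exact h
  | cons s ss ih =>
    have : evalCup (s :: ss) = evalLeadCup s ss ∘ₗ boundary :=
      linearMap_ext fun l => by simp [evalLeadCup_boundaryList ih]
    simp [this, boundary_boundaryList]

lemma evalLeadCup_boundary (s : V → ZMod 2) (ss : List (V → ZMod 2)) (c : OrderedChain V) :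
    evalLeadCup s ss (boundary c) = evalCup (s :: ss) c := by
  have : evalLeadCup s ss ∘ₗ boundary = evalCup (s :: ss) :=
    linearMap_ext fun l => by simp [evalLeadCup_boundaryList (evalCup_boundaryList ss)]
  exact LinearMap.congr_fun this c

lemma cup_map {T : V → V} {ss : List (V → ZMod 2)} {l : List V}
    (h : ∀ s ∈ ss, ∀ v ∈ l, s (T v) = s v + 1) : cup ss (l.map T) = cup ss l := by
  induction ss generalizing l with
  | nil =>
    match l with
    | [] => rfl
    | [u] => rfl
    | u :: v :: l => rfl
  | cons s ss ih =>
    match l with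
    | [] => rfl
    | [u] => rfl
    | u :: v :: l =>
      have := ih (l := v :: l) fun s hs v hv =>
        h s (List.mem_cons_of_mem _ hs) v (List.mem_cons_of_mem _ hv)
      simp only [List.map_cons] at this
      simp only [List.map_cons, cup, this, h s (by simp) u (by simp), h s (by simp) v (by simp)]
      linear_combination cup ss (v :: l) * CharTwo.add_self_eq_zero (1 : ZMod 2)

lemma evalLeadCup_add_push {T : V → V} {s : V → ZMod 2} {ss : List (V → ZMod 2)}
    {c : OrderedChain V}
    (hc : c ∈ supported (ZMod 2) (ZMod 2) {l | ∀ t ∈ s :: ss, ∀ v ∈ l, t (T v) = t v + 1}) :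
    evalLeadCup s ss (c + push T c) = evalCup ss c := by
  rw [supported_eq_span_single] at hc
  induction hc using Submodule.span_induction with
  | mem x hx =>
    obtain ⟨l, hl, rfl⟩ := hx
    have h := cup_map fun t ht => hl t (List.mem_cons_of_mem _ ht)
    simp only [push_single, map_add, evalLeadCup_single, evalCup_single, h]
    match l with
    | [] => cases ss <;> simp [cup, lead]
    | v :: l =>
      simp only [List.map_cons, lead, hl s (by simp) v (by simp)]
      linear_combination cup ss (v :: l) * CharTwo.add_self_eq_zero (s v)
  | zero => simp
  | add x y _ _ hx hy =>
    rw [map_add (evalCup ss), ← hx, ← hy, ← map_add]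
    congr 1
    rw [map_add]; abel
  | smul a x _ hx => rw [map_smul, map_smul, ← smul_add, map_smul, hx]

lemma exists_ne_of_cup_ne_zero {ss : List (V → ZMod 2)} {l : List V} (h : cup ss l ≠ 0)
    {s : V → ZMod 2} (hs : s ∈ ss) : ∃ u ∈ l, ∃ v ∈ l, s u ≠ s v := by
  induction ss generalizing l with
  | nil => simp at hs
  | cons t ss ih =>
    match l with
    | [] => simp [cup] at h
    | [u] => simp [cup] at h
    | u :: v :: l =>
      rw [cup] at h
      rcases List.mem_cons.1 hs with rfl | hs
      · refine ⟨u, by simp, v, by simp, fun huv => h ?_⟩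
        rw [huv, CharTwo.add_self_eq_zero, zero_mul]
      · obtain ⟨x, hx, y, hy, hxy⟩ := ih (right_ne_zero_of_mul h) hs
        exact ⟨x, List.mem_cons_of_mem _ hx, y, List.mem_cons_of_mem _ hy, hxy⟩

/-- Ordered simplices of diameter at most `δ` on the unit sphere of the `ℓ¹` norm on `ℝ^N`, whose
vertices involve the first `k + 1` coordinates only. -/
def smallSimplices (N k : ℕ) (δ : ℝ) : Set (List (Fin N → ℝ)) :=
  {l | (∀ v ∈ l, ∑ i, |v i| = 1 ∧ ∀ i : Fin N, k < i → v i = 0) ∧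
    ∀ v ∈ l, ∀ w ∈ l, dist v w ≤ δ}

lemma map_neg_mem_smallSimplices {N k : ℕ} {δ : ℝ} {l : List (Fin N → ℝ)}
    (hl : l ∈ smallSimplices N k δ) : l.map Neg.neg ∈ smallSimplices N k δ := by
  refine ⟨?_, ?_⟩
  · intro v hv
    obtain ⟨w, hw, rfl⟩ := List.mem_map.1 hv
    simpa using hl.1 w hw
  · intro v hv w hw
    obtain ⟨v', hv', rfl⟩ := List.mem_map.1 hv
    obtain ⟨w', hw', rfl⟩ := List.mem_map.1 hw
    simpa using hl.2 v' hv' w' hw'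

lemma sum_abs_lineMap_single {N k : ℕ} (hk : k + 1 < N) {v : Fin N → ℝ} {t : ℝ}
    (hv : ∑ i, |v i| = 1) (hv0 : ∀ i : Fin N, k < i → v i = 0) (ht0 : 0 ≤ t) (ht1 : t ≤ 1) :
    ∑ i, |AffineMap.lineMap v (Pi.single ⟨k + 1, hk⟩ 1 : Fin N → ℝ) t i| = 1 := by
  have h : ∀ i, |AffineMap.lineMap v (Pi.single ⟨k + 1, hk⟩ 1 : Fin N → ℝ) t i|
      = (1 - t) * |v i| + t * (Pi.single ⟨k + 1, hk⟩ 1 : Fin N → ℝ) i := by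
    intro i
    rw [AffineMap.lineMap_apply_module]
    simp only [Pi.add_apply, Pi.smul_apply, smul_eq_mul]
    by_cases hi : i = ⟨k + 1, hk⟩
    · subst hi
      simp [hv0 ⟨k + 1, hk⟩ (Nat.lt_succ_self k), abs_of_nonneg ht0]
    · simp [Pi.single_eq_of_ne hi, abs_mul, abs_of_nonneg (sub_nonneg.2 ht1)]
  simp only [h, Finset.sum_add_distrib, ← Finset.mul_sum, hv, Finset.sum_pi_single',
    Finset.mem_univ, if_true]
  ring

lemma dist_le_two_of_sum_abs {N : ℕ} {v w : Fin N → ℝ} (hv : ∑ i, |v i| = 1)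
    (hw : ∑ i, |w i| = 1) : dist v w ≤ 2 := by
  have bound : ∀ u : Fin N → ℝ, ∑ i, |u i| = 1 → ∀ i, |u i| ≤ 1 := fun u hu i =>
    hu ▸ Finset.single_le_sum (f := fun i => |u i|) (fun i _ => abs_nonneg _) (Finset.mem_univ i)
  refine (dist_pi_le_iff (by norm_num)).2 fun i => ?_
  rw [Real.dist_eq]
  linarith [abs_sub (v i) (w i), bound v hv i, bound w hw i]

lemma dist_lineMap_le {E : Type*} [NormedAddCommGroup E] [NormedSpace ℝ E] (v w e : E) {t : ℝ}
    (t' : ℝ) (ht0 : 0 ≤ t) (ht1 : t ≤ 1) :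
    dist (AffineMap.lineMap v e t) (AffineMap.lineMap w e t')
      ≤ dist v w + |t - t'| * dist w e := by
  refine (dist_triangle _ (AffineMap.lineMap w e t) _).trans (add_le_add ?_ ?_)
  · have : AffineMap.lineMap v e t - AffineMap.lineMap w e t = (1 - t) • (v - w) := by
      simp only [AffineMap.lineMap_apply_module]
      module
    rw [dist_eq_norm, this, norm_smul, dist_eq_norm, Real.norm_of_nonneg (sub_nonneg.2 ht1)]
    exact mul_le_of_le_one_left (norm_nonneg _) (by linarith)
  · rw [dist_lineMap_lineMap, Real.dist_eq]

lemma push_neg_push_neg {V : Type*} [InvolutiveNeg V] (c : OrderedChain V) :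
    push Neg.neg (push Neg.neg c) = c := by
  have : push (Neg.neg : V → V) ∘ₗ push Neg.neg = LinearMap.id :=
    linearMap_ext fun l => by simp
  exact LinearMap.congr_fun this c

lemma push_id' {V : Type*} {f : V → V} (hf : ∀ v, f v = v) (c : OrderedChain V) :
    push f c = c := by
  obtain rfl : f = id := funext hf
  have : push (id : V → V) = LinearMap.id := linearMap_ext fun l => by simp
  exact LinearMap.congr_fun this c

/-- A subdivided upper hemisphere obtained by joining the symmetrization of a chain in the equator
to the pole `e`. -/
lemma exists_hemisphere_succ {N k m : ℕ} (hm : 0 < m) (hk : k + 1 < N) {δ : ℝ} (hδ : 0 ≤ δ)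
    {z : OrderedChain (Fin N → ℝ)}
    (hz : z ∈ supported (ZMod 2) (ZMod 2) (smallSimplices N k δ)) (hz0 : boundary z = 0) :
    ∃ c ∈ supported (ZMod 2) (ZMod 2) (smallSimplices N (k + 1) (δ + 2 / m)),
      boundary c = z := by
  set e : Fin N → ℝ := Pi.single ⟨k + 1, hk⟩ 1 with he
  set h : ℕ → (Fin N → ℝ) → (Fin N → ℝ) := fun j v => AffineMap.lineMap v e ((j : ℝ) / m) with hh
  have hm' : (0 : ℝ) < m := by exact_mod_cast hm
  have he1 : ∑ i, |e i| = 1 := by simp [he, Pi.single_apply, apply_ite abs]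
  have he0 : ∀ i : Fin N, k + 1 < i → e i = 0 := fun i hi =>
    Pi.single_eq_of_ne (fun h => by simp [h] at hi) _
  have ht0 : ∀ j : ℕ, 0 ≤ (j : ℝ) / m := fun j => by positivity
  have ht1 : ∀ j : ℕ, j ≤ m → (j : ℝ) / m ≤ 1 := fun j hj =>
    (div_le_one hm').2 (by exact_mod_cast hj)
  have hh1 : ∀ j ≤ m, ∀ v : Fin N → ℝ, (∑ i, |v i| = 1 ∧ ∀ i : Fin N, k < i → v i = 0) →
      ∑ i, |h j v i| = 1 ∧ ∀ i : Fin N, k + 1 < i → h j v i = 0 := by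
    intro j hj v hv
    refine ⟨sum_abs_lineMap_single hk hv.1 hv.2 (ht0 j) (ht1 j hj), fun i hi => ?_⟩
    simp [hh, AffineMap.lineMap_apply_module, hv.2 i (by omega), he0 i hi]
  refine ⟨∑ j ∈ Finset.range m, prism (h j) (h (j + 1)) z + cone e (push (h m) z), ?_, ?_⟩
  · refine add_mem (sum_mem fun j hj => ?_) ?_
    · have hjm : j < m := Finset.mem_range.1 hj
      have close : ∀ a b : ℕ, a ≤ m → |(a : ℝ) / m - b / m| ≤ 1 / m →
          ∀ v w, dist v w ≤ δ → ∑ i, |w i| = 1 → dist (h a v) (h b w) ≤ δ + 2 / m := by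
        intro a b ha hab v w hvw hw
        have h1 := dist_lineMap_le v w e ((b : ℝ) / m) (ht0 a) (ht1 a ha)
        have h2 := mul_le_mul hab (dist_le_two_of_sum_abs hw he1) dist_nonneg (by positivity)
        calc _ ≤ _ := h1
          _ ≤ δ + 1 / m * 2 := add_le_add hvw h2
          _ = _ := by ring
      refine map_mem_supported (fun l hl => ?_) hz
      rw [prism_single]
      refine supported_mono ?_ (prismList_mem_supported _ _ l)
      intro l' hl'
      refine ⟨fun x hx => ?_, fun x hx y hy => ?_⟩
      · obtain ⟨v, hv, rfl | rfl⟩ := hl' x hx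
        exacts [hh1 _ hjm.le v (hl.1 v hv), hh1 _ hjm v (hl.1 v hv)]
      · have e1 : |(j : ℝ) / m - (j + 1 : ℕ) / m| ≤ 1 / m := by
          rw [← sub_div]; push_cast
          rw [sub_add_cancel_left, neg_div, abs_neg, abs_of_pos (by positivity)]
        have e2 : |((j + 1 : ℕ) : ℝ) / m - j / m| ≤ 1 / m := by rwa [abs_sub_comm]
        have e3 : ∀ a : ℕ, |(a : ℝ) / m - a / m| ≤ 1 / m := fun a => by
          rw [sub_self, abs_zero]; positivity
        obtain ⟨v, hv, rfl | rfl⟩ := hl' x hx <;> obtain ⟨w, hw, rfl | rfl⟩ := hl' y hy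
        · exact close _ _ hjm.le (e3 _) v w (hl.2 v hv w hw) (hl.1 w hw).1
        · exact close _ _ hjm.le e1 v w (hl.2 v hv w hw) (hl.1 w hw).1
        · exact close _ _ hjm e2 v w (hl.2 v hv w hw) (hl.1 w hw).1
        · exact close _ _ hjm (e3 _) v w (hl.2 v hv w hw) (hl.1 w hw).1
    · rw [← LinearMap.comp_apply]
      refine map_mem_supported (fun l _ => ?_) hz
      rw [LinearMap.comp_apply, push_single, cone_single]
      refine single_mem_supported _ _ ?_
      have hall : ∀ x ∈ e :: l.map (h m), x = e := by
        simp [hh, div_self hm'.ne']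
      refine ⟨fun x hx => ?_, fun x hx y hy => ?_⟩
      · rw [hall x hx]
        exact ⟨he1, he0⟩
      · rw [hall x hx, hall y hy, dist_self]
        positivity
  · have hp : ∀ j, boundary (prism (h j) (h (j + 1)) z) = push (h j) z - push (h (j + 1)) z := by
      intro j
      rw [ZModModule.sub_eq_add, ← boundary_prism, hz0, map_zero, add_zero]
    simp only [map_add, map_sum, hp, Finset.sum_range_sub', boundary_cone, boundary_push, hz0,
      map_zero, add_zero]
    rw [sub_add_cancel]
    exact push_id' (fun v => by simp [hh]) z

/-- Antipodally compatible fine chains representing the hemispheres of the spheres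
`S⁰ ⊂ S¹ ⊂ ⋯`; every product of `k` coboundaries of odd cochains evaluates to `1` on the
`k`-dimensional one. -/
lemma exists_hemisphere {N m : ℕ} (hm : 0 < m) (k : ℕ) (hk : k < N) :
    ∃ c ∈ supported (ZMod 2) (ZMod 2) (smallSimplices N k (2 * k / m)),
      boundary (c + push Neg.neg c) = 0 ∧
      ∀ ss : List ((Fin N → ℝ) → ZMod 2), ss.length = k →
        (∀ s ∈ ss, ∀ v : Fin N → ℝ, ∑ i, |v i| = 1 → s (-v) = s v + 1) → evalCup ss c = 1 := by
  induction k with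
  | zero =>
    refine ⟨single [Pi.single ⟨0, hk⟩ 1] 1, single_mem_supported _ _ ?_, ?_, ?_⟩
    · refine ⟨?_, ?_⟩
      · simp only [List.mem_singleton, forall_eq]
        refine ⟨by simp [Pi.single_apply, apply_ite abs], fun i hi => ?_⟩
        exact Pi.single_eq_of_ne (fun h => by simp [h] at hi) _
      · simp
    · simp [boundaryList, add_self]
    · intro ss hss _
      obtain rfl := List.length_eq_zero_iff.1 hss
      simp [cup]
  | succ k ih =>
    obtain ⟨c, hc, hc0, hcup⟩ := ih (by omega)
    have hz : c + push Neg.neg c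
        ∈ supported (ZMod 2) (ZMod 2) (smallSimplices N k (2 * k / m)) := by
      refine add_mem hc (map_mem_supported (fun l hl => ?_) hc)
      rw [push_single]
      exact single_mem_supported _ _ (map_neg_mem_smallSimplices hl)
    obtain ⟨c', hc', hb⟩ := exists_hemisphere_succ hm hk (by positivity) hz hc0
    refine ⟨c', ?_, ?_, ?_⟩
    · convert hc' using 3
      push_cast
      ring
    · rw [map_add, boundary_push, hb, map_add, push_neg_push_neg, add_comm (push _ c) c]
      exact add_self _
    · intro ss hss hodd
      match ss with
      | s :: ss =>
        rw [← evalLeadCup_boundary, hb, evalLeadCup_add_push]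
        · exact hcup ss (by simpa using hss) fun t ht => hodd t (List.mem_cons_of_mem _ ht)
        · have hsub : smallSimplices N k (2 * k / m)
              ⊆ {l | ∀ t ∈ s :: ss, ∀ v ∈ l, t (-v) = t v + 1} :=
            fun l hl t ht v hv => hodd t ht v (hl.1 v hv).1
          exact supported_mono hsub hc

end OrderedChain

open OrderedChain Finsupp in
/-- Two-valued odd functions on the `ℓ¹` sphere change their values on a common small set. -/
lemma exists_small_list_of_odd {n : ℕ} (s : Fin n → (Fin (n + 1) → ℝ) → ZMod 2)
    (hs : ∀ i v, ∑ j, |v j| = 1 → s i (-v) = s i v + 1) {δ : ℝ} (hδ : 0 < δ) :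
    ∃ l : List (Fin (n + 1) → ℝ), l ≠ [] ∧ (∀ v ∈ l, ∑ j, |v j| = 1) ∧
      (∀ v ∈ l, ∀ w ∈ l, dist v w ≤ δ) ∧ ∀ i, ∃ v ∈ l, ∃ w ∈ l, s i v ≠ s i w := by
  obtain ⟨m, hm⟩ := exists_nat_gt (max 0 (2 * n / δ))
  have hm0 : (0 : ℝ) < m := (le_max_left _ _).trans_lt hm
  have hmδ : 2 * n / (m : ℝ) ≤ δ := by
    rw [div_le_iff₀ hm0]
    have := (div_lt_iff₀ hδ).1 ((le_max_right _ _).trans_lt hm)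
    linarith
  obtain ⟨c, hc, -, hcup⟩ :=
    exists_hemisphere (N := n + 1) (m := m) (by exact_mod_cast hm0) n n.lt_succ_self
  have h1 : evalCup (List.ofFn s) c = 1 := by
    refine hcup _ (by simp) fun t ht => ?_
    obtain ⟨i, rfl⟩ := List.mem_ofFn.1 ht
    exact hs i
  obtain ⟨l, hl, hne⟩ : ∃ l ∈ c.support, cup (List.ofFn s) l ≠ 0 := by
    by_contra! H
    rw [evalCup, linearCombination_apply, Finsupp.sum,
      Finset.sum_eq_zero fun l hl => by rw [H l hl, smul_zero]] at h1
    exact zero_ne_one h1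
  have hl' := hc hl
  refine ⟨l, ?_, fun v hv => (hl'.1 v hv).1, fun v hv w hw => (hl'.2 v hv w hw).trans hmδ,
    fun i => exists_ne_of_cup_ne_zero hne (List.mem_ofFn.2 ⟨i, rfl⟩)⟩
  rintro rfl
  cases h : List.ofFn s <;> simp [h, cup] at hne

/-- An odd choice of signs for an odd real function on nonzero vectors. -/
noncomputable def oddSign {N : ℕ} (g : (Fin N → ℝ) → ℝ) (v : Fin N → ℝ) : ZMod 2 :=
  open Classical in if 0 < g v ∨ g v = 0 ∧ toLex v < toLex (-v) then 1 else 0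

lemma oddSign_neg {N : ℕ} {g : (Fin N → ℝ) → ℝ} {v : Fin N → ℝ} (hv : v ≠ 0)
    (hg : g (-v) = -g v) : oddSign g (-v) = oddSign g v + 1 := by
  have hne : toLex v ≠ -toLex v := fun h => hv (self_eq_neg.1 h)
  have h2 : (1 : ZMod 2) + 1 = 0 := by decide
  unfold oddSign
  rw [hg, neg_neg, toLex_neg]
  rcases lt_trichotomy (g v) 0 with h | h | h
  · simp [h, h.not_gt, h.ne]
  · rcases lt_or_gt_of_ne hne with h' | h'
    · rw [if_neg fun hc => hc.elim (fun h0 => by simp [h] at h0) fun h0 => h'.not_gt h0.2,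
        if_pos (Or.inr ⟨h, h'⟩), h2]
    · rw [if_pos (Or.inr ⟨by simp [h], h'⟩),
        if_neg fun hc => hc.elim (fun h0 => by simp [h] at h0) fun h0 => h'.not_gt h0.2, zero_add]
  · simp [h, h.not_gt, h.ne', h2]

lemma mul_nonpos_of_oddSign_ne {N : ℕ} {g : (Fin N → ℝ) → ℝ} {v w : Fin N → ℝ}
    (h : oddSign g v ≠ oddSign g w) : g v * g w ≤ 0 := by
  by_contra! H
  rcases pos_and_pos_or_neg_and_neg_of_mul_pos H with ⟨h1, h2⟩ | ⟨h1, h2⟩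
  · simp [oddSign, h1, h2] at h
  · simp [oddSign, h1.not_gt, h2.not_gt, h1.ne, h2.ne] at h

/-- **Borsuk–Ulam theorem** on the unit sphere of the `ℓ¹` norm: an odd continuous map to a space
of smaller dimension has a zero. -/
theorem exists_eq_zero_of_odd {n : ℕ} {F : (Fin (n + 1) → ℝ) → (Fin n → ℝ)}
    (hF : ContinuousOn F {v | ∑ j, |v j| = 1})
    (hodd : ∀ v, ∑ j, |v j| = 1 → F (-v) = -F v) : ∃ v, ∑ j, |v j| = 1 ∧ F v = 0 := by
  have hcpt : IsCompact {v : Fin (n + 1) → ℝ | ∑ j, |v j| = 1} := by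
    refine Metric.isCompact_of_isClosed_isBounded
      (isClosed_eq (by fun_prop) continuous_const) ?_
    refine (Metric.isBounded_iff).2 ⟨2, fun v hv w hw => ?_⟩
    exact OrderedChain.dist_le_two_of_sum_abs hv hw
  have hnonempty : {v : Fin (n + 1) → ℝ | ∑ j, |v j| = 1}.Nonempty :=
    ⟨Pi.single 0 1, by simp [Pi.single_apply, apply_ite abs]⟩
  obtain ⟨x, hx, hmin⟩ := hcpt.exists_isMinOn hnonempty hF.norm
  refine ⟨x, hx, norm_le_zero_iff.1 (le_of_forall_pos_le_add fun ε hε => ?_)⟩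
  obtain ⟨δ, hδ, hunif⟩ := Metric.uniformContinuousOn_iff.1
    (hcpt.uniformContinuousOn_of_continuous hF) (ε / 2) (half_pos hε)
  obtain ⟨l, hl, hsphere, hsmall, hchange⟩ := exists_small_list_of_odd
    (fun i => oddSign fun v => F v i) (fun i v hv => oddSign_neg (by rintro rfl; simp at hv)
      (congrFun (hodd v hv) i)) (half_pos hδ)
  obtain ⟨y, hy⟩ := List.exists_mem_of_ne_nil l hl
  have hclose : ∀ v ∈ l, ∀ w ∈ l, ∀ i, |F v i - F w i| < ε / 2 := fun v hv w hw i =>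
    (dist_le_pi_dist (F v) (F w) i).trans_lt
      (hunif v (hsphere v hv) w (hsphere w hw) ((hsmall v hv w hw).trans_lt (half_lt_self hδ)))
  refine (hmin (hsphere y hy)).trans ((pi_norm_le_iff_of_nonneg (by linarith)).2 fun i => ?_)
  obtain ⟨v, hv, w, hw, hvw⟩ := hchange i
  have h1 := mul_nonpos_of_oddSign_ne hvw
  have h2 := abs_lt.1 (hclose v hv w hw i)
  have h3 := abs_lt.1 (hclose y hy v hv i)
  have h4 := abs_lt.1 (hclose y hy w hw i)
  rw [Real.norm_eq_abs, abs_le]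
  constructor <;> rcases mul_nonpos_iff.1 h1 with h | h <;> linarith

/-- The sum of all products of `k` distinct coordinates. -/
noncomputable def elemSymm {N : ℕ} (k : ℕ) (y : Fin N → ℝ) : ℝ :=
  ∑ S ∈ Finset.powersetCard k Finset.univ, ∏ i ∈ S, y i

lemma continuous_elemSymm {N : ℕ} (k : ℕ) : Continuous (elemSymm (N := N) k) := by
  unfold elemSymm
  fun_prop

lemma elemSymm_succ_eq_zero_iff {N : ℕ} {k : ℕ} {y : Fin N → ℝ} (hy : ∀ i, 0 ≤ y i) :
    elemSymm (k + 1) y = 0 ↔ (Finset.univ.filter fun i => y i ≠ 0).card ≤ k := by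
  rw [elemSymm, Finset.sum_eq_zero_iff_of_nonneg fun S _ => Finset.prod_nonneg fun i _ => hy i]
  constructor
  · intro h
    by_contra! hk
    obtain ⟨S, hS, hcard⟩ := Finset.exists_subset_card_eq (Nat.succ_le_of_lt hk)
    obtain ⟨i, hi, hi0⟩ := Finset.prod_eq_zero_iff.1
      (h S (Finset.mem_powersetCard.2 ⟨Finset.subset_univ _, hcard⟩))
    exact (Finset.mem_filter.1 (hS hi)).2 hi0
  · intro h S hS
    by_contra hne
    have hsub : S ⊆ Finset.univ.filter fun i => y i ≠ 0 := fun i hi =>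
      Finset.mem_filter.2 ⟨Finset.mem_univ _, Finset.prod_ne_zero_iff.1 hne i hi⟩
    have := Finset.card_le_card hsub
    have := (Finset.mem_powersetCard.1 hS).2
    omega

/-- The skeleton as a subset of `ℝ^{2d+3}`. -/
def skelSet (d : ℕ) : Set (Fin (2 * d + 3) → ℝ) :=
  {x | (∀ i, 0 ≤ x i) ∧ (∑ i, x i) = 1 ∧ (Finset.univ.filter fun i => x i ≠ 0).card ≤ d + 1}

lemma isCompact_skelSet (d : ℕ) : IsCompact (skelSet d) := by
  have h : skelSet d = stdSimplex ℝ (Fin (2 * d + 3)) ∩ {x | elemSymm (d + 2) x = 0} := by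
    ext x
    constructor
    · exact fun hx => ⟨⟨hx.1, hx.2.1⟩, (elemSymm_succ_eq_zero_iff hx.1).2 hx.2.2⟩
    · exact fun hx => ⟨hx.1.1, hx.1.2, (elemSymm_succ_eq_zero_iff hx.1.1).1 hx.2⟩
  rw [h]
  exact (isCompact_stdSimplex ℝ _).inter_right
    (isClosed_eq (continuous_elemSymm _) continuous_const)

lemma isClosedEmbedding_skel (d : ℕ) :
    Topology.IsClosedEmbedding (Subtype.val : VKskel d → Fin (2 * d + 3) → ℝ) :=
  (isCompact_skelSet d).isClosed.isClosedEmbedding_subtypeVal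

instance (d : ℕ) : CompactSpace (VKskel d) :=
  isCompact_iff_compactSpace.1 (isCompact_skelSet d)

/-- The **van Kampen–Flores theorem**: every continuous map from the `d`-skeleton of the
`(2d+2)`-simplex to `ℝ^{2d}` identifies two points with disjoint supports. -/
theorem exists_disjoint_support_eq (d : ℕ) {g : VKskel d → Fin (2 * d) → ℝ} (hg : Continuous g) :
    ∃ x y : VKskel d, (∀ i, x.1 i = 0 ∨ y.1 i = 0) ∧ g x = g y := by
  obtain ⟨G, hG⟩ := ContinuousMap.exists_extension (isClosedEmbedding_skel d) ⟨g, hg⟩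
  have hG' : ∀ x : VKskel d, G x.1 = g x := fun x => DFunLike.congr_fun hG x
  let p : (Fin (2 * d + 3) → ℝ) → (Fin (2 * d + 3) → ℝ) := fun v i => max (v i) 0
  have hp : Continuous p := by fun_prop
  let F : (Fin (2 * d + 2 + 1) → ℝ) → (Fin (2 * d + 1 + 1) → ℝ) := fun v =>
    Fin.cons (∑ i, v i) (Fin.cons (elemSymm (d + 2) (p v) - elemSymm (d + 2) (p (-v)))
      (G ((2 : ℝ) • p v) - G ((2 : ℝ) • p (-v))) : Fin (2 * d + 1) → ℝ)
  have hF : Continuous F := by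
    have h1 := continuous_elemSymm (N := 2 * d + 3) (d + 2)
    have h2 := G.continuous
    refine continuous_pi fun i => ?_
    refine Fin.cases ?_ (fun i => Fin.cases ?_ (fun i => ?_) i) i
    · simp only [F, Fin.cons_zero]; fun_prop
    · simp only [F, Fin.cons_zero, Fin.cons_succ]; fun_prop
    · simp only [F, Fin.cons_succ, Pi.sub_apply]; fun_prop
  have hodd : ∀ v, F (-v) = -F v := by
    intro v
    funext i
    refine Fin.cases ?_ (fun i => Fin.cases ?_ (fun i => ?_) i) i <;> simp [F]
  obtain ⟨v, hv1, hv0⟩ := exists_eq_zero_of_odd hF.continuousOn fun v _ => hodd v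
  have e0 : ∑ i, v i = 0 := by simpa [F] using congrFun hv0 0
  have e1 : elemSymm (d + 2) (p v) = elemSymm (d + 2) (p (-v)) :=
    sub_eq_zero.1 (by simpa [F] using congrFun hv0 (Fin.succ 0))
  have e2 : G ((2 : ℝ) • p v) = G ((2 : ℝ) • p (-v)) := by
    refine sub_eq_zero.1 (funext fun i => ?_)
    simpa [F] using congrFun hv0 (Fin.succ (Fin.succ i))
  have hp0 : ∀ v i, 0 ≤ p v i := fun v i => le_max_right _ _
  have hsub : ∀ i, p v i - p (-v) i = v i := fun i => by
    rcases le_total (v i) 0 with h | h <;> simp [p, h]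
  have hadd : ∀ i, p v i + p (-v) i = |v i| := fun i => by
    rcases le_total (v i) 0 with h | h <;> simp [p, h, abs_of_nonneg, abs_of_nonpos]
  have hdisj : ∀ i, p v i = 0 ∨ p (-v) i = 0 := fun i => by
    rcases le_total (v i) 0 with h | h <;> simp [p, h]
  have s1 : ∑ i, p v i - ∑ i, p (-v) i = 0 := by
    rw [← Finset.sum_sub_distrib, ← e0]; exact Finset.sum_congr rfl fun i _ => hsub i
  have s2 : ∑ i, p v i + ∑ i, p (-v) i = 1 := by
    rw [← Finset.sum_add_distrib, ← hv1]; exact Finset.sum_congr rfl fun i _ => hadd i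
  have hcard : (Finset.univ.filter fun i => p v i ≠ 0).card
      + (Finset.univ.filter fun i => p (-v) i ≠ 0).card ≤ 2 * d + 3 := by
    rw [← Finset.card_union_of_disjoint]
    · exact (Finset.card_le_univ _).trans (by simp)
    · rw [Finset.disjoint_filter]
      exact fun i _ h h' => (hdisj i).elim h h'
  have hz : elemSymm (d + 2) (p v) = 0 := by
    rcases le_or_gt (Finset.univ.filter fun i => p v i ≠ 0).card (d + 1) with h | h
    · exact (elemSymm_succ_eq_zero_iff (hp0 v)).2 h
    · rw [e1]
      exact (elemSymm_succ_eq_zero_iff (hp0 (-v))).2 (by omega)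
  have hmem : ∀ w, ∑ i, p w i = 1 / 2 → elemSymm (d + 2) (p w) = 0 →
      (2 : ℝ) • p w ∈ skelSet d := by
    intro w hw hw0
    refine ⟨fun i => mul_nonneg zero_le_two (hp0 w i), ?_, ?_⟩
    · simp only [Pi.smul_apply, smul_eq_mul, ← Finset.mul_sum, hw]; norm_num
    · simpa using (elemSymm_succ_eq_zero_iff (hp0 w)).1 hw0
  refine ⟨⟨_, hmem v (by linarith) hz⟩, ⟨_, hmem (-v) (by linarith) (e1 ▸ hz)⟩, fun i => ?_, ?_⟩
  · exact (hdisj i).imp (fun h => by simp [h]) (fun h => by simp [h])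
  · exact (hG' ⟨_, hmem v (by linarith) hz⟩).symm.trans
      (e2.trans (hG' ⟨_, hmem (-v) (by linarith) (e1 ▸ hz)⟩))

lemma single_mem_skelSet (d : ℕ) (j : Fin (2 * d + 3)) : Pi.single j 1 ∈ skelSet d := by
  refine ⟨fun i => ?_, by simp, (Finset.card_le_card (t := {j}) fun c hc => ?_).trans (by simp)⟩
  · exact (Pi.single_nonneg (α := fun _ => ℝ)).2 zero_le_one i
  · by_contra h
    exact (Finset.mem_filter.1 hc).2 (Pi.single_eq_of_ne (by simpa using h) 1)

/-- The cone over the image of the skeleton under a smooth map has Hausdorff dimension at most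
`d + 1`. -/
lemma dimH_cone_le {d : ℕ} {E : Type*} [NormedAddCommGroup E] [NormedSpace ℝ E]
    {p : (Fin (2 * d + 3) → ℝ) → E} (hp : ContDiff ℝ 1 p) :
    dimH {w | ∃ (t : ℝ) (x : VKskel d), w = t • p x.1} ≤ (d + 1 : ℕ) := by
  let e : (τ : Finset (Fin (2 * d + 3))) → Fin (2 * d + 3) → (τ → ℝ) → Fin (2 * d + 3) → ℝ :=
    fun τ j y i => if h : i ∈ τ then y ⟨i, h⟩ else if i = j then 1 - ∑ k, y k else 0
  have he : ∀ τ j, ContDiff ℝ 1 (e τ j) := fun τ j => contDiff_pi.2 fun i => by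
    by_cases h : i ∈ τ
    · simp only [e, h, dif_pos]; fun_prop
    · by_cases hj : i = j
      · subst hj
        simp only [e, h, dif_neg, if_true, not_false_eq_true]
        fun_prop
      · simp only [e, h, hj, dif_neg, if_false, not_false_eq_true]; fun_prop
  have hsub : {w | ∃ (t : ℝ) (x : VKskel d), w = t • p x.1} ⊆
      ⋃ a : {τ : Finset (Fin (2 * d + 3)) // τ.card ≤ d} × Fin (2 * d + 3),
        Set.range fun z : (a.1.1 → ℝ) × ℝ => z.2 • p (e a.1.1 a.2 z.1) := by
    rintro _ ⟨t, ⟨x, hx0, hx1, hxc⟩, rfl⟩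
    obtain ⟨j, hj⟩ : ∃ j, x j ≠ 0 := by
      by_contra! h
      simp [h] at hx1
    set S := Finset.univ.filter fun i => x i ≠ 0 with hS
    have hjS : j ∈ S := by simp [hS, hj]
    have hSsum : ∑ i ∈ S, x i = 1 := by rw [hS, Finset.sum_filter_ne_zero]; exact hx1
    have hcard : (S.erase j).card ≤ d := by rw [Finset.card_erase_of_mem hjS]; omega
    refine Set.mem_iUnion.2 ⟨(⟨S.erase j, hcard⟩, j), (fun i => x i, t), ?_⟩
    have hxe : e (S.erase j) j (fun i => x i) = x := by
      funext i
      by_cases h : i ∈ S.erase j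
      · simp only [e, h, dif_pos]
      · by_cases hi : i = j
        · subst hi
          have h1 : ∑ k : (S.erase i), x k = ∑ k ∈ S.erase i, x k :=
            Finset.sum_coe_sort (S.erase i) x
          have h2 := Finset.add_sum_erase S x hjS
          simp only [e, h, dif_neg, if_true, not_false_eq_true, h1]
          linarith
        · simp only [e, h, hi, dif_neg, if_false, not_false_eq_true]
          by_contra hne
          exact h (by simp [hi, hS, Ne.symm hne])
    simp only [hxe]
  refine (dimH_mono hsub).trans ?_
  rw [dimH_iUnion]
  refine iSup_le fun a => ?_
  have hφ : ContDiff ℝ 1 fun z : (a.1.1 → ℝ) × ℝ => z.2 • p (e a.1.1 a.2 z.1) :=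
    contDiff_snd.smul (hp.comp ((he _ _).comp contDiff_fst))
  refine hφ.dimH_range_le.trans ?_
  have := a.1.2
  simp only [Module.finrank_prod, Module.finrank_fintype_fun_eq_card, Fintype.card_coe,
    Module.finrank_self]
  exact_mod_cast Nat.succ_le_succ this

/-- A map from the `d`-skeleton to the `2d`-sphere can be approximated by a nonsurjective one. -/
lemma exists_approx_ne {d : ℕ} (hd : 1 ≤ d)
    {f : VKskel d → Metric.sphere (0 : EuclideanSpace ℝ (Fin (2 * d + 1))) 1}
    (hf : Continuous f) {ε : ℝ} (hε : 0 < ε) :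
    ∃ (u : Metric.sphere (0 : EuclideanSpace ℝ (Fin (2 * d + 1))) 1)
      (q : VKskel d → Metric.sphere (0 : EuclideanSpace ℝ (Fin (2 * d + 1))) 1),
      Continuous q ∧ ∀ x, q x ≠ u ∧ dist (q x) (f x) < ε := by
  obtain ⟨F, hF⟩ := ContinuousMap.exists_extension (isClosedEmbedding_skel d)
    ⟨fun x => (f x : EuclideanSpace ℝ (Fin (2 * d + 1))), by fun_prop⟩
  have hF' : ∀ x : VKskel d, F x.1 = f x := fun x => DFunLike.congr_fun hF x
  obtain ⟨p, hp, hpF, -⟩ := F.continuous.exists_contDiff_approx 1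
    (ε := fun _ => min (1 / 2) (ε / 2)) continuous_const fun _ => by positivity
  have hpf : ∀ x : VKskel d, ‖p x.1 - f x‖ < min (1 / 2) (ε / 2) := fun x => by
    rw [← dist_eq_norm, ← hF']; exact hpF x.1
  have hnorm : ∀ x : VKskel d, |‖p x.1‖ - 1| < min (1 / 2) (ε / 2) := fun x => by
    have h := abs_norm_sub_norm_le (p x.1) (f x)
    rw [norm_eq_of_mem_sphere] at h
    exact h.trans_lt (hpf x)
  have hpos : ∀ x : VKskel d, 0 < ‖p x.1‖ := fun x => by
    have := (abs_lt.1 ((hnorm x).trans_le (min_le_left _ _))).1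
    linarith
  have hdim : dimH {w | ∃ (t : ℝ) (x : VKskel d), w = t • p x.1}
      < Module.finrank ℝ (EuclideanSpace ℝ (Fin (2 * d + 1))) := by
    refine (dimH_cone_le hp).trans_lt ?_
    rw [finrank_euclideanSpace_fin]
    exact_mod_cast (by omega : d + 1 < 2 * d + 1)
  obtain ⟨w, hw⟩ := (dense_compl_of_dimH_lt_finrank hdim).nonempty
  have hw0 : 0 < ‖w‖ := norm_pos_iff.2 fun h =>
    hw ⟨0, ⟨_, single_mem_skelSet d 0⟩, by rw [h, zero_smul]⟩
  have hp' : Continuous fun x : VKskel d => p x.1 :=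
    hp.continuous.comp (isClosedEmbedding_skel d).continuous
  have hq : Continuous fun x : VKskel d => ‖p x.1‖⁻¹ • p x.1 :=
    (hp'.norm.inv₀ fun x => (hpos x).ne').smul hp'
  have hmem : ∀ x : VKskel d, ‖p x.1‖⁻¹ • p x.1 ∈
      Metric.sphere (0 : EuclideanSpace ℝ (Fin (2 * d + 1))) 1 := fun x => by
    simp [norm_smul, (hpos x).ne']
  refine ⟨⟨‖w‖⁻¹ • w, by simp [norm_smul, hw0.ne']⟩,
    fun x => ⟨‖p x.1‖⁻¹ • p x.1, hmem x⟩,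
    hq.subtype_mk hmem, fun x => ⟨fun h => ?_, ?_⟩⟩
  · have h' : ‖p x.1‖⁻¹ • p x.1 = ‖w‖⁻¹ • w := congrArg Subtype.val h
    refine hw ⟨‖w‖ * ‖p x.1‖⁻¹, x, ?_⟩
    rw [mul_smul, h', smul_inv_smul₀ hw0.ne']
  · have h1 : ‖‖p x.1‖⁻¹ • p x.1 - p x.1‖ = |‖p x.1‖ - 1| := by
      rw [show ‖p x.1‖⁻¹ • p x.1 - p x.1 = (‖p x.1‖⁻¹ - 1) • p x.1 by rw [sub_smul, one_smul],
        norm_smul, Real.norm_eq_abs, ← abs_of_pos (hpos x), ← abs_mul, abs_of_pos (hpos x),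
        sub_mul, inv_mul_cancel₀ (hpos x).ne', one_mul, abs_sub_comm]
    have h2 := (hnorm x).trans_le (min_le_right _ _)
    have h3 := (hpf x).trans_le (min_le_right _ _)
    rw [Subtype.dist_eq, dist_eq_norm]
    calc ‖‖p x.1‖⁻¹ • p x.1 - f x‖
        = ‖(‖p x.1‖⁻¹ • p x.1 - p x.1) + (p x.1 - f x)‖ := by rw [sub_add_sub_cancel]
      _ ≤ _ := norm_add_le _ _
      _ < ε := by rw [h1]; linarith

/-- In dimension zero, two of the three vertices are sent to the same point of `S⁰`. -/
lemma exists_disjoint_support_eq_zero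
    (f : VKskel 0 → Metric.sphere (0 : EuclideanSpace ℝ (Fin (2 * 0 + 1))) 1) :
    ∃ x y : VKskel 0, (∀ i, x.1 i = 0 ∨ y.1 i = 0) ∧ f x = f y := by
  let v : Fin 3 → VKskel 0 := fun j => ⟨Pi.single j 1, single_mem_skelSet 0 j⟩
  have hs : ∀ s : Metric.sphere (0 : EuclideanSpace ℝ (Fin (2 * 0 + 1))) 1,
      s.1 0 = 1 ∨ s.1 0 = -1 := fun s => by
    have h := norm_eq_of_mem_sphere s
    rw [EuclideanSpace.norm_eq, Real.sqrt_eq_one] at h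
    simpa using h
  obtain ⟨a, b, hab, h⟩ := Fintype.exists_ne_map_eq_of_card_lt
    (fun j => decide ((f (v j)).1 0 = 1)) (by simp)
  refine ⟨v a, v b, fun i => ?_, ?_⟩
  · by_cases hi : i = a
    · exact Or.inr (Pi.single_eq_of_ne (hi ▸ hab) 1)
    · exact Or.inl (Pi.single_eq_of_ne hi 1)
  · refine Subtype.ext (PiLp.ext fun i => ?_)
    obtain rfl : i = 0 := Subsingleton.elim (α := Fin 1) _ _
    rcases hs (f (v a)) with ha | ha <;> rcases hs (f (v b)) with hb | hb <;>
      simp_all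

/-- Every continuous map from the `d`-skeleton to the `2d`-sphere identifies two points with
disjoint supports. -/
lemma exists_disjoint_support_eq_sphere {d : ℕ}
    {f : VKskel d → Metric.sphere (0 : EuclideanSpace ℝ (Fin (2 * d + 1))) 1}
    (hf : Continuous f) :
    ∃ x y : VKskel d, (∀ i, x.1 i = 0 ∨ y.1 i = 0) ∧ f x = f y := by
  rcases Nat.eq_zero_or_pos d with rfl | hd
  · exact exists_disjoint_support_eq_zero f
  by_contra! hne
  have hcl : IsClosed {z : VKskel d × VKskel d | ∀ i, z.1.1 i = 0 ∨ z.2.1 i = 0} := by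
    have hc := (isClosedEmbedding_skel d).continuous
    simp only [Set.ofPred_forall, Set.ofPred_or]
    exact isClosed_iInter fun i =>
      (isClosed_eq ((continuous_apply i).comp (hc.comp continuous_fst)) continuous_const).union
      (isClosed_eq ((continuous_apply i).comp (hc.comp continuous_snd)) continuous_const)
  obtain ⟨δ, hδ, hdist⟩ := hcl.isCompact.exists_forall_le'
    (f := fun z : VKskel d × VKskel d => dist (f z.1) (f z.2)) (a := 0) (by fun_prop)
    fun z hz => dist_pos.2 (hne z.1 z.2 hz)
  obtain ⟨u, q, hq, hqf⟩ := exists_approx_ne hd hf (half_pos hδ)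
  have : Fact (Module.finrank ℝ (EuclideanSpace ℝ (Fin (2 * d + 1))) = 2 * d + 1) :=
    ⟨finrank_euclideanSpace_fin⟩
  have hmem : ∀ x, q x ∈ (stereographic' (2 * d) u).source := fun x => by
    rw [stereographic'_source]; exact (hqf x).1
  have hg : Continuous fun x => (stereographic' (2 * d) u (q x)).ofLp :=
    (PiLp.continuous_ofLp 2 _).comp
      ((stereographic' (2 * d) u).continuousOn.comp_continuous hq hmem)
  obtain ⟨x, y, hxy, h⟩ := exists_disjoint_support_eq d hg
  have hqq : q x = q y :=
    (stereographic' (2 * d) u).injOn (hmem x) (hmem y) (WithLp.ofLp_injective 2 h)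
  have h1 := hdist (x, y) hxy
  have h2 := dist_triangle_left (f x) (f y) (q x)
  have h3 := (hqf x).2
  have h4 := (hqf y).2
  rw [← hqq] at h4
  simp only at h1
  linarith

/-- The strong form of the van Kampen–Flores theorem: for any continuous map from the
`d`-skeleton of the `(2d+2)`-simplex into the `2d`-sphere, there are two vertex-disjoint
faces whose images intersect.  Here, for a set `σ` of coordinate indices, `‖σ‖` is the set
of points of `VKskel d` supported in `σ`, i.e. those `x` with `x i = 0` for all `i ∉ σ`. -/
theorem vanKampen_Flores_strong (d : ℕ)
    (f : VKskel d → Metric.sphere (0 : EuclideanSpace ℝ (Fin (2 * d + 1))) 1)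
    (hf : Continuous f) :
    ∃ σ τ : Finset (Fin (2 * d + 3)), σ.Nonempty ∧ τ.Nonempty ∧ Disjoint σ τ ∧
      σ.card ≤ d + 1 ∧ τ.card ≤ d + 1 ∧
      ∃ x y : VKskel d, (∀ i, i ∉ σ → x.1 i = 0) ∧ (∀ i, i ∉ τ → y.1 i = 0) ∧
        f x = f y := by
  obtain ⟨x, y, hxy, hfxy⟩ := exists_disjoint_support_eq_sphere hf
  have hne : ∀ z : VKskel d, (Finset.univ.filter fun i => z.1 i ≠ 0).Nonempty := fun z => by
    by_contra h
    have h0 : ∀ i, z.1 i = 0 := by simpa [Finset.filter_eq_empty_iff] using h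
    simpa [h0] using z.2.2.1
  refine ⟨Finset.univ.filter fun i => x.1 i ≠ 0, Finset.univ.filter fun i => y.1 i ≠ 0,
    hne x, hne y, ?_, x.2.2.2, y.2.2.2, x, y, fun i hi => ?_, fun i hi => ?_, hfxy⟩
  · exact Finset.disjoint_filter.2 fun i _ h h' => (hxy i).elim h h'
  · simpa using hi
  · simpa using hi
end

section
/- Let d ≥ 1 and let S be a PL 2d-sphere, i.e., an abstract simplicial complex obtained from the boundary complex of the (2d+1)-simplex by a finite sequence of bistellar moves. Let M be a missing d-face of S. Then the complex K := S_{≤d} ∪ {M} does not embed in the 2d-sphere: there is no continuous injective map ‖K‖ → S^{2d}. -/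
/-- An abstract simplicial complex on vertex type `V`: a collection of nonempty finite
sets (the faces) closed under passing to nonempty subsets. -/
def IsComplex {V : Type} [DecidableEq V] (K : Finset (Finset V)) : Prop :=
  (∀ σ ∈ K, σ.Nonempty) ∧ ∀ σ ∈ K, ∀ τ : Finset V, τ ⊆ σ → τ.Nonempty → τ ∈ K

/-- The geometric realization `‖K‖` of an abstract simplicial complex `K`: all functions
`x : V → [0,1]` with `∑ v, x v = 1` whose support is a face of `K`. -/
def GeomRep {V : Type} [Fintype V] (K : Finset (Finset V)) : Type :=
  {x : V → ℝ // (∀ v, 0 ≤ x v) ∧ (∀ v, x v ≤ 1) ∧ (∑ v, x v) = 1 ∧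
    (Finset.univ.filter fun v => x v ≠ 0) ∈ K}

instance {V : Type} [Fintype V] (K : Finset (Finset V)) : TopologicalSpace (GeomRep K) :=
  instTopologicalSpaceSubtype

/-- `L` arises from `K` by a bistellar move (of type `(dim σ, |τ| - 1)`):
`σ` is a face of `K`, `τ ∉ K` is a nonempty vertex set whose boundary `∂τ`
(the nonempty proper subsets of `τ`) equals the link of `σ` in `K`, and
`L = (K ∖ {ρ ∈ K : σ ⊆ ρ}) ∪ {α ∪ β : α ⊊ σ, β ⊆ τ, α ∪ β ≠ ∅}`. -/
def BistellarMove {V : Type} [DecidableEq V] (K L : Finset (Finset V)) : Prop :=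
  ∃ σ τ : Finset V, σ ∈ K ∧ τ.Nonempty ∧ τ ∉ K ∧
    (∀ ρ : Finset V, (ρ ∈ K ∧ Disjoint ρ σ ∧ ρ ∪ σ ∈ K) ↔ (ρ.Nonempty ∧ ρ ⊂ τ)) ∧
    (∀ ρ : Finset V, ρ ∈ L ↔
      ((ρ ∈ K ∧ ¬ σ ⊆ ρ) ∨ (ρ.Nonempty ∧ ∃ α β : Finset V, α ⊂ σ ∧ β ⊆ τ ∧ ρ = α ∪ β)))

/-- A piecewise linear `n`-sphere: a complex obtainable from the boundary complex of the
`(n+1)`-simplex (all nonempty proper subsets of an `(n+2)`-element vertex set) by a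
finite sequence of bistellar moves. -/
def IsPLSphere {V : Type} [DecidableEq V] (n : ℕ) (S : Finset (Finset V)) : Prop :=
  ∃ V₀ : Finset V, V₀.card = n + 2 ∧
    Relation.ReflTransGen BistellarMove
      (V₀.powerset.filter fun σ => σ.Nonempty ∧ σ ≠ V₀) S

/-- Mod 2 chains on the finite subsets of `W`. -/
abbrev Chain (W : Type*) := Finset W → ZMod 2

theorem zmod_two_eq_zero : (2 : ZMod 2) = 0 := rfl

theorem zmod_two_cases (a : ZMod 2) : a = 0 ∨ a = 1 := by
  revert a; decide

theorem zmod_two_add_self (a : ZMod 2) : a + a = 0 := CharTwo.add_self_eq_zero a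

theorem zmod_two_eq_of_add_eq_zero {a b : ZMod 2} (h : a + b = 0) : a = b := by
  linear_combination h - b * zmod_two_eq_zero

theorem sum_sum_eq_zero_of_symm {ι : Type*} [Fintype ι] (s : ι → ι → ZMod 2)
    (hs : ∀ x y, s x y = s y x) (h0 : ∀ x, s x x = 0) : ∑ x, ∑ y, s x y = 0 := by
  rw [← Fintype.sum_prod_type']
  refine Finset.sum_involution (fun p _ => p.swap) ?_ ?_ ?_ ?_
  · rintro ⟨x, y⟩ -
    simp only [Prod.swap]
    rw [hs y x, zmod_two_add_self]
  · rintro ⟨x, y⟩ - h h'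
    simp only [Prod.swap_prod_mk, Prod.mk.injEq] at h'
    obtain rfl := h'.1
    exact h (h0 _)
  · simp
  · simp

/-- The chain `c` vanishes outside the family `P`. -/
def SuppOn {W : Type*} (P : Set (Finset W)) (c : Chain W) : Prop := ∀ F, F ∉ P → c F = 0

theorem SuppOn.add {W : Type*} {P : Set (Finset W)} {c c' : Chain W} (h : SuppOn P c)
    (h' : SuppOn P c') :
    SuppOn P (c + c') := fun F hF => by simp [h F hF, h' F hF]

theorem SuppOn.smul {W : Type*} {P : Set (Finset W)} {c : Chain W} (h : SuppOn P c) (r : ZMod 2) :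
    SuppOn P (r • c) := fun F hF => by simp [h F hF]

section Chains

variable {W : Type*} [DecidableEq W] [Fintype W]

/-- The augmented simplicial boundary, on all finite subsets of `W`. -/
def bd : Chain W →ₗ[ZMod 2] Chain W where
  toFun c G := ∑ x, if x ∈ G then 0 else c (insert x G)
  map_add' c c' := by
    funext G
    simp only [Pi.add_apply, ← Finset.sum_add_distrib]
    exact Finset.sum_congr rfl fun x _ => by split_ifs <;> simp
  map_smul' r c := by
    funext G
    simp only [Pi.smul_apply, RingHom.id_apply, Finset.smul_sum]
    exact Finset.sum_congr rfl fun x _ => by split_ifs <;> simp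

theorem bd_apply (c : Chain W) (G : Finset W) :
    bd c G = ∑ x, if x ∈ G then 0 else c (insert x G) := rfl

theorem bd_congr {c c' : Chain W} {G : Finset W}
    (h : ∀ x, x ∉ G → c (insert x G) = c' (insert x G)) : bd c G = bd c' G := by
  simp only [bd_apply]
  exact Finset.sum_congr rfl fun x _ => by
    split_ifs with hx
    · rfl
    · exact h x hx

theorem bd_eq_zero_of_forall {c : Chain W} {G : Finset W}
    (h : ∀ x, x ∉ G → c (insert x G) = 0) : bd c G = 0 := by
  rw [bd_congr (c' := 0) h, map_zero]; rfl

theorem bd_bd (c : Chain W) : bd (bd c) = 0 := by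
  funext G
  simp only [bd_apply, Pi.zero_apply]
  have : ∀ x, (if x ∈ G then (0 : ZMod 2) else
      ∑ y, if y ∈ insert x G then 0 else c (insert y (insert x G))) =
      ∑ y, if x ∈ G ∨ y ∈ insert x G then 0 else c (insert y (insert x G)) := by
    intro x
    split_ifs with hx <;> simp [hx]
  rw [Finset.sum_congr rfl fun x _ => this x]
  refine sum_sum_eq_zero_of_symm _ (fun x y => ?_) (fun x => by simp)
  rw [Finset.insert_comm]
  simp only [Finset.mem_insert]
  refine if_congr ?_ rfl rfl
  constructor <;> rintro (h | h | h) <;> simp [h]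

/-- The cone over a chain with apex `x`; sets that contain `x` are sent to zero. -/
def cone (x : W) (c : Chain W) : Chain W := fun F => if x ∈ F then c (F.erase x) else 0

theorem bd_cone (x : W) (c : Chain W) : bd (cone x c) = c + cone x (bd c) := by
  funext G
  simp only [bd_apply, cone, Pi.add_apply]
  by_cases hx : x ∈ G
  · have h1 : ∀ y, (if y ∈ G then (0 : ZMod 2) else
        if x ∈ insert y G then c ((insert y G).erase x) else 0) =
        (if y ∈ G.erase x then 0 else c (insert y (G.erase x))) + if y = x then c G else 0 := by
      intro y
      by_cases hy : y = x
      · subst hy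
        simp [hx, Finset.insert_erase, zmod_two_add_self]
      · by_cases hyG : y ∈ G
        · simp [hyG, hy]
        · simp [hyG, hy, hx, Finset.erase_insert_of_ne hy]
    rw [Finset.sum_congr rfl fun y _ => h1 y, Finset.sum_add_distrib]
    simp [hx, add_comm]
  · rw [Finset.sum_eq_single x]
    · simp [hx]
    · intro y _ hy
      have : x ∉ insert y G := by simp [hx, Ne.symm hy]
      simp [this]
    · simp

/-- The augmented simplicial coboundary. -/
def cobd (a : Chain W) : Chain W := fun F => ∑ x ∈ F, a (F.erase x)

theorem sum_mul_bd (a c : Chain W) : ∑ G, a G * bd c G = ∑ F, cobd a F * c F := by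
  simp only [bd_apply, cobd, Finset.mul_sum, Finset.sum_mul]
  have h1 : ∑ G : Finset W, ∑ x, (a G * if x ∈ G then 0 else c (insert x G)) =
      ∑ p : Finset W × W, if p.2 ∈ p.1 then 0 else a p.1 * c (insert p.2 p.1) := by
    rw [Fintype.sum_prod_type]
    exact Finset.sum_congr rfl fun G _ => Finset.sum_congr rfl fun x _ => by
      split_ifs <;> simp
  have h2 : ∑ F : Finset W, ∑ x ∈ F, a (F.erase x) * c F =
      ∑ p : Finset W × W, if p.2 ∈ p.1 then a (p.1.erase p.2) * c p.1 else 0 := by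
    rw [Fintype.sum_prod_type]
    exact Finset.sum_congr rfl fun F _ => by simp [Finset.sum_ite_mem]
  rw [h1, h2]
  have h3 : ∀ p : Finset W × W, (if p.2 ∈ p.1 then (0 : ZMod 2) else a p.1 * c (insert p.2 p.1)) =
      if p.2 ∉ p.1 then a p.1 * c (insert p.2 p.1) else 0 := by
    intro p; split_ifs <;> simp_all
  rw [Finset.sum_congr rfl fun p _ => h3 p, ← Finset.sum_filter, ← Finset.sum_filter]
  refine Finset.sum_nbij' (fun p => (insert p.2 p.1, p.2)) (fun p => (p.1.erase p.2, p.2))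
    ?_ ?_ ?_ ?_ ?_
  · rintro ⟨G, x⟩ h; simp
  · rintro ⟨G, x⟩ h; simp
  · rintro ⟨G, x⟩ h
    simp only [Finset.mem_filter, Finset.mem_univ, true_and] at h
    simp [h]
  · rintro ⟨G, x⟩ h
    simp only [Finset.mem_filter, Finset.mem_univ, true_and] at h
    simp [h]
  · rintro ⟨G, x⟩ h
    simp only [Finset.mem_filter, Finset.mem_univ, true_and] at h
    simp [h]

theorem cobd_cobd (a : Chain W) : cobd (cobd a) = 0 := by
  funext F
  simp only [cobd, Pi.zero_apply]
  have h1 : ∑ x ∈ F, ∑ y ∈ F.erase x, a ((F.erase x).erase y) =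
      ∑ x, ∑ y, if x ∈ F ∧ y ∈ F.erase x then a ((F.erase x).erase y) else 0 := by
    rw [← Finset.sum_subset (Finset.subset_univ F)]
    · refine Finset.sum_congr rfl fun x hx => ?_
      rw [← Finset.sum_filter]
      exact Finset.sum_congr (by ext y; simp [hx]) fun _ _ => rfl
    · intro x _ hx
      simp [hx]
  rw [h1]
  refine sum_sum_eq_zero_of_symm _ (fun x y => ?_) (fun x => by simp)
  rw [Finset.erase_right_comm]
  refine if_congr ?_ rfl rfl
  simp only [Finset.mem_erase]
  tauto

/-- The boundary, restricted to the sets that contain `ρ`. -/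
noncomputable def rbd (ρ : Finset W) (c : Chain W) : Chain W := Set.indicator {G | ρ ⊆ G} (bd c)

theorem rbd_of_subset {ρ G : Finset W} (h : ρ ⊆ G) (c : Chain W) : rbd ρ c G = bd c G :=
  Set.indicator_of_mem (s := {G | ρ ⊆ G}) h _

theorem rbd_of_not_subset {ρ G : Finset W} (h : ¬ ρ ⊆ G) (c : Chain W) : rbd ρ c G = 0 :=
  Set.indicator_of_notMem (s := {G | ρ ⊆ G}) h _

theorem bd_indicator_superset {ρ G : Finset W} (h : ρ ⊆ G) (c : Chain W) :
    bd (Set.indicator {F | ρ ⊆ F} c) G = bd c G :=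
  bd_congr fun x _ => Set.indicator_of_mem (s := {F | ρ ⊆ F})
    (h.trans (Finset.subset_insert x G)) _

theorem bd_rbd {ρ G : Finset W} (h : ρ ⊆ G) (c : Chain W) : bd (rbd ρ c) G = 0 := by
  rw [rbd, bd_indicator_superset h, bd_bd]; rfl

theorem SuppOn.rbd {P : Set (Finset W)} {ρ : Finset W} {c : Chain W}
    (hP : ∀ F ∈ P, ∀ G, ρ ⊆ G → G ⊆ F → G ∈ P) (h : SuppOn P c) : SuppOn P (rbd ρ c) := by
  intro G hG
  by_cases hρ : ρ ⊆ G
  · rw [rbd_of_subset hρ]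
    exact bd_eq_zero_of_forall fun x _ => h _ fun hx => hG (hP _ hx _ hρ (Finset.subset_insert x G))
  · exact rbd_of_not_subset hρ _

end Chains

open Classical in
/-- The sum of all members of `P` that have `n + 1` elements. -/
noncomputable def facetChain {V : Type*} (n : ℕ) (P : Set (Finset V)) : Chain V :=
  fun F => if F ∈ P ∧ F.card = n + 1 then 1 else 0

theorem facetChain_of_mem {V : Type*} {n : ℕ} {P : Set (Finset V)} {F : Finset V} (h : F ∈ P)
    (hc : F.card = n + 1) : facetChain n P F = 1 := by simp [facetChain, h, hc]

theorem facetChain_of_notMem {V : Type*} {n : ℕ} {P : Set (Finset V)} {F : Finset V} (h : F ∉ P) :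
    facetChain n P F = 0 := by simp [facetChain, h]

theorem facetChain_of_card_ne {V : Type*} {n : ℕ} {P : Set (Finset V)} {F : Finset V}
    (h : F.card ≠ n + 1) : facetChain n P F = 0 := by simp [facetChain, h]

section Spheres

variable {V : Type*} [DecidableEq V] [Fintype V]

/-- A pure complex (with the empty set adjoined) of dimension `n` all of whose relative
homology groups with respect to the complement of an open star are those of an `n`-sphere. -/
structure SphereLike (n : ℕ) (P : Set (Finset V)) : Prop where
  empty_mem : ∅ ∈ P
  down : ∀ F ∈ P, ∀ G, G ⊆ F → G ∈ P
  card_le : ∀ F ∈ P, F.card ≤ n + 1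
  facet : ∀ F ∈ P, ∃ G ∈ P, F ⊆ G ∧ G.card = n + 1
  bd_facetChain : bd (facetChain n P) = 0
  homology : ∀ ρ ∈ P, ∀ c : Chain V, SuppOn {F | F ∈ P ∧ ρ ⊆ F} c →
    (∀ G, ρ ⊆ G → bd c G = 0) → ∃ (e : Chain V) (ε : ZMod 2),
      SuppOn {F | F ∈ P ∧ ρ ⊆ F} e ∧ ∀ G, ρ ⊆ G → bd e G = c G + ε * facetChain n P G

theorem bd_single (N G : Finset V) :
    bd (Pi.single N 1) G = if G ⊆ N ∧ G.card + 1 = N.card then 1 else 0 := by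
  rw [bd_apply]
  split_ifs with h
  · obtain ⟨x, hx, rfl⟩ := (Finset.covBy_iff_exists_insert (s := G) (t := N)).1
      (Finset.covBy_iff_card_sdiff_eq_one.2 ⟨h.1, by
        rw [Finset.card_sdiff_of_subset h.1]; omega⟩)
    rw [Finset.sum_eq_single x]
    · simp [hx]
    · intro y _ hy
      split_ifs with hyG
      · rfl
      · rw [Pi.single_eq_of_ne]
        intro heq
        have : y ∈ insert x G := heq ▸ Finset.mem_insert_self y G
        simp [hy, hyG] at this
    · simp
  · refine Finset.sum_eq_zero fun x _ => ?_
    split_ifs with hx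
    · rfl
    · rw [Pi.single_eq_of_ne]
      rintro rfl
      exact h ⟨Finset.subset_insert _ _, by rw [Finset.card_insert_of_notMem hx]⟩

/-- Relative homology of the boundary of a simplex. -/
theorem exists_bd_eq_of_ssubset {N ρ : Finset V} (hρ : ρ ⊂ N) {c : Chain V}
    (hc : SuppOn {F | ρ ⊆ F ∧ F ⊂ N} c) (h0 : ∀ G, ρ ⊆ G → bd c G = 0) :
    ∃ (e : Chain V) (ε : ZMod 2), SuppOn {F | ρ ⊆ F ∧ F ⊂ N} e ∧
      ∀ G, ρ ⊆ G → bd e G = c G + ε * bd (Pi.single N 1) G := by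
  obtain ⟨x, hxN, hxρ⟩ := Finset.exists_of_ssubset hρ
  have hsupp : ∀ F, ¬ (ρ ⊆ F ∧ F ⊆ N) → cone x c F = 0 := by
    intro F hF
    unfold cone
    split_ifs with hx
    · refine hc _ fun h => hF ⟨h.1.trans (Finset.erase_subset _ _), ?_⟩
      rw [← Finset.insert_erase hx]
      exact Finset.insert_subset hxN h.2.1
    · rfl
  refine ⟨cone x c + cone x c N • Pi.single N 1, cone x c N, ?_, ?_⟩
  · intro F hF
    by_cases hFN : F = N
    · subst hFN
      simp [zmod_two_add_self]
    · simp only [Pi.add_apply, Pi.smul_apply, Pi.single_eq_of_ne hFN, smul_zero, add_zero]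
      exact hsupp F fun h => hF ⟨h.1, h.2.ssubset_of_ne hFN⟩
  · intro G hG
    rw [map_add, map_smul, bd_cone]
    have : cone x (bd c) G = 0 := by
      unfold cone
      split_ifs with hx
      · exact h0 _ (Finset.subset_erase.2 ⟨hG, hxρ⟩)
      · rfl
    simp [this]

theorem sphereLike_ssubset {n : ℕ} {N : Finset V} (hN : N.card = n + 2) :
    SphereLike n {F | F ⊂ N} := by
  have htop : facetChain n {F | F ⊂ N} = bd (Pi.single N 1) := by
    funext G
    rw [bd_single, facetChain]
    have h : (G ∈ {F | F ⊂ N} ∧ G.card = n + 1) ↔ G ⊆ N ∧ G.card + 1 = N.card := by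
      constructor
      · rintro ⟨h, h'⟩
        exact ⟨h.1, by omega⟩
      · rintro ⟨h, h'⟩
        refine ⟨h.ssubset_of_ne ?_, by omega⟩
        rintro rfl
        omega
    simp only [h]
  refine ⟨?_, ?_, ?_, ?_, ?_, ?_⟩
  · exact Finset.empty_ssubset.2 (Finset.card_pos.1 (by omega))
  · exact fun F hF G hG => hG.trans_ssubset hF
  · intro F hF
    have := Finset.card_lt_card hF
    omega
  · intro F hF
    obtain ⟨x, hxN, hxF⟩ := Finset.exists_of_ssubset hF
    exact ⟨N.erase x, Finset.erase_ssubset hxN, Finset.subset_erase.2 ⟨hF.1, hxF⟩, by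
      rw [Finset.card_erase_of_mem hxN]; omega⟩
  · rw [htop, bd_bd]
  · intro ρ hρ c hc h0
    have heq : {F | F ∈ {F | F ⊂ N} ∧ ρ ⊆ F} = {F | ρ ⊆ F ∧ F ⊂ N} := by
      ext F; simp [and_comm]
    rw [heq] at hc ⊢
    rw [htop]
    exact exists_bd_eq_of_ssubset hρ hc h0

/-- A relative chain that is a cycle over `A` can be pushed off the open star of `A`. -/
theorem exists_push {Q : Set (Finset V)} (hQ : ∀ F ∈ Q, ∀ G, G ⊆ F → G ∈ Q)
    {N A ρ : Finset V} (hN : N ∈ Q) (hA : ∀ F ∈ Q, A ⊆ F → F ⊆ N) {y : V} (hyN : y ∈ N)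
    (hyA : y ∉ A) (hyρ : y ∉ ρ) {e : Chain V} (he : SuppOn {F | F ∈ Q ∧ ρ ⊆ F} e)
    (h0 : ∀ G, ρ ⊆ G → A ⊆ G → bd e G = 0) :
    ∃ h : Chain V, SuppOn {F | F ∈ Q ∧ ρ ⊆ F} h ∧
      SuppOn {F | F ∈ Q ∧ ρ ⊆ F ∧ ¬ A ⊆ F} (e + rbd ρ h) := by
  set eA : Chain V := Set.indicator {F | A ⊆ F} e with heA
  have hsupp : SuppOn {F | F ∈ Q ∧ ρ ⊆ F} (cone y eA) := by
    intro F hF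
    unfold cone
    split_ifs with hy
    · rw [heA]
      by_cases hAF : A ⊆ F.erase y
      · rw [Set.indicator_of_mem (s := {F | A ⊆ F}) hAF]
        refine he _ fun h => hF ⟨hQ N hN _ ?_, h.2.trans (Finset.erase_subset _ _)⟩
        rw [← Finset.insert_erase hy]
        exact Finset.insert_subset hyN (hA _ h.1 hAF)
      · exact Set.indicator_of_notMem (s := {F | A ⊆ F}) hAF _
    · rfl
  refine ⟨cone y eA, hsupp, ?_⟩
  have hsum : SuppOn {F | F ∈ Q ∧ ρ ⊆ F} (e + rbd ρ (cone y eA)) :=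
    he.add (hsupp.rbd fun F hF G hρG hG => ⟨hQ F hF.1 G hG, hρG⟩)
  intro F hF
  by_cases hF' : F ∈ Q ∧ ρ ⊆ F
  · have hAF : A ⊆ F := by
      by_contra h
      exact hF ⟨hF'.1, hF'.2, h⟩
    rw [Pi.add_apply, rbd_of_subset hF'.2, bd_cone, Pi.add_apply]
    have h1 : eA F = e F := Set.indicator_of_mem (s := {F | A ⊆ F}) hAF _
    have h2 : cone y (bd eA) F = 0 := by
      unfold cone
      split_ifs with hy
      · have h3 : A ⊆ F.erase y := Finset.subset_erase.2 ⟨hAF, hyA⟩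
        rw [heA, bd_indicator_superset h3]
        exact h0 _ (Finset.subset_erase.2 ⟨hF'.2, hyρ⟩) h3
      · rfl
    rw [h1, h2, add_zero, zmod_two_add_self]
  · exact hsum F hF'

/-- Replacing the star of `σ` by the star of `τ` inside the simplex `σ ∪ τ`. -/
theorem SphereLike.flip {n : ℕ} {Q : Set (Finset V)} (hQ : ∀ F ∈ Q, ∀ G, G ⊆ F → G ∈ Q)
    {σ τ : Finset V} (hστ : Disjoint σ τ) (hσ : σ.Nonempty) (hN : σ ∪ τ ∈ Q)
    (hcard : (σ ∪ τ).card = n + 2) (hσQ : ∀ F ∈ Q, σ ⊆ F → F ⊆ σ ∪ τ)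
    (hτQ : ∀ F ∈ Q, τ ⊆ F → F ⊆ σ ∪ τ) (hP : SphereLike n {F | F ∈ Q ∧ ¬ τ ⊆ F}) :
    SphereLike n {F | F ∈ Q ∧ ¬ σ ⊆ F} := by
  set N := σ ∪ τ with hNdef
  have hσN : σ ⊆ N := Finset.subset_union_left
  have hτN : τ ⊆ N := Finset.subset_union_right
  have hboth : ∀ F, F ⊆ N → σ ⊆ F → τ ⊆ F → F = N := fun F h1 h2 h3 =>
    h1.antisymm (Finset.union_subset h2 h3)
  have herase : ∀ x ∈ σ, N.erase x ∈ Q ∧ ¬ σ ⊆ N.erase x ∧ (N.erase x).card = n + 1 := by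
    intro x hx
    refine ⟨hQ N hN _ (Finset.erase_subset _ _), fun h => by simpa using h hx, ?_⟩
    rw [Finset.card_erase_of_mem (hσN hx)]
    omega
  have htop : ∀ G, facetChain n {F | F ∈ Q ∧ ¬ σ ⊆ F} G =
      facetChain n {F | F ∈ Q ∧ ¬ τ ⊆ F} G + bd (Pi.single N 1) G := by
    intro G
    rw [bd_single]
    by_cases hG : G.card = n + 1
    · by_cases hGN : G ⊆ N
      · have hGQ := hQ N hN G hGN
        have hne : G ≠ N := by rintro rfl; omega
        rw [if_pos ⟨hGN, by omega⟩]
        obtain ⟨x, hxN, hxG⟩ := Finset.exists_of_ssubset (hGN.ssubset_of_ne hne)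
        have hGe : G = N.erase x := by
          refine Finset.eq_of_subset_of_card_le (Finset.subset_erase.2 ⟨hGN, hxG⟩) ?_
          rw [Finset.card_erase_of_mem hxN]; omega
        rcases Finset.mem_union.1 hxN with hx | hx
        · have h1 : τ ⊆ G := by
            rw [hGe]
            exact Finset.subset_erase.2 ⟨hτN, Finset.disjoint_left.1 hστ hx⟩
          have h2 : ¬ σ ⊆ G := fun h => hxG (h hx)
          rw [facetChain_of_mem (P := {F | F ∈ Q ∧ ¬ σ ⊆ F}) ⟨hGQ, h2⟩ hG,
            facetChain_of_notMem (fun h => h.2 h1), zero_add]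
        · have h1 : σ ⊆ G := by
            rw [hGe]
            exact Finset.subset_erase.2 ⟨hσN, Finset.disjoint_right.1 hστ hx⟩
          have h2 : ¬ τ ⊆ G := fun h => hxG (h hx)
          rw [facetChain_of_mem (P := {F | F ∈ Q ∧ ¬ τ ⊆ F}) ⟨hGQ, h2⟩ hG,
            facetChain_of_notMem (fun h => h.2 h1), zmod_two_add_self]
      · rw [if_neg (fun h => hGN h.1), add_zero]
        by_cases hGQ : G ∈ Q
        · rw [facetChain_of_mem (P := {F | F ∈ Q ∧ ¬ σ ⊆ F}) ⟨hGQ, fun h => hGN (hσQ G hGQ h)⟩ hG,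
            facetChain_of_mem (P := {F | F ∈ Q ∧ ¬ τ ⊆ F}) ⟨hGQ, fun h => hGN (hτQ G hGQ h)⟩ hG]
        · rw [facetChain_of_notMem (fun h => hGQ h.1), facetChain_of_notMem (fun h => hGQ h.1)]
    · rw [facetChain_of_card_ne hG, facetChain_of_card_ne hG, if_neg (by omega), add_zero]
  refine ⟨?_, ?_, ?_, ?_, ?_, ?_⟩
  · exact ⟨hQ N hN _ (Finset.empty_subset _), fun h =>
      hσ.ne_empty (Finset.subset_empty.1 h)⟩
  · exact fun F hF G hG => ⟨hQ F hF.1 G hG, fun h => hF.2 (h.trans hG)⟩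
  · rintro F ⟨hF, hσF⟩
    by_cases hτF : τ ⊆ F
    · have := Finset.card_lt_card ((hτQ F hF hτF).ssubset_of_ne
        (by rintro rfl; exact hσF hσN))
      omega
    · exact hP.card_le F ⟨hF, hτF⟩
  · rintro F ⟨hF, hσF⟩
    obtain ⟨x, hxσ, hxF⟩ := Finset.not_subset.1 hσF
    have hcase : F ⊆ N → ∃ G ∈ {F | F ∈ Q ∧ ¬ σ ⊆ F}, F ⊆ G ∧ G.card = n + 1 := fun h =>
      ⟨N.erase x, ⟨(herase x hxσ).1, (herase x hxσ).2.1⟩, Finset.subset_erase.2 ⟨h, hxF⟩,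
        (herase x hxσ).2.2⟩
    by_cases hτF : τ ⊆ F
    · exact hcase (hτQ F hF hτF)
    · obtain ⟨G, hG, hFG, hGc⟩ := hP.facet F ⟨hF, hτF⟩
      by_cases hσG : σ ⊆ G
      · exact hcase (hFG.trans (hσQ G hG.1 hσG))
      · exact ⟨G, ⟨hG.1, hσG⟩, hFG, hGc⟩
  · have : facetChain n {F | F ∈ Q ∧ ¬ σ ⊆ F} =
        facetChain n {F | F ∈ Q ∧ ¬ τ ⊆ F} + bd (Pi.single N 1) := funext htop
    rw [this, map_add, hP.bd_facetChain, bd_bd, add_zero]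
  · rintro ρ ⟨hρ, hσρ⟩ c hc h0
    obtain ⟨x, hxσ, hxρ⟩ := Finset.not_subset.1 hσρ
    by_cases hτρ : τ ⊆ ρ
    · have hρN : ρ ⊂ N := (hτQ ρ hρ hτρ).ssubset_of_ne (by rintro rfl; exact hσρ hσN)
      have hc' : SuppOn {F | ρ ⊆ F ∧ F ⊂ N} c := fun F hF => hc F fun h =>
        hF ⟨h.2, (hτQ F h.1.1 (hτρ.trans h.2)).ssubset_of_ne
          (by rintro rfl; exact h.1.2 hσN)⟩
      obtain ⟨e, ε, he, hbe⟩ := exists_bd_eq_of_ssubset hρN hc' h0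
      refine ⟨e, ε, fun F hF => he F fun h => hF ⟨⟨hQ N hN F h.2.1, fun h' => ?_⟩, h.1⟩, ?_⟩
      · exact h.2.ne (hboth F h.2.1 h' (hτρ.trans h.1))
      · intro G hG
        rw [hbe G hG, htop G, facetChain_of_notMem (fun h => h.2 (hτρ.trans hG)), zero_add]
    · obtain ⟨y, hyτ, hyρ⟩ := Finset.not_subset.1 hτρ
      obtain ⟨h, hh, hch⟩ := exists_push hQ hN hτQ (hσN hxσ)
        (Finset.disjoint_left.1 hστ hxσ) hxρ (e := c)
        (fun F hF => hc F fun h => hF ⟨h.1.1, h.2⟩) (fun G hG _ => h0 G hG)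
      obtain ⟨e, ε, he, hbe⟩ := hP.homology ρ ⟨hρ, hτρ⟩ (c + rbd ρ h)
        (fun F hF => hch F fun h => hF ⟨⟨h.1, h.2.2⟩, h.2.1⟩) (fun G hG => by
          rw [map_add, Pi.add_apply, h0 G hG, bd_rbd hG, add_zero])
      have hbd1 : ∀ G, ρ ⊆ G → bd (Set.indicator {F | ρ ⊆ F} (e + h + ε • Pi.single N 1)) G =
          c G + ε * facetChain n {F | F ∈ Q ∧ ¬ σ ⊆ F} G := by
        intro G hG
        rw [bd_indicator_superset hG, map_add, map_add, map_smul, Pi.add_apply, Pi.add_apply,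
          hbe G hG, Pi.add_apply, rbd_of_subset hG, Pi.smul_apply, htop G, smul_eq_mul]
        linear_combination bd h G * zmod_two_eq_zero
      obtain ⟨h', hh', heh'⟩ := exists_push hQ hN hσQ (hτN hyτ)
        (Finset.disjoint_right.1 hστ hyτ) hyρ
        (e := Set.indicator {F | ρ ⊆ F} (e + h + ε • Pi.single N 1)) (by
          intro F hF
          by_cases hρF : ρ ⊆ F
          · rw [Set.indicator_of_mem (s := {F | ρ ⊆ F}) hρF]
            have hFQ : F ∉ Q := fun h => hF ⟨h, hρF⟩
            simp only [Pi.add_apply, Pi.smul_apply]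
            rw [he F fun h => hFQ h.1.1, hh F fun h => hFQ h.1,
              Pi.single_eq_of_ne (by rintro rfl; exact hFQ hN)]
            simp
          · exact Set.indicator_of_notMem (s := {F | ρ ⊆ F}) hρF _) (by
          intro G hG hσG
          rw [hbd1 G hG, hc G fun h => h.1.2 hσG, facetChain_of_notMem fun h => h.2 hσG]
          simp)
      refine ⟨_, ε, fun F hF => heh' F fun h => hF ⟨⟨h.1, h.2.2⟩, h.2.1⟩, ?_⟩
      intro G hG
      rw [map_add, Pi.add_apply, bd_rbd hG, add_zero, hbd1 G hG]

end Spheres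

section PLSpheres

variable {V : Type} [DecidableEq V] [Fintype V]

/-- A finite complex with the empty set adjoined. -/
def withEmpty {V : Type} (K : Finset (Finset V)) : Set (Finset V) := {F | F = ∅ ∨ F ∈ K}

theorem BistellarMove.sphereLike {n : ℕ} {K L : Finset (Finset V)} (h : BistellarMove K L)
    (hne : ∀ F ∈ K, F.Nonempty) (hK : SphereLike n (withEmpty K)) :
    SphereLike n (withEmpty L) := by
  obtain ⟨σ, τ, hσK, hτ, hτK, hlink, hL⟩ := h
  have hσ := hne σ hσK
  have hdown : ∀ F ∈ K, ∀ G, G ⊆ F → G.Nonempty → G ∈ K := fun F hF G hG hGne =>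
    (hK.down F (Or.inr hF) G hG).resolve_left hGne.ne_empty
  have hστ : Disjoint σ τ := by
    rw [Finset.disjoint_right]
    intro x hxτ hxσ
    by_cases h1 : {x} = τ
    · exact hτK (h1 ▸ hdown σ hσK {x} (by simpa using hxσ) (by simp))
    · have := ((hlink {x}).2 ⟨by simp, Finset.ssubset_iff_subset_ne.2 ⟨by simpa using hxτ, h1⟩⟩).2.1
      simp [hxσ] at this
  have hsub : ∀ ρ, ρ ⊂ τ → ρ ∪ σ ∈ K := by
    intro ρ hρ
    rcases ρ.eq_empty_or_nonempty with rfl | h1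
    · simpa using hσK
    · exact ((hlink ρ).2 ⟨h1, hρ⟩).2.2
  have hstar : ∀ F ∈ K, σ ⊆ F → F \ σ ⊂ τ := by
    intro F hF hσF
    rcases (F \ σ).eq_empty_or_nonempty with h1 | h1
    · rw [h1]; exact Finset.empty_ssubset.2 hτ
    · exact ((hlink _).1 ⟨hdown F hF _ Finset.sdiff_subset h1, Finset.sdiff_disjoint, by
        rwa [Finset.sdiff_union_of_subset hσF]⟩).2
  have hτnot : ∀ F ∈ K, ¬ τ ⊆ F := fun F hF hτF => hτK (hdown F hF τ hτF hτ)
  have hinK : ∀ F, F ⊆ σ ∪ τ → ¬ τ ⊆ F → F.Nonempty → F ∈ K := by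
    intro F hF hτF hFne
    refine hdown _ (hsub (F ∩ τ) (Finset.ssubset_iff_subset_ne.2
      ⟨Finset.inter_subset_right, fun h => hτF (Finset.inter_eq_right.1 h)⟩)) F ?_ hFne
    intro x hx
    rcases Finset.mem_union.1 (hF hx) with h | h <;> simp [h, hx]
  have hcard : (σ ∪ τ).card = n + 2 := by
    obtain ⟨x, hx⟩ := hτ
    obtain ⟨F, hF, hsF, hFc⟩ := hK.facet _ (Or.inr (hsub (τ.erase x) (Finset.erase_ssubset hx)))
    have hFK : F ∈ K := hF.resolve_left (by rintro rfl; simp at hFc)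
    have h1 := hstar F hFK (Finset.subset_union_right.trans hsF)
    have h2 := Finset.card_lt_card h1
    rw [Finset.card_sdiff_of_subset (Finset.subset_union_right.trans hsF)] at h2
    have h3 := Finset.card_le_card hsF
    have h4 : (τ.erase x ∪ σ).card = τ.card - 1 + σ.card := by
      rw [Finset.card_union_of_disjoint, Finset.card_erase_of_mem hx]
      exact hστ.symm.mono_left (Finset.erase_subset _ _)
    have h5 := Finset.card_pos.2 ⟨x, hx⟩
    rw [Finset.card_union_of_disjoint hστ]
    omega
  have hQ : ∀ F ∈ {F | F ∈ withEmpty K ∨ F ⊆ σ ∪ τ}, ∀ G, G ⊆ F →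
      G ∈ {F | F ∈ withEmpty K ∨ F ⊆ σ ∪ τ} := by
    rintro F (hF | hF) G hG
    · exact Or.inl (hK.down F hF G hG)
    · exact Or.inr (hG.trans hF)
  have hKQ : withEmpty K = {F | F ∈ {F | F ∈ withEmpty K ∨ F ⊆ σ ∪ τ} ∧ ¬ τ ⊆ F} := by
    ext F
    constructor
    · intro h
      refine ⟨Or.inl h, ?_⟩
      rcases h with rfl | h
      · exact fun h => hτ.ne_empty (Finset.subset_empty.1 h)
      · exact hτnot F h
    · rintro ⟨h | h, h'⟩
      · exact h
      · exact F.eq_empty_or_nonempty.imp id (hinK F h h')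
  have hLQ : withEmpty L = {F | F ∈ {F | F ∈ withEmpty K ∨ F ⊆ σ ∪ τ} ∧ ¬ σ ⊆ F} := by
    ext F
    rcases F.eq_empty_or_nonempty with rfl | hF
    · simp [withEmpty, hσ.ne_empty]
    · simp only [withEmpty, Set.mem_ofPred_eq, hF.ne_empty, false_or, hL]
      constructor
      · rintro (h | ⟨-, α, β, hα, hβ, rfl⟩)
        · exact ⟨Or.inl h.1, h.2⟩
        · refine ⟨Or.inr (Finset.union_subset_union hα.1 hβ), fun h => hα.2 fun x hx => ?_⟩
          exact (Finset.mem_union.1 (h hx)).resolve_right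
            fun hxβ => Finset.disjoint_left.1 hστ hx (hβ hxβ)
      · rintro ⟨h | h, h'⟩
        · exact Or.inl ⟨h, h'⟩
        · refine Or.inr ⟨hF, F ∩ σ, F ∩ τ, ?_, Finset.inter_subset_right, ?_⟩
          · exact Finset.ssubset_iff_subset_ne.2
              ⟨Finset.inter_subset_right, fun h => h' (Finset.inter_eq_right.1 h)⟩
          · rw [← Finset.inter_union_distrib_left, Finset.inter_eq_left.2 h]
  rw [hLQ]
  rw [hKQ] at hK
  refine SphereLike.flip hQ hστ hσ (Or.inr subset_rfl) hcard ?_ ?_ hK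
  · rintro F ((rfl | hF) | hF) hσF
    · exact Finset.empty_subset _
    · intro x hx
      by_cases h : x ∈ σ
      · simp [h]
      · exact Finset.mem_union_right _ ((hstar F hF hσF).1 (by simp [hx, h]))
    · exact hF
  · rintro F ((rfl | hF) | hF) hτF
    · exact Finset.empty_subset _
    · exact absurd hτF (hτnot F hF)
    · exact hF

theorem IsPLSphere.nonempty_and_sphereLike {n : ℕ} {S : Finset (Finset V)} (h : IsPLSphere n S) :
    (∀ F ∈ S, F.Nonempty) ∧ SphereLike n (withEmpty S) := by
  obtain ⟨N, hN, h⟩ := h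
  induction h with
  | refl =>
    refine ⟨fun F hF => (Finset.mem_filter.1 hF).2.1, ?_⟩
    convert sphereLike_ssubset hN using 1
    ext F
    simp only [withEmpty, Finset.mem_filter, Finset.mem_powerset, Set.mem_ofPred_eq]
    constructor
    · rintro (rfl | h)
      · exact Finset.empty_ssubset.2 (Finset.card_pos.1 (by omega))
      · exact h.1.ssubset_of_ne h.2.2
    · intro h
      exact F.eq_empty_or_nonempty.imp id fun hF => ⟨h.1, hF, h.ne⟩
  | tail _ hmove ih =>
    refine ⟨fun F hF => ?_, hmove.sphereLike ih.1 ih.2⟩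
    obtain ⟨σ, τ, -, -, -, -, hL⟩ := hmove
    rcases (hL F).1 hF with h | h
    · exact ih.1 F h.1
    · exact h.1

end PLSpheres

section Acyclic

variable {V : Type*} [DecidableEq V] [Fintype V]

/-- The relative homology of the complement of the open stars of the vertices of a face
vanishes. -/
theorem SphereLike.exists_bd_eq {n : ℕ} {P : Set (Finset V)} (hP : SphereLike n P)
    {A : Finset V} (hA : A.Nonempty) {ρ : Finset V} (hρA : Disjoint ρ A) (hρ : ρ ∪ A ∈ P)
    {c : Chain V} (hc : SuppOn {F | F ∈ P ∧ ρ ⊆ F ∧ Disjoint F A} c)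
    (h0 : ∀ G, ρ ⊆ G → bd c G = 0) :
    ∃ e : Chain V, SuppOn {F | F ∈ P ∧ ρ ⊆ F ∧ Disjoint F A} e ∧ ∀ G, ρ ⊆ G → bd e G = c G := by
  induction A using Finset.induction_on generalizing ρ c with
  | empty => exact absurd hA (by simp)
  | insert v A' hv ih =>
    have hvρ : v ∉ ρ := Finset.disjoint_right.1 hρA (by simp)
    have hρA' : Disjoint ρ A' := hρA.mono_right (Finset.subset_insert _ _)
    have hfill : ∀ ρ : Finset V, Disjoint ρ A' → ρ ∪ A' ∈ P → ∀ c : Chain V,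
        SuppOn {F | F ∈ P ∧ ρ ⊆ F ∧ Disjoint F A'} c → (∀ G, ρ ⊆ G → bd c G = 0) →
        ∃ f t : Chain V, SuppOn {F | F ∈ P ∧ ρ ⊆ F ∧ Disjoint F A'} f ∧
          SuppOn {F | F ∈ P ∧ Disjoint F A'} t ∧ bd t = 0 ∧
          ∀ G, ρ ⊆ G → bd f G = c G + t G := by
      intro ρ hρA hρ c hc h0
      rcases A'.eq_empty_or_nonempty with rfl | hA'
      · simp only [Finset.disjoint_empty_right, and_true] at hc ⊢
        obtain ⟨e, ε, he, hbe⟩ := hP.homology ρ (by simpa using hρ) c hc h0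
        refine ⟨e, ε • facetChain n P, he, fun F hF => ?_, ?_, hbe⟩
        · rw [Pi.smul_apply, facetChain_of_notMem (P := P) hF, smul_zero]
        · rw [map_smul, hP.bd_facetChain, smul_zero]
      · obtain ⟨e, he, hbe⟩ := ih hA' hρA hρ hc h0
        exact ⟨e, 0, he, fun _ _ => rfl, map_zero _, fun G hG => by simp [hbe G hG]⟩
    have hfirst : ∃ e : Chain V, SuppOn {F | F ∈ P ∧ ρ ⊆ F ∧ Disjoint F A'} e ∧
        ∀ G, ρ ⊆ G → bd e G = c G := by
      have hc' : SuppOn {F | F ∈ P ∧ ρ ⊆ F ∧ Disjoint F A'} c := fun F hF => hc F fun h =>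
        hF ⟨h.1, h.2.1, h.2.2.mono_right (Finset.subset_insert _ _)⟩
      rcases A'.eq_empty_or_nonempty with rfl | hA'
      · simp only [Finset.disjoint_empty_right, and_true] at hc' ⊢
        obtain ⟨e, ε, he, hbe⟩ := hP.homology ρ
          (hP.down _ hρ _ Finset.subset_union_left) c hc' h0
        obtain ⟨G, hG, hGs, hGc⟩ := hP.facet _ hρ
        have hρG : ρ ⊆ G := Finset.subset_union_left.trans hGs
        have h1 := hbe G hρG
        rw [facetChain_of_mem hG hGc, hc G fun h => Finset.disjoint_left.1 h.2.2
          (hGs (Finset.mem_union_right _ (Finset.mem_insert_self v _))) (by simp),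
          bd_eq_zero_of_forall] at h1
        · have hε : ε = 0 := by linear_combination -h1
          exact ⟨e, he, fun G hG => by simp [hbe G hG, hε]⟩
        · intro x hx
          refine he _ fun h => ?_
          have := hP.card_le _ h.1
          rw [Finset.card_insert_of_notMem hx] at this
          omega
      · exact ih hA' hρA' (hP.down _ hρ _ (Finset.union_subset_union subset_rfl
          (Finset.subset_insert _ _))) hc' h0
    obtain ⟨e, he, hbe⟩ := hfirst
    obtain ⟨f, t, hf, ht, hbt, hbf⟩ := hfill (insert v ρ)
      (by exact Finset.disjoint_insert_left.2 ⟨hv, hρA'⟩)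
      (hP.down _ hρ _ (by intro x; simp)) (Set.indicator {F : Finset V | v ∈ F} e)
      (fun F hF => by
        by_cases hvF : v ∈ F
        · rw [Set.indicator_of_mem (s := {F : Finset V | v ∈ F}) hvF]
          exact he F fun h => hF ⟨h.1, Finset.insert_subset hvF h.2.1, h.2.2⟩
        · exact Set.indicator_of_notMem (s := {F : Finset V | v ∈ F}) hvF _)
      (fun G hG => by
        have hvG : v ∈ G := hG (Finset.mem_insert_self _ _)
        have hρG : ρ ⊆ G := (Finset.subset_insert _ _).trans hG
        rw [bd_congr (c' := e) fun x _ => Set.indicator_of_mem (s := {F : Finset V | v ∈ F})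
          (Finset.mem_insert_of_mem hvG) _, hbe G hρG]
        exact hc G fun h => Finset.disjoint_left.1 h.2.2 hvG (by simp))
    have hf' : SuppOn {F | F ∈ P ∧ ρ ⊆ F ∧ Disjoint F A'} f := fun F hF => hf F fun h =>
      hF ⟨h.1, (Finset.subset_insert _ _).trans h.2.1, h.2.2⟩
    have ht' : SuppOn {F | F ∈ P ∧ ρ ⊆ F ∧ Disjoint F A'} (Set.indicator {F | ρ ⊆ F} t) := by
      intro F hF
      by_cases hρF : ρ ⊆ F
      · rw [Set.indicator_of_mem (s := {F | ρ ⊆ F}) hρF]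
        exact ht F fun h => hF ⟨h.1, hρF, h.2⟩
      · exact Set.indicator_of_notMem (s := {F | ρ ⊆ F}) hρF _
    refine ⟨e + rbd ρ f + Set.indicator {F | ρ ⊆ F} t, fun F hF => ?_, fun G hG => ?_⟩
    · by_cases hF' : F ∈ P ∧ ρ ⊆ F ∧ Disjoint F A'
      · have hvF : v ∈ F := by
          by_contra h
          exact hF ⟨hF'.1, hF'.2.1, Finset.disjoint_insert_right.2 ⟨h, hF'.2.2⟩⟩
        have hvρF := Finset.insert_subset hvF hF'.2.1
        rw [Pi.add_apply, Pi.add_apply, rbd_of_subset hF'.2.1, hbf F hvρF,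
          Set.indicator_of_mem (s := {F | ρ ⊆ F}) hF'.2.1,
          Set.indicator_of_mem (s := {F : Finset V | v ∈ F}) hvF]
        linear_combination (e F + t F) * zmod_two_eq_zero
      · exact ((he.add (hf'.rbd fun F hF G hρG hG => ⟨hP.down F hF.1 G hG, hρG,
          hF.2.2.mono_left hG⟩)).add ht') F hF'
    · rw [map_add, map_add, Pi.add_apply, Pi.add_apply, bd_rbd hG, bd_indicator_superset hG,
        hbt, hbe G hG]
      simp

end Acyclic

section Joins

variable {V : Type*} [DecidableEq V] [Fintype V]

open Finset (disjSum)

/-- The part of a chain supported on the sets of size `k`. -/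
def homog {W : Type*} (k : ℕ) (c : Chain W) : Chain W := fun F => if F.card = k then c F else 0

theorem bd_homog {W : Type*} [DecidableEq W] [Fintype W] (k : ℕ) (c : Chain W) :
    bd (homog (k + 1) c) = homog k (bd c) := by
  funext G
  simp only [bd_apply, homog]
  split_ifs with h
  · exact Finset.sum_congr rfl fun x _ => by split_ifs with hx <;> simp_all
  · refine Finset.sum_eq_zero fun x _ => ?_
    split_ifs with hx h'
    · rfl
    · rw [Finset.card_insert_of_notMem hx] at h'
      omega
    · rfl

theorem SuppOn.homog {W : Type*} {P : Set (Finset W)} {c : Chain W} (h : SuppOn P c) (k : ℕ) :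
    SuppOn {F | F ∈ P ∧ F.card = k} (homog k c) := by
  intro F hF
  unfold _root_.homog
  split_ifs with hk
  · exact h F fun hP => hF ⟨hP, hk⟩
  · rfl

theorem homog_of_suppOn {W : Type*} {P : Set (Finset W)} {k : ℕ} {c : Chain W}
    (h : SuppOn {F | F ∈ P ∧ F.card = k} c) : homog k c = c := by
  funext F
  unfold homog
  split_ifs with hk
  · rfl
  · exact (h F fun h => hk h.2).symm

theorem SuppOn.mono {W : Type*} {P Q : Set (Finset W)} {c : Chain W} (h : SuppOn P c)
    (hPQ : ∀ F ∈ P, F ∈ Q) : SuppOn Q c := fun F hF => h F fun hP => hF (hPQ F hP)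

theorem SuppOn.bd {W : Type*} [DecidableEq W] [Fintype W] {P : Set (Finset W)} {c : Chain W}
    (hP : ∀ F ∈ P, ∀ G, G ⊆ F → G ∈ P) (h : SuppOn P c) : SuppOn P (bd c) := fun G hG =>
  bd_eq_zero_of_forall fun x _ => h _ fun hx => hG (hP _ hx _ (Finset.subset_insert x G))

theorem bd_disjSum (c : Chain (V ⊕ V)) (σ τ : Finset V) :
    bd c (disjSum σ τ) = bd (fun ρ => c (disjSum ρ τ)) σ + bd (fun ρ => c (disjSum σ ρ)) τ := by
  simp only [bd_apply, Fintype.sum_sum_type]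
  congr 1
  · refine Finset.sum_congr rfl fun x _ => ?_
    have : insert (Sum.inl x) (disjSum σ τ) = disjSum (insert x σ) τ := by
      ext (y | y) <;> simp
    simp [this]
  · refine Finset.sum_congr rfl fun x _ => ?_
    have : insert (Sum.inr x) (disjSum σ τ) = disjSum σ (insert x τ) := by
      ext (y | y) <;> simp
    simp [this]

/-- A cycle on a join can be moved to the columns over small sets if the columns over
larger sets are acyclic. -/
theorem exists_add_bd_suppOn {D : Set (Finset (V ⊕ V))} (hD : ∀ F ∈ D, ∀ G, G ⊆ F → G ∈ D)
    {k : ℕ} (hcol : ∀ τ : Finset V, k ≤ τ.card → ∀ c : Chain V,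
      SuppOn {σ | disjSum σ τ ∈ D} c → bd c = 0 →
        ∃ e : Chain V, SuppOn {σ | disjSum σ τ ∈ D} e ∧ bd e = c)
    {j : ℕ} {z : Chain (V ⊕ V)} (hz : SuppOn {F | F ∈ D ∧ F.card = j} z) (hbz : bd z = 0) :
    ∃ u : Chain (V ⊕ V), SuppOn {F | F ∈ D ∧ F.card = j + 1} u ∧
      SuppOn {F | (F ∈ D ∧ F.toRight.card < k) ∧ F.card = j} (z + bd u) := by
  have key : ∀ m : ℕ, ∀ z : Chain (V ⊕ V), SuppOn {F | F ∈ D ∧ F.toRight.card < k + m} z →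
      bd z = 0 → ∃ u : Chain (V ⊕ V), SuppOn D u ∧
        SuppOn {F | F ∈ D ∧ F.toRight.card < k} (z + bd u) := by
    intro m
    induction m with
    | zero => exact fun z hz _ => ⟨0, fun _ _ => rfl, by simpa using hz⟩
    | succ m ih =>
      intro z hz hbz
      have h1 : ∀ τ : Finset V, ∃ e : Chain V, SuppOn {σ | disjSum σ τ ∈ D} e ∧
          (τ.card = k + m → bd e = fun σ => z (disjSum σ τ)) := by
        intro τ
        by_cases hτ : τ.card = k + m
        · obtain ⟨e, he, hbe⟩ := hcol τ (by omega) (fun σ => z (disjSum σ τ))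
            (fun σ hσ => hz _ fun h => hσ h.1) (by
              funext σ
              have h2 := congrFun hbz (disjSum σ τ)
              rw [bd_disjSum, bd_eq_zero_of_forall (c := fun ρ => z (disjSum σ ρ)), add_zero] at h2
              · exact h2
              · intro x hx
                refine hz _ fun h => ?_
                have := h.2
                rw [Finset.toRight_disjSum, Finset.card_insert_of_notMem hx] at this
                omega)
          exact ⟨e, he, fun _ => hbe⟩
        · exact ⟨0, fun _ _ => rfl, fun h => absurd h hτ⟩
      choose e he hbe using h1
      set u : Chain (V ⊕ V) := fun F =>
        if F.toRight.card = k + m then e F.toRight F.toLeft else 0 with hu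
      have huD : SuppOn D u := by
        intro F hF
        simp only [hu]
        split_ifs
        · exact he _ _ fun h => hF ((Finset.toLeft_disjSum_toRight (u := F)) ▸ h)
        · rfl
      obtain ⟨u', hu', hs⟩ := ih (z + bd u) (by
        intro F hF
        by_cases hFD : F ∈ D
        · have hFc : ¬ F.toRight.card < k + m := fun h => hF ⟨hFD, h⟩
          obtain ⟨σ, τ, rfl⟩ : ∃ σ τ, F = disjSum σ τ :=
            ⟨F.toLeft, F.toRight, Finset.toLeft_disjSum_toRight.symm⟩
          rw [Finset.toRight_disjSum] at hFc
          rw [Pi.add_apply, bd_disjSum, bd_eq_zero_of_forall (c := fun ρ => u (disjSum σ ρ)),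
            add_zero]
          · by_cases hτ : τ.card = k + m
            · have : (fun ρ => u (disjSum ρ τ)) = e τ := by
                funext ρ
                simp [hu, hτ]
              rw [this, hbe τ hτ, zmod_two_add_self]
            · rw [hz _ fun h => by have := h.2; rw [Finset.toRight_disjSum] at this; omega,
                bd_eq_zero_of_forall, zero_add]
              intro x _
              simp [hu, hτ]
          · intro x hx
            have : (insert x τ).card ≠ k + m := by
              rw [Finset.card_insert_of_notMem hx]
              omega
            simp [hu, this]
        · rw [Pi.add_apply, hz F fun h => hFD h.1, huD.bd hD F hFD, add_zero])
        (by rw [map_add, hbz, bd_bd, add_zero])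
      refine ⟨u + u', huD.add hu', ?_⟩
      rwa [map_add, ← add_assoc]
  obtain ⟨u, hu, hs⟩ := key (Fintype.card V + 1) z (fun F hF => hz F fun h => hF ⟨h.1, by
    have := Finset.card_le_univ F.toRight
    omega⟩) hbz
  refine ⟨homog (j + 1) u, hu.homog _, ?_⟩
  have : z + bd (homog (j + 1) u) = homog j (z + bd u) := by
    rw [bd_homog]
    conv_lhs => rw [← homog_of_suppOn hz]
    funext F
    simp only [homog, Pi.add_apply]
    split_ifs <;> simp
  rw [this]
  exact hs.homog j

/-- Exchange of the two factors of a join. -/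
def swapFactors {V : Type*} (F : Finset (V ⊕ V)) : Finset (V ⊕ V) :=
  F.map (Equiv.sumComm V V).toEmbedding

omit [Fintype V] [DecidableEq V] in
@[simp] theorem mem_swapFactors {F : Finset (V ⊕ V)} {x : V ⊕ V} :
    x ∈ swapFactors F ↔ x.swap ∈ F := by
  simp [swapFactors, Finset.mem_map_equiv]

omit [Fintype V] [DecidableEq V] in
@[simp] theorem swapFactors_swapFactors (F : Finset (V ⊕ V)) :
    swapFactors (swapFactors F) = F := by
  ext; simp

omit [Fintype V] [DecidableEq V] in
@[simp] theorem card_swapFactors (F : Finset (V ⊕ V)) : (swapFactors F).card = F.card := by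
  simp [swapFactors]

omit [Fintype V] [DecidableEq V] in
@[simp] theorem toLeft_swapFactors (F : Finset (V ⊕ V)) : (swapFactors F).toLeft = F.toRight := by
  ext; simp

omit [Fintype V] [DecidableEq V] in
@[simp] theorem toRight_swapFactors (F : Finset (V ⊕ V)) : (swapFactors F).toRight = F.toLeft := by
  ext; simp

omit [Fintype V] in
theorem swapFactors_insert (x : V ⊕ V) (F : Finset (V ⊕ V)) :
    swapFactors (insert x F) = insert x.swap (swapFactors F) := by
  ext y
  simp only [mem_swapFactors, Finset.mem_insert]
  rw [← Sum.swap_rightInverse.injective.eq_iff, Sum.swap_swap]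

omit [Fintype V] in
theorem swapFactors_erase (x : V ⊕ V) (F : Finset (V ⊕ V)) :
    swapFactors (F.erase x) = (swapFactors F).erase x.swap := by
  ext y
  simp only [mem_swapFactors, Finset.mem_erase, ne_eq]
  rw [← Sum.swap_rightInverse.injective.eq_iff, Sum.swap_swap]

/-- The action on chains of the exchange of the two factors. -/
def swapChain {V : Type*} (c : Chain (V ⊕ V)) : Chain (V ⊕ V) := fun F => c (swapFactors F)

omit [Fintype V] [DecidableEq V] in
theorem swapChain_swapChain (c : Chain (V ⊕ V)) : swapChain (swapChain c) = c := by
  funext F; simp [swapChain]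

omit [Fintype V] [DecidableEq V] in
theorem swapChain_add (c c' : Chain (V ⊕ V)) :
    swapChain (c + c') = swapChain c + swapChain c' := rfl

omit [Fintype V] [DecidableEq V] in
theorem swapChain_smul (r : ZMod 2) (c : Chain (V ⊕ V)) :
    swapChain (r • c) = r • swapChain c := rfl

theorem bd_swapChain (c : Chain (V ⊕ V)) : bd (swapChain c) = swapChain (bd c) := by
  funext G
  simp only [bd_apply, swapChain, swapFactors_insert]
  refine Fintype.sum_equiv (Equiv.sumComm V V) _ _ fun x => ?_
  simp

/-- The pairing of a cochain with a chain. -/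
def pairing {W : Type*} [Fintype W] [DecidableEq W] (a c : Chain W) : ZMod 2 := ∑ F, a F * c F

theorem pairing_add {W : Type*} [Fintype W] [DecidableEq W] (a c c' : Chain W) :
    pairing a (c + c') = pairing a c + pairing a c' := by
  simp [pairing, mul_add, Finset.sum_add_distrib]

theorem pairing_smul {W : Type*} [Fintype W] [DecidableEq W] (a c : Chain W) (r : ZMod 2) :
    pairing a (r • c) = r * pairing a c := by
  simp only [pairing, Finset.mul_sum, Pi.smul_apply, smul_eq_mul]
  exact Finset.sum_congr rfl fun F _ => by ring

theorem pairing_bd {W : Type*} [Fintype W] [DecidableEq W] (a c : Chain W) :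
    pairing a (bd c) = pairing (cobd a) c := sum_mul_bd a c

theorem pairing_swapChain (a c : Chain (V ⊕ V)) :
    pairing a (swapChain c) = pairing (swapChain a) c := by
  refine Finset.sum_nbij' swapFactors swapFactors ?_ ?_ ?_ ?_ ?_ <;> simp [swapChain]

theorem pairing_congr {W : Type*} [Fintype W] [DecidableEq W] {P : Set (Finset W)}
    {a a' c : Chain W} (hc : SuppOn P c) (h : ∀ F ∈ P, a F = a' F) :
    pairing a c = pairing a' c := by
  refine Finset.sum_congr rfl fun F _ => ?_
  by_cases hF : F ∈ P
  · rw [h F hF]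
  · rw [hc F hF, mul_zero, mul_zero]

theorem pairing_eq_zero {W : Type*} [Fintype W] [DecidableEq W] {P : Set (Finset W)}
    {a c : Chain W} (hc : SuppOn P c) (h : ∀ F ∈ P, a F = 0) : pairing a c = 0 := by
  rw [pairing_congr (a' := 0) hc h]
  simp [pairing]

end Joins

section SphereJoins

theorem suppOn_facetChain {V : Type*} {n : ℕ} {P : Set (Finset V)} :
    SuppOn {σ | σ ∈ P ∧ σ.card = n + 1} (facetChain n P) := by
  intro F hF
  by_cases h : F ∈ P
  · exact facetChain_of_card_ne fun h' => hF ⟨h, h'⟩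
  · exact facetChain_of_notMem h

variable {V : Type*} [DecidableEq V]

open Finset (disjSum)

/-- The deleted join of a complex with itself. -/
def deletedJoin {V : Type*} (P : Set (Finset V)) : Set (Finset (V ⊕ V)) :=
  {F | F.toLeft ∈ P ∧ F.toRight ∈ P ∧ Disjoint F.toLeft F.toRight}

theorem deletedJoin_down {V : Type*} {P : Set (Finset V)} (hP : ∀ F ∈ P, ∀ G, G ⊆ F → G ∈ P) :
    ∀ F ∈ deletedJoin P, ∀ G, G ⊆ F → G ∈ deletedJoin P := fun _ hF _ hG =>
  ⟨hP _ hF.1 _ (Finset.toLeft_subset_toLeft hG), hP _ hF.2.1 _ (Finset.toRight_subset_toRight hG),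
    (hF.2.2.mono_left (Finset.toLeft_subset_toLeft hG)).mono_right
      (Finset.toRight_subset_toRight hG)⟩

theorem swapFactors_mem_deletedJoin {V : Type*} {P : Set (Finset V)} {F : Finset (V ⊕ V)}
    (hF : F ∈ deletedJoin P) : swapFactors F ∈ deletedJoin P := by
  simpa [deletedJoin] using ⟨hF.2.1, hF.1, hF.2.2.symm⟩

/-- A chain, placed in the left factor of the join. -/
def leftCopy (c : Chain V) : Chain (V ⊕ V) := fun F => if F.toRight = ∅ then c F.toLeft else 0

theorem leftCopy_suppOn {P : Set (Finset V)} {k : ℕ} {c : Chain V} (h0 : ∅ ∈ P)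
    (h : SuppOn {σ | σ ∈ P ∧ σ.card = k} c) :
    SuppOn {F | (F ∈ deletedJoin P ∧ F.toRight = ∅) ∧ F.card = k} (leftCopy c) := by
  intro F hF
  unfold leftCopy
  split_ifs with hr
  · refine h _ fun hl => hF ⟨⟨⟨hl.1, hr ▸ h0, hr ▸ Finset.disjoint_empty_right _⟩, hr⟩, ?_⟩
    rw [← Finset.card_toLeft_add_card_toRight, hr, hl.2, Finset.card_empty, add_zero]
  · rfl

theorem leftCopy_smul (r : ZMod 2) (c : Chain V) : leftCopy (r • c) = r • leftCopy c := by
  funext F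
  simp [leftCopy]

variable [Fintype V]

theorem bd_leftCopy (c : Chain V) : bd (leftCopy c) = leftCopy (bd c) := by
  funext F
  obtain ⟨σ, τ, rfl⟩ : ∃ σ τ, F = disjSum σ τ :=
    ⟨F.toLeft, F.toRight, Finset.toLeft_disjSum_toRight.symm⟩
  rw [bd_disjSum, bd_eq_zero_of_forall (c := fun ρ => leftCopy c (disjSum σ ρ)), add_zero]
  · by_cases hτ : τ = ∅
    · subst hτ
      simp only [leftCopy, Finset.toRight_disjSum, Finset.toLeft_disjSum, if_true]
    · simp only [leftCopy, Finset.toRight_disjSum, hτ, if_false]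
      exact congrFun (map_zero bd) σ
  · intro x _
    simp [leftCopy]

variable {n : ℕ} {P : Set (Finset V)}

theorem SphereLike.exists_bd_eq_add (hP : SphereLike n P) {j : ℕ} {c : Chain V}
    (hc : SuppOn {σ | σ ∈ P ∧ σ.card = j} c) (h0 : bd c = 0) :
    ∃ (e : Chain V) (ε : ZMod 2), SuppOn {σ | σ ∈ P ∧ σ.card = j + 1} e ∧
      c + bd e = ε • facetChain n P ∧ (j ≠ n + 1 → ε = 0) := by
  obtain ⟨e, ε, he, hbe⟩ := hP.homology ∅ hP.empty_mem c
    (fun F hF => hc F fun h => hF ⟨h.1, Finset.empty_subset F⟩) (fun G _ => congrFun h0 G)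
  have he' : SuppOn P e := he.mono fun F hF => hF.1
  have hbe' : c + bd e = ε • facetChain n P := by
    funext G
    simp only [Pi.add_apply, hbe G (Finset.empty_subset G), Pi.smul_apply, smul_eq_mul]
    linear_combination c G * zmod_two_eq_zero
  have key : c + bd (homog (j + 1) e) = homog j (ε • facetChain n P) := by
    rw [bd_homog, ← hbe']
    conv_lhs => rw [← homog_of_suppOn hc]
    funext F
    simp only [homog, Pi.add_apply]
    split_ifs <;> simp
  by_cases hj : j = n + 1
  · subst hj
    refine ⟨_, ε, he'.homog _, ?_, fun h => absurd rfl h⟩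
    rw [key, homog_of_suppOn ((suppOn_facetChain (P := P)).smul ε)]
  · refine ⟨_, 0, he'.homog _, ?_, fun _ => rfl⟩
    rw [key, zero_smul]
    funext F
    unfold homog
    split_ifs with h
    · rw [Pi.smul_apply, facetChain_of_card_ne (by omega), smul_zero, Pi.zero_apply]
    · rfl

theorem SphereLike.exists_add_bd_eq_leftCopy (hP : SphereLike n P) (m : ℕ) {j : ℕ}
    {z : Chain (V ⊕ V)}
    (hz : SuppOn {F | (F ∈ deletedJoin P ∧ F.toRight.card ≤ m) ∧ F.card = j} z)
    (hbz : bd z = 0) : ∃ (u : Chain (V ⊕ V)) (c : Chain V),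
      SuppOn {F | (F ∈ deletedJoin P ∧ F.toRight.card ≤ m) ∧ F.card = j + 1} u ∧
      SuppOn {σ | σ ∈ P ∧ σ.card = j} c ∧ bd c = 0 ∧ z + bd u = leftCopy c := by
  have hD : ∀ F ∈ {F | F ∈ deletedJoin P ∧ F.toRight.card ≤ m}, ∀ G, G ⊆ F →
      G ∈ {F | F ∈ deletedJoin P ∧ F.toRight.card ≤ m} := fun F hF G hG =>
    ⟨deletedJoin_down hP.down F hF.1 G hG,
      (Finset.card_le_card (Finset.toRight_subset_toRight hG)).trans hF.2⟩
  obtain ⟨u, hu, hs⟩ := exists_add_bd_suppOn hD (k := 1) (by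
    intro τ hτ c hc hbc
    by_cases hτP : τ ∈ P ∧ τ.card ≤ m
    · obtain ⟨e, he, hbe⟩ := hP.exists_bd_eq (A := τ) (ρ := ∅) (Finset.card_pos.1 hτ)
        (Finset.disjoint_empty_left _) (by simpa using hτP.1) (c := c)
        (fun σ hσ => hc σ fun h => hσ ⟨by simpa using h.1.1, Finset.empty_subset _,
          by simpa using h.1.2.2⟩) (fun G _ => congrFun hbc G)
      refine ⟨e, fun σ hσ => he σ fun h => hσ ⟨⟨?_, ?_, ?_⟩, ?_⟩, funext fun G =>
        hbe G (Finset.empty_subset G)⟩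
      · simpa using h.1
      · simpa using hτP.1
      · simpa using h.2.2
      · simpa using hτP.2
    · refine ⟨0, fun _ _ => rfl, ?_⟩
      rw [map_zero]
      funext σ
      refine (hc σ fun h => hτP ⟨?_, ?_⟩).symm
      · simpa using h.1.2.1
      · simpa using h.2) hz hbz
  have heq : z + bd u = leftCopy (fun σ => (z + bd u) (disjSum σ ∅)) := by
    funext F
    unfold leftCopy
    split_ifs with h
    · change _ = (z + bd u) (disjSum F.toLeft ∅)
      rw [← h, Finset.toLeft_disjSum_toRight]
    · exact hs F fun h' => h (Finset.card_eq_zero.1 (by have := h'.1.2; omega))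
  refine ⟨u, fun σ => (z + bd u) (disjSum σ ∅), hu, ?_, ?_, heq⟩
  · intro σ hσ
    refine hs _ fun h => hσ ⟨by simpa [-Finset.disjSum_empty] using h.1.1.1.1, ?_⟩
    have := h.2
    rwa [Finset.card_disjSum, Finset.card_empty, add_zero] at this
  · have h1 : bd (leftCopy fun σ => (z + bd u) (disjSum σ ∅)) = 0 := by
      rw [← heq, map_add, hbz, bd_bd, add_zero]
    rw [bd_leftCopy] at h1
    funext σ
    simpa [leftCopy, -Finset.disjSum_empty] using congrFun h1 (disjSum σ ∅)

theorem SphereLike.exists_add_bd_eq_smul (hP : SphereLike n P) {j : ℕ} {z : Chain (V ⊕ V)}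
    (hz : SuppOn {F | F ∈ deletedJoin P ∧ F.card = j} z) (hbz : bd z = 0) :
    ∃ (u : Chain (V ⊕ V)) (ε : ZMod 2), SuppOn {F | F ∈ deletedJoin P ∧ F.card = j + 1} u ∧
      z + bd u = ε • leftCopy (facetChain n P) ∧ (j ≠ n + 1 → ε = 0) := by
  obtain ⟨u, c, hu, hc, hbc, hzu⟩ := hP.exists_add_bd_eq_leftCopy (Fintype.card V)
    (hz.mono fun F hF => show _ ∧ _ from ⟨⟨hF.1, Finset.card_le_univ _⟩, hF.2⟩) hbz
  obtain ⟨e, ε, he, hce, hε⟩ := hP.exists_bd_eq_add hc hbc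
  refine ⟨u + leftCopy e, ε, (hu.mono fun F hF => show _ ∧ _ from ⟨hF.1.1, hF.2⟩).add
    ((leftCopy_suppOn hP.empty_mem he).mono fun F hF => show _ ∧ _ from ⟨hF.1.1, hF.2⟩), ?_, hε⟩
  rw [map_add, ← add_assoc, hzu, bd_leftCopy, ← leftCopy_smul, ← hce]
  funext F
  simp only [leftCopy, Pi.add_apply]
  split_ifs <;> simp

end SphereJoins

section Extension

variable {V : Type*} [DecidableEq V]

/-- The partial coboundary, in the left (`b = true`) or right (`b = false`) factor. -/
def partialCobd (b : Bool) (a : Chain (V ⊕ V)) : Chain (V ⊕ V) :=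
  fun F => ∑ x ∈ F with x.isLeft = b, a (F.erase x)

theorem cobd_eq_add (a : Chain (V ⊕ V)) (F : Finset (V ⊕ V)) :
    cobd a F = partialCobd true a F + partialCobd false a F := by
  unfold partialCobd cobd
  rw [← Finset.sum_filter_add_sum_filter_not F (fun x => x.isLeft = true)]
  simp

theorem partialCobd_congr {b : Bool} {a a' : Chain (V ⊕ V)} {F : Finset (V ⊕ V)}
    (h : ∀ x ∈ F, x.isLeft = b → a (F.erase x) = a' (F.erase x)) :
    partialCobd b a F = partialCobd b a' F :=
  Finset.sum_congr rfl fun x hx => h x (Finset.mem_filter.1 hx).1 (Finset.mem_filter.1 hx).2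

theorem partialCobd_add (b : Bool) (a a' : Chain (V ⊕ V)) :
    partialCobd b (a + a') = partialCobd b a + partialCobd b a' := by
  funext F
  simp [partialCobd, Finset.sum_add_distrib]

theorem partialCobd_eq_zero {b : Bool} {a : Chain (V ⊕ V)} {F : Finset (V ⊕ V)}
    (h : ∀ x ∈ F, x.isLeft = b → a (F.erase x) = 0) : partialCobd b a F = 0 := by
  rw [partialCobd_congr (a' := 0) h]
  simp [partialCobd]

theorem partialCobd_partialCobd [Fintype V] (b b' : Bool) (a : Chain (V ⊕ V))
    (F : Finset (V ⊕ V)) : partialCobd b (partialCobd b' a) F =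
      ∑ x, ∑ y, if (x ∈ F ∧ x.isLeft = b) ∧ (y ∈ F ∧ y.isLeft = b') ∧ x ≠ y
        then a ((F.erase x).erase y) else 0 := by
  unfold partialCobd
  rw [Finset.sum_filter, ← Finset.sum_subset (Finset.subset_univ F)]
  · refine Finset.sum_congr rfl fun x hx => ?_
    split_ifs with h
    · rw [← Finset.sum_filter]
      refine Finset.sum_congr ?_ fun _ _ => rfl
      ext y
      simp only [Finset.mem_filter, Finset.mem_erase, Finset.mem_univ, true_and, ne_eq, hx, h]
      tauto
    · simp [h]
  · intro x _ hx
    simp [hx]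

theorem partialCobd_comm [Fintype V] (b b' : Bool) (a : Chain (V ⊕ V)) :
    partialCobd b (partialCobd b' a) = partialCobd b' (partialCobd b a) := by
  funext F
  rw [partialCobd_partialCobd, partialCobd_partialCobd, Finset.sum_comm]
  refine Finset.sum_congr rfl fun x _ => Finset.sum_congr rfl fun y _ => ?_
  rw [Finset.erase_right_comm]
  refine if_congr ?_ rfl rfl
  tauto

theorem partialCobd_self [Fintype V] (b : Bool) (a : Chain (V ⊕ V)) :
    partialCobd b (partialCobd b a) = 0 := by
  funext F
  rw [partialCobd_partialCobd]
  refine sum_sum_eq_zero_of_symm _ (fun x y => ?_) (fun x => by simp)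
  rw [Finset.erase_right_comm]
  refine if_congr ?_ rfl rfl
  tauto

theorem partialCobd_swapChain (b : Bool) (a : Chain (V ⊕ V)) (F : Finset (V ⊕ V)) :
    partialCobd b (swapChain a) F = partialCobd (!b) a (swapFactors F) := by
  refine Finset.sum_nbij' Sum.swap Sum.swap ?_ ?_ ?_ ?_ ?_
  · rintro (x | x) <;> simp +contextual
  · rintro (x | x) <;> simp +contextual
  · simp
  · simp
  · intro x _
    rw [swapChain, swapFactors_erase]

theorem card_toLeft_erase {x : V ⊕ V} {F : Finset (V ⊕ V)} (hx : x ∈ F) (hl : x.isLeft = true) :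
    (F.erase x).toLeft.card + 1 = F.toLeft.card ∧ (F.erase x).toRight.card = F.toRight.card := by
  obtain x | x := x
  · have h1 : (F.erase (Sum.inl x)).toLeft = F.toLeft.erase x := by ext; simp
    have h2 : (F.erase (Sum.inl x)).toRight = F.toRight := by ext; simp
    rw [h1, h2]
    exact ⟨Finset.card_erase_add_one (by simpa using hx), rfl⟩
  · simp at hl

theorem card_toRight_erase {x : V ⊕ V} {F : Finset (V ⊕ V)} (hx : x ∈ F) (hl : x.isLeft = false) :
    (F.erase x).toRight.card + 1 = F.toRight.card ∧ (F.erase x).toLeft.card = F.toLeft.card := by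
  obtain x | x := x
  · simp at hl
  · have h1 : (F.erase (Sum.inr x)).toRight = F.toRight.erase x := by ext; simp
    have h2 : (F.erase (Sum.inr x)).toLeft = F.toLeft := by ext; simp
    rw [h1, h2]
    exact ⟨Finset.card_erase_add_one (by simpa using hx), rfl⟩

/-- The extension of a cochain, from the deleted join of the `d`-skeleton of a complex to the
deleted join of the complex. -/
def extendCochain (d : ℕ) (a : Chain (V ⊕ V)) : Chain (V ⊕ V) := fun F =>
  if d + 1 < F.toRight.card then 0
  else if F.toLeft.card ≤ d + 1 then a F
  else if F.toLeft.card = d + 2 then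
    partialCobd true a F + partialCobd false (partialCobd true a) F
  else 0

variable {d : ℕ} {a : Chain (V ⊕ V)} {F : Finset (V ⊕ V)}

theorem extendCochain_of_le (hl : F.toLeft.card ≤ d + 1) (hr : F.toRight.card ≤ d + 1) :
    extendCochain d a F = a F := by
  rw [extendCochain, if_neg (by omega), if_pos hl]

theorem extendCochain_of_lt_right (hr : d + 1 < F.toRight.card) :
    extendCochain d a F = 0 := by
  rw [extendCochain, if_pos hr]

theorem extendCochain_of_eq (hl : F.toLeft.card = d + 2) (hr : F.toRight.card ≤ d + 1) :
    extendCochain d a F = partialCobd true a F + partialCobd false (partialCobd true a) F := by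
  rw [extendCochain, if_neg (by omega), if_neg (by omega), if_pos hl]

theorem extendCochain_of_lt_left (hl : d + 2 < F.toLeft.card) :
    extendCochain d a F = 0 := by
  unfold extendCochain
  split_ifs <;> first | rfl | omega

variable [Fintype V] {P : Set (Finset V)}

theorem extendCochain_add_swap (hP : ∀ F ∈ P, ∀ G, G ⊆ F → G ∈ P)
    (ha : ∀ F ∈ deletedJoin P, F.toLeft.card ≤ d + 1 → F.toRight.card ≤ d + 1 → F ≠ ∅ →
      a F + a (swapFactors F) = cobd a F)
    (hF : F ∈ deletedJoin P) (hne : F ≠ ∅) (hcard : F.card ≤ 2 * d + 3) :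
    extendCochain d a F + extendCochain d a (swapFactors F) = cobd (extendCochain d a) F := by
  have hsum := Finset.card_toLeft_add_card_toRight (u := F)
  rw [cobd_eq_add]
  rcases le_or_gt F.toLeft.card (d + 1) with hl | hl
  · rcases le_or_gt F.toRight.card (d + 1) with hr | hr
    · rw [extendCochain_of_le hl hr, extendCochain_of_le (by simpa using hr) (by simpa using hl),
        ha F hF hl hr hne, cobd_eq_add]
      congr 1
      · refine partialCobd_congr fun x hx hxl => (extendCochain_of_le ?_ ?_).symm <;>
        have := card_toLeft_erase hx hxl <;> omega
      · refine partialCobd_congr fun x hx hxl => (extendCochain_of_le ?_ ?_).symm <;>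
        have := card_toRight_erase hx hxl <;> omega
    · rw [extendCochain_of_lt_right hr, zero_add, partialCobd_eq_zero (b := true), zero_add]
      · rcases Nat.eq_or_lt_of_le (show d + 2 ≤ F.toRight.card from hr) with hr' | hr'
        · rw [extendCochain_of_eq (by simpa using hr'.symm) (by simpa using hl)]
          have h1 : partialCobd false (extendCochain d a) F =
              partialCobd true (swapChain a) (swapFactors F) := by
            rw [partialCobd_swapChain, swapFactors_swapFactors]
            refine partialCobd_congr fun x hx hxl => extendCochain_of_le ?_ ?_ <;>
            have := card_toRight_erase hx hxl <;> omega
          have h2 : partialCobd true (swapChain a) (swapFactors F) =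
              partialCobd true (a + partialCobd true a + partialCobd false a) (swapFactors F) := by
            refine partialCobd_congr fun x hx hxl => ?_
            have h3 := card_toLeft_erase hx hxl
            rw [toLeft_swapFactors, toRight_swapFactors] at h3
            have h4 := ha _ (deletedJoin_down hP _ (swapFactors_mem_deletedJoin hF) _
              (Finset.erase_subset x _)) (by omega) (by omega) (by
                intro h
                have h5 := Finset.card_toLeft_add_card_toRight (u := (swapFactors F).erase x)
                have h6 : ((swapFactors F).erase x).card = 0 := by rw [h, Finset.card_empty]
                omega)
            rw [cobd_eq_add] at h4
            simp only [swapChain, Pi.add_apply]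
            linear_combination h4 - a ((swapFactors F).erase x) * zmod_two_eq_zero
          rw [h1, h2, partialCobd_add, partialCobd_add, partialCobd_self,
            partialCobd_comm true false]
          simp
        · rw [extendCochain_of_lt_left (by simpa using hr'), partialCobd_eq_zero]
          intro x hx hxl
          have := card_toRight_erase hx hxl
          exact extendCochain_of_lt_right (by omega)
      · intro x hx hxl
        have := card_toLeft_erase hx hxl
        exact extendCochain_of_lt_right (by omega)
  · rw [extendCochain_of_lt_right (F := swapFactors F) (by simpa using hl), add_zero]
    rcases Nat.eq_or_lt_of_le (show d + 2 ≤ F.toLeft.card from hl) with hl' | hl'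
    · rw [extendCochain_of_eq hl'.symm (by omega)]
      have h1 : partialCobd true (extendCochain d a) F = partialCobd true a F := by
        refine partialCobd_congr fun x hx hxl => extendCochain_of_le ?_ ?_ <;>
        have := card_toLeft_erase hx hxl <;> omega
      have h2 : partialCobd false (extendCochain d a) F =
          partialCobd false (partialCobd true a + partialCobd false (partialCobd true a)) F := by
        refine partialCobd_congr fun x hx hxl => extendCochain_of_eq ?_ ?_ <;>
        have := card_toRight_erase hx hxl <;> omega
      rw [h1, h2, partialCobd_add, partialCobd_self, add_zero]
    · rw [extendCochain_of_lt_left hl', partialCobd_eq_zero (b := false), add_zero]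
      · rcases Nat.eq_or_lt_of_le (show d + 3 ≤ F.toLeft.card from hl') with hl'' | hl''
        · have h1 : partialCobd true (extendCochain d a) F =
              partialCobd true (partialCobd true a + partialCobd false (partialCobd true a)) F := by
            refine partialCobd_congr fun x hx hxl => extendCochain_of_eq ?_ ?_ <;>
            have := card_toLeft_erase hx hxl <;> omega
          rw [h1, partialCobd_add, partialCobd_comm true false, partialCobd_self]
          simp [partialCobd]
        · rw [partialCobd_eq_zero]
          intro x hx hxl
          have := card_toLeft_erase hx hxl
          exact extendCochain_of_lt_left (by omega)
      · intro x hx hxl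
        have := card_toRight_erase hx hxl
        exact extendCochain_of_lt_left (by omega)

theorem extendCochain_eq_zero (hP : ∀ F ∈ P, ∀ G, G ⊆ F → G ∈ P)
    (ha : ∀ F ∈ deletedJoin P, F.toLeft.card ≤ d + 1 → F.toRight.card ≤ d + 1 → F ≠ ∅ →
      a F + a (swapFactors F) = cobd a F)
    (ha' : ∀ F ∈ deletedJoin P, F.toLeft.card ≤ d + 1 → F.toRight.card ≤ d + 1 →
      2 * d + 2 ≤ F.card → a F = 0)
    (hF : F ∈ deletedJoin P) (hcard : F.card = 2 * d + 3) : extendCochain d a F = 0 := by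
  have hsum := Finset.card_toLeft_add_card_toRight (u := F)
  rcases lt_or_ge (d + 1) F.toRight.card with hr | hr
  · exact extendCochain_of_lt_right hr
  rcases Nat.eq_or_lt_of_le (show d + 2 ≤ F.toLeft.card by omega) with hl | hl
  · rw [extendCochain_of_eq hl.symm hr, partialCobd_comm false true]
    have h1 : partialCobd true (partialCobd false a) F =
        partialCobd true (partialCobd true a) F := by
      refine partialCobd_congr fun x hx hxl => ?_
      have h2 := card_toLeft_erase hx hxl
      have hx' := deletedJoin_down hP F hF _ (Finset.erase_subset x F)
      have h3 := Finset.card_erase_add_one hx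
      have h4 := ha _ hx' (by omega) (by omega) (by
        intro h
        rw [h, Finset.card_empty] at h3
        omega)
      rw [ha' _ hx' (by omega) (by omega) (by omega), ha' _ (swapFactors_mem_deletedJoin hx')
        (by rw [toLeft_swapFactors]; omega) (by rw [toRight_swapFactors]; omega)
        (by rw [card_swapFactors]; omega), cobd_eq_add] at h4
      exact (zmod_two_eq_of_add_eq_zero (by rw [← h4, add_zero])).symm
    rw [h1, partialCobd_self, Pi.zero_apply, add_zero]
    refine partialCobd_eq_zero fun x hx hxl => ?_
    have h2 := card_toLeft_erase hx hxl
    have h3 := Finset.card_erase_add_one hx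
    exact ha' _ (deletedJoin_down hP F hF _ (Finset.erase_subset x F)) (by omega) (by omega)
      (by omega)
  · exact extendCochain_of_lt_left (by omega)

end Extension

section Obstruction

variable {V : Type*} [DecidableEq V] [Fintype V] {P : Set (Finset V)} {d : ℕ}

open Finset (disjSum)

theorem SuppOn.eq_of_empty {W : Type*} {c : Chain W} {Q : Set (Finset W)} (h : SuppOn Q c)
    (hQ : ∀ F, F ∉ Q) : c = 0 := funext fun F => h F (hQ F)

theorem SuppOn.swapChain {W : Type*} {c : Chain (W ⊕ W)} {Q : Set (Finset (W ⊕ W))}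
    (h : SuppOn Q c) : SuppOn {F | swapFactors F ∈ Q} (swapChain c) := fun _ hF => h _ hF

theorem pairing_add_left (a a' c : Chain V) : pairing (a + a') c = pairing a c + pairing a' c := by
  simp [pairing, add_mul, Finset.sum_add_distrib]

/-- An almost invariant cochain on the deleted join, up to sets of size `m`. -/
def AlmostInvariant {V : Type*} [DecidableEq V] (P : Set (Finset V)) (m : ℕ)
    (b : Chain (V ⊕ V)) : Prop :=
  ∀ F ∈ deletedJoin P, F ≠ ∅ → F.card ≤ m → b F + b (swapFactors F) = cobd b F

theorem AlmostInvariant.pairing_add_swapChain {m k : ℕ} {b c : Chain (V ⊕ V)}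
    (hb : AlmostInvariant P m b) (hc : SuppOn {F | F ∈ deletedJoin P ∧ F.card = k} c)
    (hk : k ≠ 0) (hkm : k ≤ m) : pairing b (c + swapChain c) = pairing b (bd c) := by
  rw [pairing_add, pairing_swapChain, ← pairing_add_left, pairing_bd]
  refine pairing_congr hc fun F hF => hb F hF.1 ?_ (hF.2.trans_le hkm)
  rintro rfl
  exact hk (hF.2.symm.trans Finset.card_empty)

theorem suppOn_swapChain_deletedJoin {V : Type*} {P : Set (Finset V)} {k : ℕ} {c : Chain (V ⊕ V)}
    (hc : SuppOn {F | F ∈ deletedJoin P ∧ F.card = k} c) :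
    SuppOn {F | F ∈ deletedJoin P ∧ F.card = k} (swapChain c) :=
  hc.swapChain.mono fun F hF => by
    have h1 := swapFactors_mem_deletedJoin hF.1
    have h2 := hF.2
    rw [swapFactors_swapFactors] at h1
    rw [card_swapFactors] at h2
    exact ⟨h1, h2⟩

/-- The deleted join of a sphere with itself carries symmetric cycles that are detected by
every almost invariant cochain. -/
theorem SphereLike.exists_symmetric_cycle {n m : ℕ} (hP : SphereLike n P) {b : Chain (V ⊕ V)}
    (hb : AlmostInvariant P m b) (hb0 : b ∅ = 1) (hm : n + 1 ≤ m) (k : ℕ) (hk : k ≤ n) :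
    ∃ y : Chain (V ⊕ V), SuppOn {F | F ∈ deletedJoin P ∧ F.card = k + 1} y ∧
      bd (y + swapChain y) = 0 ∧ pairing b (y + swapChain y) = 1 := by
  induction k with
  | zero =>
    obtain ⟨G, hG, -, hGc⟩ := hP.facet ∅ hP.empty_mem
    obtain ⟨v, hv⟩ := Finset.card_pos.1 (show 0 < G.card by omega)
    have hy : SuppOn {F | F ∈ deletedJoin P ∧ F.card = 1}
        (Pi.single {Sum.inl v} 1 : Chain (V ⊕ V)) := by
      intro F hF
      refine Pi.single_eq_of_ne ?_ _
      rintro rfl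
      refine hF ⟨⟨hP.down G hG _ ?_, hP.down G hG _ ?_, ?_⟩, by simp⟩
      · intro x; simp; rintro rfl; exact hv
      · intro x; simp
      · rw [Finset.disjoint_right]; intro x; simp
    have hbd : bd (Pi.single {Sum.inl v} 1 : Chain (V ⊕ V)) = Pi.single ∅ 1 := by
      funext F
      rw [bd_single, Pi.single_apply]
      refine if_congr ?_ rfl rfl
      constructor
      · rintro ⟨-, h⟩
        exact Finset.card_eq_zero.1 (by simpa using h)
      · rintro rfl
        simp
    refine ⟨_, hy, ?_, ?_⟩
    · rw [map_add, bd_swapChain, hbd]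
      funext F
      by_cases hF : F = ∅
      · subst hF
        exact zmod_two_add_self _
      · have : swapFactors F ≠ ∅ := by
          intro h
          rw [← swapFactors_swapFactors F, h] at hF
          exact hF rfl
        simp [swapChain, hF, this]
    · rw [hb.pairing_add_swapChain hy (by omega) (by omega), hbd]
      simp [pairing, Pi.single_apply, hb0]
  | succ k ih =>
    obtain ⟨y, hy, hby, hpy⟩ := ih (by omega)
    obtain ⟨u, ε, hu, hzu, hε⟩ := hP.exists_add_bd_eq_smul
      (hy.add (suppOn_swapChain_deletedJoin hy)) hby
    rw [hε (by omega), zero_smul] at hzu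
    have hbu : bd u = y + swapChain y := by
      rw [← sub_eq_zero, ← hzu, ZModModule.sub_eq_add, add_comm]
    refine ⟨u, hu, ?_, ?_⟩
    · rw [map_add, bd_swapChain, hbu, swapChain_add, swapChain_swapChain]
      funext F
      simp only [Pi.add_apply, Pi.zero_apply]
      linear_combination (y F + swapChain y F) * zmod_two_eq_zero
    · rw [hb.pairing_add_swapChain hu (by omega) (by omega), hbu, hpy]

theorem SphereLike.suppOn_leftCopy_facetChain {n : ℕ} (hP : SphereLike n P) :
    SuppOn {F | (F ∈ deletedJoin P ∧ F.toRight = ∅) ∧ F.card = n + 1}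
      (leftCopy (facetChain n P)) :=
  leftCopy_suppOn hP.empty_mem suppOn_facetChain

theorem SphereLike.bd_leftCopy_facetChain {n : ℕ} (hP : SphereLike n P) :
    bd (leftCopy (facetChain n P)) = 0 := by
  rw [bd_leftCopy, hP.bd_facetChain]
  funext F
  simp [leftCopy]

theorem SphereLike.suppOn_swapChain_leftCopy_facetChain {n : ℕ} (hP : SphereLike n P) :
    SuppOn {F | (F ∈ deletedJoin P ∧ F.card = n + 1) ∧ F.toLeft = ∅}
      (swapChain (leftCopy (facetChain n P))) := by
  refine hP.suppOn_leftCopy_facetChain.swapChain.mono fun F hF => ?_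
  have h1 := swapFactors_mem_deletedJoin hF.1.1
  have h2 := hF.1.2
  have h3 := hF.2
  rw [swapFactors_swapFactors] at h1
  rw [card_swapFactors] at h3
  rw [toRight_swapFactors] at h2
  exact ⟨⟨h1, h3⟩, h2⟩

theorem SphereLike.pairing_leftCopy_facetChain (hd : 1 ≤ d) (hP : SphereLike (2 * d) P)
    {a : Chain (V ⊕ V)} (hb : AlmostInvariant P (2 * d + 3) (extendCochain d a)) :
    pairing (extendCochain d a) (leftCopy (facetChain (2 * d) P)) = 0 := by
  have hpR' : pairing (extendCochain d a) (swapChain (leftCopy (facetChain (2 * d) P))) = 0 := by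
    refine pairing_eq_zero hP.suppOn_swapChain_leftCopy_facetChain fun F hF =>
      extendCochain_of_lt_right ?_
    have h1 := Finset.card_toLeft_add_card_toRight (u := F)
    have h2 := hF.1.2
    rw [hF.2, Finset.card_empty] at h1
    omega
  have h1 := hb.pairing_add_swapChain
    (hP.suppOn_leftCopy_facetChain.mono fun F hF => show _ ∧ _ from ⟨hF.1.1, hF.2⟩)
    (by omega) (by omega)
  rw [pairing_add, hpR', hP.bd_leftCopy_facetChain, add_zero] at h1
  rw [h1]
  simp [pairing]

/-- The obstruction chain attached to a missing face. -/
theorem SphereLike.exists_obstruction_chain (hd : 1 ≤ d) (hP : SphereLike (2 * d) P)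
    {M : Finset V} (hM : M.card = d + 1) (hMP : M ∉ P) (hMbd : ∀ τ, τ ⊂ M → τ ∈ P)
    {a : Chain (V ⊕ V)}
    (hb : AlmostInvariant P (2 * d + 3) (extendCochain d a))
    (ha : ∀ F ∈ deletedJoin P, F.toLeft.card ≤ d + 1 → F.toRight.card ≤ d + 1 →
      2 * d + 2 ≤ F.card → a F = 0)
    (haM : ∀ F : Finset (V ⊕ V), F.toLeft = M → F.toRight ∈ P → F.toRight.card = d + 1 →
      Disjoint M F.toRight → cobd a F = 0) :
    ∃ (c : Chain (V ⊕ V)) (ε : ZMod 2),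
      SuppOn {F | F ∈ deletedJoin P ∧ F.card = 2 * d + 2} c ∧
      bd c = swapChain (leftCopy (facetChain (2 * d) P)) +
        ε • leftCopy (facetChain (2 * d) P) ∧ pairing (extendCochain d a) c = 0 := by
  set R := leftCopy (facetChain (2 * d) P) with hRdef
  have hR := hP.suppOn_leftCopy_facetChain
  have hbR := hP.bd_leftCopy_facetChain
  have hR' := hP.suppOn_swapChain_leftCopy_facetChain
  have hpR := hP.pairing_leftCopy_facetChain hd hb
  rw [← hRdef] at hR hbR hR' hpR
  have hbR' : bd (swapChain R) = 0 := by rw [bd_swapChain, hbR]; rfl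
  set D : Set (Finset (V ⊕ V)) :=
    {F | F.toRight ∈ P ∧ F.toLeft ⊆ M ∧ Disjoint F.toLeft F.toRight} with hDdef
  have hD : ∀ F ∈ D, ∀ G, G ⊆ F → G ∈ D := fun F hF G hG =>
    ⟨hP.down _ hF.1 _ (Finset.toRight_subset_toRight hG),
      (Finset.toLeft_subset_toLeft hG).trans hF.2.1,
      (hF.2.2.mono_left (Finset.toLeft_subset_toLeft hG)).mono_right
        (Finset.toRight_subset_toRight hG)⟩
  obtain ⟨B, hB, hs⟩ := exists_add_bd_suppOn hD (k := 0) (j := 2 * d + 1) (z := swapChain R) (by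
    intro τ _ c hc hbc
    by_cases hτ : τ ∈ P
    · obtain ⟨y, hyM, hyτ⟩ := Finset.not_subset.1
        (show ¬ M ⊆ τ from fun h => hMP (hP.down τ hτ M h))
      refine ⟨cone y c, fun σ hσ => ?_, ?_⟩
      · unfold cone
        split_ifs with hy
        · refine hc _ fun h => hσ ⟨by simpa using hτ, ?_, ?_⟩
          · have h1 := h.2.1
            rw [Finset.toLeft_disjSum] at h1 ⊢
            rw [← Finset.insert_erase hy]
            exact Finset.insert_subset hyM h1
          · have h1 := h.2.2
            rw [Finset.toLeft_disjSum, Finset.toRight_disjSum] at h1 ⊢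
            rw [← Finset.insert_erase hy]
            exact Finset.disjoint_insert_left.2 ⟨hyτ, h1⟩
        · rfl
      · rw [bd_cone, hbc]
        funext F
        simp [cone]
    · refine ⟨0, fun _ _ => rfl, ?_⟩
      rw [map_zero]
      funext σ
      refine (hc σ fun h => hτ ?_).symm
      simpa using h.1)
    (hR'.mono fun F hF => show _ ∧ _ from
      ⟨⟨hF.1.1.2.1, hF.2 ▸ Finset.empty_subset M, hF.1.1.2.2⟩, hF.1.2⟩) hbR'
  have hbB : bd B = swapChain R := by
    have h1 := hs.eq_of_empty fun F hF => Nat.not_lt_zero _ hF.1.2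
    rw [← sub_eq_zero, ← h1, ZModModule.sub_eq_add, add_comm]
  set Z : Chain (V ⊕ V) := fun F => if F.toLeft = M then B F else 0 with hZdef
  have hZ : SuppOn {F | (F ∈ D ∧ F.toRight.card = d + 1) ∧ F.toLeft = M} Z := by
    intro F hF
    simp only [hZdef]
    split_ifs with h
    · refine hB F fun h' => hF ⟨⟨h'.1, ?_⟩, h⟩
      have h1 := Finset.card_toLeft_add_card_toRight (u := F)
      have h2 := h'.2
      rw [h, hM] at h1
      omega
    · rfl
  have hZc : SuppOn {F | F ∈ D ∧ F.card = 2 * d + 1 + 1} Z := by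
    refine hZ.mono fun F hF => ⟨hF.1.1, ?_⟩
    rw [← Finset.card_toLeft_add_card_toRight, hF.2, hF.1.2, hM]
    omega
  have hQM : ∀ F : Finset (V ⊕ V), F.toLeft = M → bd Z F = 0 := by
    intro F hF
    obtain ⟨τ, rfl⟩ : ∃ τ, F = disjSum M τ :=
      ⟨F.toRight, by rw [← hF, Finset.toLeft_disjSum_toRight]⟩
    have h1 : bd B (disjSum M τ) = 0 := by
      rw [hbB]
      refine hR' _ fun h => ?_
      have h2 := h.2
      rw [Finset.toLeft_disjSum] at h2
      rw [h2, Finset.card_empty] at hM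
      omega
    rw [bd_disjSum, bd_eq_zero_of_forall (c := fun ρ => B (disjSum ρ τ)), zero_add] at h1
    · rw [bd_disjSum, bd_eq_zero_of_forall (c := fun ρ => Z (disjSum ρ τ)), zero_add, ← h1]
      · exact bd_congr fun x _ => by simp [hZdef]
      · intro x hx
        have : insert x M ≠ M := fun h => hx (h ▸ Finset.mem_insert_self x M)
        simp [hZdef, this]
    · intro x hx
      refine hB _ fun h => hx (h.1.2.1 ?_)
      simp
  have hDM : ∀ F ∈ D, F.toLeft ≠ M → F ∈ deletedJoin P := fun F hF h =>
    ⟨hMbd _ (hF.2.1.ssubset_of_ne h), hF.1, hF.2.2⟩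
  have hQD : SuppOn {F | F ∈ D ∧ F.toRight.card ≤ d + 1} (bd Z) :=
    SuppOn.bd (fun F hF G hG => ⟨hD F hF.1 G hG,
      (Finset.card_le_card (Finset.toRight_subset_toRight hG)).trans hF.2⟩)
      (hZ.mono fun F hF => ⟨hF.1.1, hF.1.2.le⟩)
  have hQ : SuppOn {F | (F ∈ deletedJoin P ∧ F.toRight.card ≤ d + 1) ∧ F.card = 2 * d + 1}
      (bd Z) := by
    have h2 : homog (2 * d + 1) (bd Z) = bd Z := by rw [← bd_homog, homog_of_suppOn hZc]
    intro F hF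
    by_cases hFM : F.toLeft = M
    · exact hQM F hFM
    · rw [← h2]
      exact hQD.homog _ F fun h => hF ⟨⟨hDM F h.1.1 hFM, h.1.2⟩, h.2⟩
  obtain ⟨W', c, hW', hc, hbc, hQW'⟩ := hP.exists_add_bd_eq_leftCopy (d + 1) hQ (bd_bd Z)
  obtain ⟨e, ε, he, hce, -⟩ := hP.exists_bd_eq_add hc hbc
  have he0 : e = 0 := he.eq_of_empty fun F hF => by
    have h1 := hP.card_le F hF.1
    have h2 := hF.2
    omega
  rw [he0, map_zero, add_zero] at hce
  have hbW' : bd W' = bd Z + ε • R := by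
    rw [hRdef, ← leftCopy_smul, ← hce, ← hQW', ← add_assoc, ZModModule.add_self, zero_add]
  have hW : SuppOn {F | (F ∈ deletedJoin P ∧ F.card = 2 * d + 2) ∧ d + 1 < F.toRight.card}
      (B + Z) := by
    intro F hF
    by_cases hFM : F.toLeft = M
    · simp [hZdef, hFM, zmod_two_add_self]
    · simp only [Pi.add_apply, hZdef, hFM, if_false, add_zero]
      refine hB F fun h => hF ⟨⟨hDM F h.1 hFM, h.2⟩, ?_⟩
      have h1 := Finset.card_toLeft_add_card_toRight (u := F)
      have h2 := Finset.card_lt_card (h.1.2.1.ssubset_of_ne hFM)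
      have h3 := h.2
      omega
  have hW'' : SuppOn {F | F ∈ deletedJoin P ∧ F.card = 2 * d + 2} W' :=
    hW'.mono fun F hF => show _ ∧ _ from ⟨hF.1.1, hF.2⟩
  refine ⟨B + Z + W', ε, (hW.mono fun F hF => hF.1).add hW'', ?_, ?_⟩
  · rw [map_add, map_add, hbB, hbW']
    rw [add_assoc, ← add_assoc (bd Z), ZModModule.add_self, zero_add]
  · have hpQ : pairing (extendCochain d a) (bd Z) = 0 := by
      rw [pairing_congr (a' := a) hQD fun F hF => extendCochain_of_le
        ((Finset.card_le_card hF.1.2.1).trans hM.le) hF.2]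
      rw [pairing_bd]
      refine pairing_eq_zero hZ fun F hF => haM F hF.2 hF.1.1.1 hF.1.2 ?_
      rw [← hF.2]
      exact hF.1.1.2.2
    have hpW' : pairing (extendCochain d a) (swapChain W') = 0 := by
      refine pairing_eq_zero hW'.swapChain fun F hF => ?_
      have h1 := swapFactors_mem_deletedJoin hF.1.1
      have h2 := hF.1.2
      have h3 := hF.2
      rw [swapFactors_swapFactors] at h1
      rw [card_swapFactors] at h3
      rw [toRight_swapFactors] at h2
      have h4 := Finset.card_toLeft_add_card_toRight (u := F)
      rcases lt_or_ge (d + 1) F.toRight.card with hr | hr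
      · exact extendCochain_of_lt_right hr
      · rw [extendCochain_of_le h2 hr]
        exact ha F h1 h2 hr h3.ge
    have h1 := hb.pairing_add_swapChain hW'' (by omega) (by omega)
    rw [pairing_add, hpW', add_zero, hbW', pairing_add, hpQ, pairing_smul, hpR, mul_zero,
      add_zero] at h1
    rw [pairing_add, h1, add_zero]
    exact pairing_eq_zero hW fun F hF => extendCochain_of_lt_right hF.2

end Obstruction

section Contradiction

variable {V : Type*} [DecidableEq V] [Fintype V] {P : Set (Finset V)} {d : ℕ}

/-- There is no cochain of the type that an embedding of the `d`-skeleton with a missing face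
would provide. -/
theorem SphereLike.not_exists_cochain (hd : 1 ≤ d) (hP : SphereLike (2 * d) P)
    {M : Finset V} (hM : M.card = d + 1) (hMP : M ∉ P) (hMbd : ∀ τ, τ ⊂ M → τ ∈ P)
    {a : Chain (V ⊕ V)} (ha0 : a ∅ = 1)
    (ha : ∀ F ∈ deletedJoin P, F.toLeft.card ≤ d + 1 → F.toRight.card ≤ d + 1 → F ≠ ∅ →
      a F + a (swapFactors F) = cobd a F)
    (ha' : ∀ F ∈ deletedJoin P, F.toLeft.card ≤ d + 1 → F.toRight.card ≤ d + 1 →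
      2 * d + 2 ≤ F.card → a F = 0)
    (haM : ∀ F : Finset (V ⊕ V), F.toLeft = M → F.toRight ∈ P → F.toRight.card = d + 1 →
      Disjoint M F.toRight → cobd a F = 0) : False := by
  have hb : AlmostInvariant P (2 * d + 3) (extendCochain d a) := fun F hF hne hcard =>
    extendCochain_add_swap hP.down ha hF hne hcard
  have hb0 : extendCochain d a ∅ = 1 := by
    have h := Finset.card_toLeft_add_card_toRight (u := (∅ : Finset (V ⊕ V)))
    rw [Finset.card_empty] at h
    rw [extendCochain_of_le (by omega) (by omega), ha0]
  have hbtop : ∀ F ∈ deletedJoin P, F.card = 2 * d + 3 → extendCochain d a F = 0 :=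
    fun F hF hcard => extendCochain_eq_zero hP.down ha ha' hF hcard
  have hpR := hP.pairing_leftCopy_facetChain hd hb
  have hbR := hP.bd_leftCopy_facetChain
  obtain ⟨C, ε', hC, hbC, hpC⟩ := hP.exists_obstruction_chain hd hM hMP hMbd hb ha' haM
  obtain ⟨y, hy, hby, hpy⟩ := hP.exists_symmetric_cycle hb hb0 (by omega) (2 * d) le_rfl
  set R := leftCopy (facetChain (2 * d) P)
  set w := y + swapChain y with hw
  have hTw : swapChain w = w := by
    rw [hw, swapChain_add, swapChain_swapChain, add_comm]
  obtain ⟨U, ε, hU, hwU, -⟩ := hP.exists_add_bd_eq_smul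
    (hy.add (suppOn_swapChain_deletedJoin hy)) hby
  have hbU : bd U = w + ε • R := by
    rw [← hwU, ← add_assoc, ZModModule.add_self, zero_add]
  have hbTU : bd (swapChain U) = w + ε • swapChain R := by
    rw [bd_swapChain, hbU, swapChain_add, hTw, swapChain_smul]
  have hbound : ∀ z : Chain (V ⊕ V), SuppOn {F | F ∈ deletedJoin P ∧ F.card = 2 * d + 2} z →
      bd z = 0 → pairing (extendCochain d a) z = 0 := by
    intro z hz hbz
    obtain ⟨Q, δ, hQ, hzQ, hδ⟩ := hP.exists_add_bd_eq_smul hz hbz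
    rw [hδ (by omega), zero_smul] at hzQ
    have h1 : z = bd Q := by
      rw [← sub_eq_zero, ZModModule.sub_eq_add, hzQ]
    rw [h1, ← hb.pairing_add_swapChain hQ (by omega) (by omega)]
    exact pairing_eq_zero (hQ.add (suppOn_swapChain_deletedJoin hQ)) fun F hF => hbtop F hF.1 hF.2
  have hno : ∀ X : Chain (V ⊕ V), SuppOn {F | F ∈ deletedJoin P ∧ F.card = 2 * d + 2} X →
      bd X ≠ w := by
    intro X hX hbX
    have h1 := hbound _ (hX.add (suppOn_swapChain_deletedJoin hX)) (by
      rw [map_add, bd_swapChain, hbX, hTw, ZModModule.add_self])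
    rw [hb.pairing_add_swapChain hX (by omega) (by omega), hbX, hpy] at h1
    exact one_ne_zero h1
  rcases zmod_two_cases ε with rfl | rfl
  · exact hno U hU (by rw [hbU, zero_smul, add_zero])
  · rcases zmod_two_cases ε' with rfl | rfl
    · refine hno (swapChain U + C) ((suppOn_swapChain_deletedJoin hU).add hC) ?_
      rw [map_add, hbTU, hbC, zero_smul, one_smul, add_zero, add_assoc, ZModModule.add_self,
        add_zero]
    · have h1 := hbound _ (hC.add (hU.add (suppOn_swapChain_deletedJoin hU))) (by
        rw [map_add, map_add, hbC, hbU, hbTU, one_smul, one_smul]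
        funext F
        simp only [Pi.add_apply, Pi.zero_apply]
        linear_combination (swapChain R F + R F + w F) * zmod_two_eq_zero)
      rw [pairing_add, hpC, zero_add, hb.pairing_add_swapChain hU (by omega) (by omega), hbU,
        one_smul, pairing_add, hpy, hpR, add_zero] at h1
      exact one_ne_zero h1

end Contradiction

section ListChains

/-- Finitely supported mod 2 chains on lists of points. -/
abbrev ListChain (E : Type*) := List E →₀ ZMod 2

namespace ListChain

variable {E E' : Type*}

/-- The cone over a chain of lists. -/
noncomputable def cons (x : E) : ListChain E →ₗ[ZMod 2] ListChain E :=
  Finsupp.lmapDomain _ _ (List.cons x)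

/-- The map of chains induced by a map of points. -/
noncomputable def map (f : E → E') : ListChain E →ₗ[ZMod 2] ListChain E' :=
  Finsupp.lmapDomain _ _ (List.map f)

/-- The boundary of a single list. -/
noncomputable def bdList : List E → ListChain E
  | [] => 0
  | x :: l => Finsupp.single l 1 + cons x (bdList l)

/-- The augmented boundary of chains of lists. -/
noncomputable def bdry : ListChain E →ₗ[ZMod 2] ListChain E :=
  Finsupp.linearCombination (ZMod 2) bdList

/-- The prism operator between two maps, on a single list. -/
noncomputable def prismList (f g : E → E') : List E → ListChain E'
  | [] => 0
  | x :: l => Finsupp.single (f x :: g x :: l.map g) 1 + cons (f x) (prismList f g l)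

/-- The prism operator between two maps. -/
noncomputable def prism (f g : E → E') : ListChain E →ₗ[ZMod 2] ListChain E' :=
  Finsupp.linearCombination (ZMod 2) (prismList f g)

@[simp] theorem cons_single (x : E) (l : List E) (r : ZMod 2) :
    cons x (Finsupp.single l r) = Finsupp.single (x :: l) r := Finsupp.mapDomain_single

@[simp] theorem map_single (f : E → E') (l : List E) (r : ZMod 2) :
    map f (Finsupp.single l r) = Finsupp.single (l.map f) r := Finsupp.mapDomain_single

@[simp] theorem bdry_single (l : List E) : bdry (Finsupp.single l 1) = bdList l := by
  simp [bdry]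

@[simp] theorem prism_single (f g : E → E') (l : List E) :
    prism f g (Finsupp.single l 1) = prismList f g l := by
  simp [prism]

theorem hom_ext {N : Type*} [AddCommMonoid N] [Module (ZMod 2) N]
    {φ ψ : ListChain E →ₗ[ZMod 2] N}
    (h : ∀ l, φ (Finsupp.single l 1) = ψ (Finsupp.single l 1)) : φ = ψ :=
  Finsupp.lhom_ext' fun l => LinearMap.ext_ring (h l)

theorem bdry_cons (x : E) (c : ListChain E) : bdry (cons x c) = c + cons x (bdry c) := by
  suffices bdry ∘ₗ cons x = LinearMap.id + cons x ∘ₗ bdry from LinearMap.congr_fun this c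
  exact hom_ext fun l => by simp [bdList]

theorem map_cons (f : E → E') (x : E) (c : ListChain E) :
    map f (cons x c) = cons (f x) (map f c) := by
  suffices map f ∘ₗ cons x = cons (f x) ∘ₗ map f from LinearMap.congr_fun this c
  exact hom_ext fun l => by simp

theorem bdry_map (f : E → E') (c : ListChain E) : bdry (map f c) = map f (bdry c) := by
  suffices bdry ∘ₗ map f = map f ∘ₗ bdry from LinearMap.congr_fun this c
  refine hom_ext fun l => ?_
  induction l with
  | nil => simp [bdList]
  | cons x l ih =>
    simp only [LinearMap.comp_apply, bdry_single, map_single, List.map_cons] at ih ⊢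
    rw [bdList, bdList, map_add, map_cons, ih, map_single]

theorem prism_cons (f g : E → E') (x : E) (c : ListChain E) :
    prism f g (cons x c) = cons (f x) (cons (g x) (map g c)) + cons (f x) (prism f g c) := by
  suffices prism f g ∘ₗ cons x =
      cons (f x) ∘ₗ cons (g x) ∘ₗ map g + cons (f x) ∘ₗ prism f g from LinearMap.congr_fun this c
  exact hom_ext fun l => by simp [prismList]

theorem bdry_prism (f g : E → E') (c : ListChain E) :
    bdry (prism f g c) = prism f g (bdry c) + map f c + map g c := by
  suffices bdry ∘ₗ prism f g = prism f g ∘ₗ bdry + map f + map g from LinearMap.congr_fun this c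
  refine hom_ext fun l => ?_
  induction l with
  | nil => simp [bdList, prismList, ZModModule.add_self]
  | cons x l ih =>
    simp only [LinearMap.comp_apply, LinearMap.add_apply, bdry_single, prism_single, map_single,
      List.map_cons] at ih ⊢
    have h1 : bdList (l.map g) = map g (bdList l) := by
      rw [← bdry_single, ← map_single, bdry_map, bdry_single]
    rw [prismList, bdList, map_add, bdry_cons, ih, map_add (prism f g), prism_cons, prism_single,
      bdry_single, bdList, bdList, h1]
    simp only [map_add, cons_single]
    have h2 := ZModModule.add_self (Finsupp.single (f x :: l.map g) 1 : ListChain E')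
    linear_combination (norm := module) h2

end ListChain

end ListChains

section SmallLists

open ListChain

/-- Lists of length `k` in `C`, of diameter less than `ε`. -/
def smallLists {E : Type*} [PseudoMetricSpace E] (C : Set E) (ε : ℝ) (k : ℕ) : Set (List E) :=
  {l | l.length = k ∧ (∀ x ∈ l, x ∈ C) ∧ ∀ x ∈ l, ∀ y ∈ l, dist x y < ε}

/-- The chains supported on a set of lists. -/
abbrev ListChain.on {E : Type*} (Q : Set (List E)) : Submodule (ZMod 2) (ListChain E) :=
  Finsupp.supported (ZMod 2) (ZMod 2) Q

theorem ListChain.apply_mem {E N : Type*} [AddCommMonoid N] [Module (ZMod 2) N]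
    {Q : Set (List E)} {W : Submodule (ZMod 2) N} {φ : ListChain E →ₗ[ZMod 2] N}
    (h : ∀ l ∈ Q, φ (Finsupp.single l 1) ∈ W) {c : ListChain E} (hc : c ∈ on Q) : φ c ∈ W := by
  have h1 : on Q ≤ W.comap φ := by
    rw [on, Finsupp.supported_eq_span_single, Submodule.span_le]
    rintro _ ⟨l, hl, rfl⟩
    exact h l hl
  exact h1 hc

theorem ListChain.apply_eq {E N : Type*} [AddCommMonoid N] [Module (ZMod 2) N]
    {Q : Set (List E)} {φ ψ : ListChain E →ₗ[ZMod 2] N}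
    (h : ∀ l ∈ Q, φ (Finsupp.single l 1) = ψ (Finsupp.single l 1)) {c : ListChain E}
    (hc : c ∈ on Q) : φ c = ψ c :=
  apply_mem (W := LinearMap.eqLocus φ ψ) (φ := LinearMap.id) h hc

theorem ListChain.single_mem_on {E : Type*} {Q : Set (List E)} {l : List E} (hl : l ∈ Q) :
    Finsupp.single l 1 ∈ on Q := Finsupp.single_mem_supported _ _ hl

theorem ListChain.cons_mem_on {E : Type*} {Q Q' : Set (List E)} {x : E}
    (h : ∀ l ∈ Q, x :: l ∈ Q') {c : ListChain E} (hc : c ∈ on Q) : cons x c ∈ on Q' :=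
  apply_mem (fun l hl => by rw [cons_single]; exact single_mem_on (h l hl)) hc

theorem ListChain.map_mem_on {E E' : Type*} {Q : Set (List E)} {Q' : Set (List E')} {f : E → E'}
    (h : ∀ l ∈ Q, l.map f ∈ Q') {c : ListChain E} (hc : c ∈ on Q) : map f c ∈ on Q' :=
  apply_mem (fun l hl => by rw [map_single]; exact single_mem_on (h l hl)) hc

theorem ListChain.prism_mem_on {E E' : Type*} {Q : Set (List E)} {Q' : Set (List E')}
    {f g : E → E'} (h : ∀ l ∈ Q, ∀ l' : List E', l'.length = l.length + 1 →
      (∀ y ∈ l', ∃ x ∈ l, y = f x ∨ y = g x) → l' ∈ Q') {c : ListChain E} (hc : c ∈ on Q) :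
    prism f g c ∈ on Q' := by
  refine apply_mem (fun l hl => ?_) hc
  rw [prism_single]
  refine Finsupp.supported_mono (R := ZMod 2) (M := ZMod 2)
    (s := {l' : List E' | l'.length = l.length + 1 ∧ ∀ y ∈ l', ∃ x ∈ l, y = f x ∨ y = g x})
    (fun l' h' => h l hl l' h'.1 h'.2) ?_
  clear hl
  induction l with
  | nil => exact Submodule.zero_mem _
  | cons x l ih =>
    refine Submodule.add_mem _ (single_mem_on ⟨by simp, ?_⟩) (cons_mem_on ?_ ih)
    · intro y hy
      simp only [List.mem_cons, List.mem_map] at hy ⊢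
      rcases hy with rfl | rfl | ⟨z, hz, rfl⟩
      · exact ⟨x, .inl rfl, .inl rfl⟩
      · exact ⟨x, .inl rfl, .inr rfl⟩
      · exact ⟨z, .inr hz, .inr rfl⟩
    · rintro l' ⟨h1, h2⟩
      refine ⟨by simp [h1], fun y hy => ?_⟩
      rcases List.mem_cons.1 hy with rfl | hy
      · exact ⟨x, by simp, .inl rfl⟩
      · obtain ⟨z, hz, h⟩ := h2 y hy
        exact ⟨z, by simp [hz], h⟩

theorem exists_bdry_eq {E : Type*} [NormedAddCommGroup E] [NormedSpace ℝ E] {C : Set E}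
    (hC : Convex ℝ C) (hne : C.Nonempty) {ε : ℝ} (hε : 0 < ε) {k : ℕ} {c : ListChain E}
    (hc : c ∈ on (smallLists C ε k)) (hbc : bdry c = 0) :
    ∃ e ∈ on (smallLists C ε (k + 1)), bdry e = c := by
  classical
  obtain ⟨p, hp⟩ := hne
  set A : Finset E := c.support.biUnion List.toFinset with hA
  obtain ⟨N, hN⟩ : ∃ N : ℕ, ∀ x ∈ A, ∀ y ∈ A, dist x y < ε →
      dist x y + 1 / ((N : ℝ) + 1) * dist y p < ε := by
    have : ∀ᶠ N : ℕ in Filter.atTop, ∀ x ∈ A, ∀ y ∈ A, dist x y < ε →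
        dist x y + 1 / ((N : ℝ) + 1) * dist y p < ε := by
      rw [Filter.eventually_all_finset]
      intro x _
      rw [Filter.eventually_all_finset]
      intro y _
      by_cases hxy : dist x y < ε
      · have h1 := (tendsto_one_div_add_atTop_nhds_zero_nat (𝕜 := ℝ)).mul_const (dist y p)
        have h2 := h1.const_add (dist x y)
        rw [zero_mul, add_zero] at h2
        filter_upwards [h2.eventually_lt_const hxy] with N hN _ using hN
      · simp [hxy]
    exact this.exists
  set f : ℕ → E → E := fun i x => AffineMap.lineMap x p ((i : ℝ) / ((N : ℝ) + 1)) with hf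
  have hNpos : (0 : ℝ) < (N : ℝ) + 1 := by positivity
  have hunit : ∀ i : ℕ, i ≤ N + 1 → (i : ℝ) / ((N : ℝ) + 1) ∈ Set.Icc (0 : ℝ) 1 := by
    intro i hi
    refine ⟨by positivity, (div_le_one hNpos).2 ?_⟩
    exact_mod_cast hi
  have hfC : ∀ i ≤ N + 1, ∀ x ∈ C, f i x ∈ C := fun i hi x hx =>
    hC.lineMap_mem hx hp (hunit i hi)
  have hdist : ∀ i ≤ N + 1, ∀ x y, dist (f i x) (f i y) ≤ dist x y := by
    intro i hi x y
    have h0 := hunit i hi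
    have : f i x - f i y = (1 - (i : ℝ) / ((N : ℝ) + 1)) • (x - y) := by
      simp only [hf, AffineMap.lineMap_apply_module]
      module
    rw [dist_eq_norm, this, norm_smul, Real.norm_of_nonneg (by linarith [h0.2]), ← dist_eq_norm]
    nlinarith [h0.1, dist_nonneg (x := x) (y := y)]
  have hstep : ∀ i y, dist (f i y) (f (i + 1) y) = 1 / ((N : ℝ) + 1) * dist y p := by
    intro i y
    have : f i y - f (i + 1) y = (1 / ((N : ℝ) + 1)) • (y - p) := by
      simp only [hf, AffineMap.lineMap_apply_module]
      push_cast
      rw [add_div]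
      module
    rw [dist_eq_norm, this, norm_smul, Real.norm_of_nonneg (by positivity), ← dist_eq_norm]
  have hmix : ∀ i, i + 1 ≤ N + 1 → ∀ x y, dist (f i x) (f (i + 1) y) ≤
      dist x y + 1 / ((N : ℝ) + 1) * dist y p := fun i hi x y =>
    (dist_triangle _ (f i y) _).trans (add_le_add (hdist i (by omega) x y) (hstep i y).le)
  set Q : Set (List E) := smallLists C ε k ∩ {l | ∀ x ∈ l, x ∈ A} with hQ
  have hcQ : c ∈ on Q := by
    rw [Finsupp.mem_supported]
    intro l hl
    refine ⟨(Finsupp.mem_supported _ _).1 hc hl, fun x hx => ?_⟩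
    exact Finset.mem_biUnion.2 ⟨l, hl, List.mem_toFinset.2 hx⟩
  have hpath : ∀ i ≤ N + 1, ∃ e ∈ on (smallLists C ε (k + 1)), bdry e = c + map (f i) c := by
    intro i
    induction i with
    | zero =>
      intro _
      refine ⟨0, Submodule.zero_mem _, ?_⟩
      have : f 0 = id := by
        funext x
        simp [hf]
      rw [map_zero, this, map, List.map_id_fun, Finsupp.lmapDomain_id, LinearMap.id_apply,
        ZModModule.add_self]
    | succ i ih =>
      intro hi
      obtain ⟨e, he, hbe⟩ := ih (by omega)
      refine ⟨e + prism (f i) (f (i + 1)) c, Submodule.add_mem _ he (prism_mem_on ?_ hcQ), ?_⟩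
      · rintro l ⟨hl, hlA⟩ l' hl' hmem
        refine ⟨by rw [hl', hl.1], ?_, ?_⟩
        · intro y hy
          obtain ⟨x, hx, rfl | rfl⟩ := hmem y hy
          · exact hfC i (by omega) x (hl.2.1 x hx)
          · exact hfC _ hi x (hl.2.1 x hx)
        · intro y hy y' hy'
          obtain ⟨x, hx, h⟩ := hmem y hy
          obtain ⟨x', hx', h'⟩ := hmem y' hy'
          have h1 := hl.2.2 x hx x' hx'
          have h2 := hl.2.2 x' hx' x hx
          rcases h with rfl | rfl <;> rcases h' with rfl | rfl
          · exact (hdist i (by omega) x x').trans_lt h1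
          · exact (hmix i hi x x').trans_lt (hN x (hlA x hx) x' (hlA x' hx') h1)
          · rw [dist_comm]
            exact (hmix i hi x' x).trans_lt (hN x' (hlA x' hx') x (hlA x hx) h2)
          · exact (hdist _ hi x x').trans_lt h1
      · rw [map_add, hbe, bdry_prism, hbc, map_zero]
        have h := ZModModule.add_self (map (f i) c)
        linear_combination (norm := module) h
  obtain ⟨e, he, hbe⟩ := hpath (N + 1) le_rfl
  have hlast : f (N + 1) = fun _ => p := by
    funext x
    simp [hf, div_self hNpos.ne']
  refine ⟨e + cons p (map (f (N + 1)) c), Submodule.add_mem _ he ?_, ?_⟩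
  · refine cons_mem_on (Q := {l | l.length = k ∧ ∀ x ∈ l, x = p}) ?_ (map_mem_on ?_ hc)
    · rintro l ⟨hl, hlp⟩
      have h1 : ∀ x ∈ p :: l, x = p := by simpa using hlp
      refine ⟨by simp [hl], fun x hx => by rwa [h1 x hx], fun x hx y hy => ?_⟩
      rw [h1 x hx, h1 y hy, dist_self]
      exact hε
    · rintro l ⟨hl, -⟩
      refine ⟨by simp [hl], fun x hx => ?_⟩
      obtain ⟨y, -, rfl⟩ := List.mem_map.1 hx
      rw [hlast]
  · rw [map_add, hbe, bdry_cons, bdry_map, hbc, map_zero, map_zero, add_zero, add_assoc,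
      ZModModule.add_self, add_zero]

end SmallLists

section EquivariantMap

open ListChain

theorem sum_sum_erase_erase_eq_zero {W N : Type*} [DecidableEq W] [AddCommGroup N]
    [Module (ZMod 2) N] (g : Finset W → N) (F : Finset W) :
    ∑ x ∈ F, ∑ y ∈ F.erase x, g ((F.erase x).erase y) = 0 := by
  rw [Finset.sum_sigma']
  refine Finset.sum_involution (fun a _ => ⟨a.2, a.1⟩) ?_ ?_ ?_ ?_
  · intro a _
    rw [Finset.erase_right_comm, ZModModule.add_self]
  · rintro ⟨x, y⟩ h _ h'
    simp only [Finset.mem_sigma, Finset.mem_erase] at h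
    simp only [Sigma.mk.injEq, heq_eq_eq] at h'
    exact h.2.1 h'.1
  · rintro ⟨x, y⟩ h
    simp only [Finset.mem_sigma, Finset.mem_erase] at h ⊢
    exact ⟨h.2.2, Ne.symm h.2.1, h.1⟩
  · intro _ _
    rfl

theorem disjoint_erase {V : Type*} [DecidableEq V] {F : Finset (V ⊕ V)}
    (hF : Disjoint F.toLeft F.toRight) (x : V ⊕ V) :
    Disjoint (F.erase x).toLeft (F.erase x).toRight :=
  (hF.mono_left (Finset.toLeft_subset_toLeft (Finset.erase_subset x F))).mono_right
    (Finset.toRight_subset_toRight (Finset.erase_subset x F))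

theorem disjoint_swapFactors {V : Type*} {F : Finset (V ⊕ V)} (hF : Disjoint F.toLeft F.toRight) :
    Disjoint (swapFactors F).toLeft (swapFactors F).toRight := by
  simpa using hF.symm

theorem sum_swapFactors {V : Type*} [DecidableEq V] {N : Type*} [AddCommMonoid N]
    (g : Finset (V ⊕ V) → N)
    (F : Finset (V ⊕ V)) :
    ∑ x ∈ swapFactors F, g ((swapFactors F).erase x) = ∑ x ∈ F, g (swapFactors (F.erase x)) := by
  refine Finset.sum_nbij' Sum.swap Sum.swap ?_ ?_ ?_ ?_ ?_
  · intro x hx; simpa using hx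
  · intro x hx; simpa using hx
  · simp
  · simp
  · intro x _
    rw [swapFactors_erase, Sum.swap_swap]

/-- A choice of one representative in each free orbit of the exchange of factors. -/
theorem exists_half (V : Type*) [DecidableEq V] [Fintype V] :
    ∃ half : Finset (V ⊕ V) → Prop, ∀ F, Disjoint F.toLeft F.toRight → F ≠ ∅ →
      (half (swapFactors F) ↔ ¬ half F) := by
  set e := Fintype.equivFin (Finset (V ⊕ V))
  refine ⟨fun F => e F < e (swapFactors F), fun F hF hne => ?_⟩
  have h : e F ≠ e (swapFactors F) := by
    intro h
    have h1 := e.injective h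
    have h2 : F.toLeft = F.toRight := by
      conv_lhs => rw [h1]
      simp
    have h3 : F.toLeft = ∅ := by
      rw [← h2] at hF
      exact disjoint_self.1 hF
    refine hne (Finset.card_eq_zero.1 ?_)
    rw [← Finset.card_toLeft_add_card_toRight, ← h2, h3, Finset.card_empty]
  simp only [swapFactors_swapFactors, not_lt]
  exact ⟨le_of_lt, fun h' => lt_of_le_of_ne h' h.symm⟩

/-- The simplex spanned by a set of coordinates. -/
def simplexOn {W : Type*} [Fintype W] (F : Finset W) : Set (W → ℝ) :=
  {p | (∀ i, 0 ≤ p i) ∧ ∑ i, p i = 1 ∧ ∀ i, i ∉ F → p i = 0}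

theorem convex_simplexOn {W : Type*} [Fintype W] (F : Finset W) : Convex ℝ (simplexOn F) := by
  intro p hp q hq a b ha hb hab
  refine ⟨fun i => ?_, ?_, fun i hi => ?_⟩
  · have h1 := mul_nonneg ha (hp.1 i)
    have h2 := mul_nonneg hb (hq.1 i)
    simpa using add_nonneg h1 h2
  · simp only [Pi.add_apply, Pi.smul_apply, smul_eq_mul, Finset.sum_add_distrib,
      ← Finset.mul_sum, hp.2.1, hq.2.1, mul_one, hab]
  · simp [hp.2.2 i hi, hq.2.2 i hi]

theorem simplexOn_nonempty {W : Type*} [Fintype W] [DecidableEq W] {F : Finset W}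
    (hF : F.Nonempty) : (simplexOn F).Nonempty := by
  obtain ⟨x, hx⟩ := hF
  refine ⟨Pi.single x 1, fun i => ?_, ?_, fun i hi => ?_⟩
  · rw [Pi.single_apply]; split_ifs <;> simp
  · simp
  · rw [Pi.single_apply, if_neg]
    rintro rfl
    exact hi hx

theorem simplexOn_mono {W : Type*} [Fintype W] {F G : Finset W} (h : F ⊆ G) :
    simplexOn F ⊆ simplexOn G := fun _ hp =>
  ⟨hp.1, hp.2.1, fun i hi => hp.2.2 i fun hiF => hi (h hiF)⟩

/-- The exchange of the two factors, on points. -/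
def swapPoint {V : Type*} (p : V ⊕ V → ℝ) : V ⊕ V → ℝ := fun i => p i.swap

theorem swapPoint_mem_simplexOn {V : Type*} [Fintype V] {F : Finset (V ⊕ V)} {p : V ⊕ V → ℝ}
    (hp : p ∈ simplexOn F) :
    swapPoint p ∈ simplexOn (swapFactors F) := by
  refine ⟨fun i => hp.1 _, ?_, fun i hi => hp.2.2 _ fun h => hi (by simpa using h)⟩
  rw [← hp.2.1]
  exact Equiv.sum_comp (Equiv.sumComm V V) p

theorem dist_swapPoint {V : Type*} [Fintype V] (p q : V ⊕ V → ℝ) :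
    dist (swapPoint p) (swapPoint q) = dist p q := by
  refine le_antisymm ?_ ?_ <;> refine (dist_pi_le_iff dist_nonneg).2 fun i => ?_
  · exact dist_le_pi_dist p q i.swap
  · have := dist_le_pi_dist (swapPoint p) (swapPoint q) i.swap
    simpa [swapPoint] using this

theorem map_swapPoint_mem_smallLists {V : Type*} [Fintype V] {F : Finset (V ⊕ V)}
    {ε : ℝ} {k : ℕ} {l : List (V ⊕ V → ℝ)}
    (hl : l ∈ smallLists (simplexOn F) ε k) :
    l.map swapPoint ∈ smallLists (simplexOn (swapFactors F)) ε k := by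
  refine ⟨by simp [hl.1], fun x hx => ?_, fun x hx y hy => ?_⟩
  · obtain ⟨p, hp, rfl⟩ := List.mem_map.1 hx
    exact swapPoint_mem_simplexOn (hl.2.1 p hp)
  · obtain ⟨p, hp, rfl⟩ := List.mem_map.1 hx
    obtain ⟨q, hq, rfl⟩ := List.mem_map.1 hy
    rw [dist_swapPoint]
    exact hl.2.2 p hp q hq

theorem map_swapPoint_map_swapPoint {V : Type*} (c : ListChain (V ⊕ V → ℝ)) :
    map swapPoint (map swapPoint c) = c := by
  suffices map swapPoint ∘ₗ map swapPoint =
      (LinearMap.id : ListChain (V ⊕ V → ℝ) →ₗ[ZMod 2] _) from LinearMap.congr_fun this c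
  refine hom_ext fun l => ?_
  have : swapPoint ∘ swapPoint = (id : (V ⊕ V → ℝ) → _) := by
    funext p i
    simp [swapPoint]
  simp [this]

/-- An equivariant chain map from the simplicial chains to chains of small lists of points. -/
theorem exists_equivariant_chainMap (V : Type*) [DecidableEq V] [Fintype V] {ε : ℝ} (hε : 0 < ε) :
    ∃ g : Finset (V ⊕ V) → ListChain (V ⊕ V → ℝ), g ∅ = Finsupp.single [] 1 ∧
      ∀ F : Finset (V ⊕ V), Disjoint F.toLeft F.toRight →
        g F ∈ on (smallLists (simplexOn F) ε F.card) ∧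
        g (swapFactors F) = map swapPoint (g F) ∧ bdry (g F) = ∑ x ∈ F, g (F.erase x) := by
  classical
  suffices H : ∀ n : ℕ, ∃ g : Finset (V ⊕ V) → ListChain (V ⊕ V → ℝ),
      g ∅ = Finsupp.single [] 1 ∧
      ∀ F : Finset (V ⊕ V), Disjoint F.toLeft F.toRight → F.card ≤ n →
        g F ∈ on (smallLists (simplexOn F) ε F.card) ∧
        g (swapFactors F) = map swapPoint (g F) ∧ bdry (g F) = ∑ x ∈ F, g (F.erase x) by
    obtain ⟨g, h0, hg⟩ := H (Fintype.card (V ⊕ V))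
    exact ⟨g, h0, fun F hF => hg F hF (Finset.card_le_univ F)⟩
  obtain ⟨half, hhalf⟩ := exists_half V
  intro n
  induction n with
  | zero =>
    refine ⟨fun _ => Finsupp.single [] 1, rfl, fun F _ hF => ?_⟩
    obtain rfl := Finset.card_eq_zero.1 (Nat.le_zero.1 hF)
    refine ⟨single_mem_on ⟨by simp, by simp, by simp⟩, by simp, by simp [bdList]⟩
  | succ n ih =>
    obtain ⟨g, h0, hg⟩ := ih
    have hh : ∀ F : Finset (V ⊕ V), ∃ c : ListChain (V ⊕ V → ℝ),
        Disjoint F.toLeft F.toRight → F.card = n + 1 →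
        c ∈ on (smallLists (simplexOn F) ε F.card) ∧ bdry c = ∑ x ∈ F, g (F.erase x) := by
      intro F
      by_cases hF : Disjoint F.toLeft F.toRight ∧ F.card = n + 1
      · have hcard : ∀ x ∈ F, (F.erase x).card = n := fun x hx => by
          rw [Finset.card_erase_of_mem hx, hF.2, Nat.add_sub_cancel]
        obtain ⟨c, hc, hbc⟩ := exists_bdry_eq (convex_simplexOn F)
          (simplexOn_nonempty (Finset.card_pos.1 (by omega))) hε (k := n)
          (c := ∑ x ∈ F, g (F.erase x))
          (Submodule.sum_mem _ fun x hx => by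
            refine Finsupp.supported_mono (R := ZMod 2) (M := ZMod 2) ?_
              (hg _ (disjoint_erase hF.1 x) (hcard x hx).le).1
            rintro l ⟨h1, h2, h3⟩
            exact ⟨h1.trans (hcard x hx),
              fun p hp => simplexOn_mono (Finset.erase_subset x F) (h2 p hp), h3⟩)
          (by
            rw [map_sum, ← sum_sum_erase_erase_eq_zero g F]
            exact Finset.sum_congr rfl fun x hx =>
              (hg _ (disjoint_erase hF.1 x) (hcard x hx).le).2.2)
        exact ⟨c, fun _ _ => ⟨hF.2 ▸ hc, hbc⟩⟩
      · exact ⟨0, fun h1 h2 => absurd ⟨h1, h2⟩ hF⟩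
    choose h hh using hh
    set g' : Finset (V ⊕ V) → ListChain (V ⊕ V → ℝ) := fun F =>
      if F.card ≤ n then g F else if half F then h F else map swapPoint (h (swapFactors F))
      with hg'
    have hle : ∀ F, F.card ≤ n → g' F = g F := fun F hF => if_pos hF
    refine ⟨g', by rw [hle ∅ (by simp), h0], fun F hF hcard => ?_⟩
    have hbd : ∑ x ∈ F, g' (F.erase x) = ∑ x ∈ F, g (F.erase x) :=
      Finset.sum_congr rfl fun x hx => hle _ (by
        rw [Finset.card_erase_of_mem hx]
        omega)
    rw [hbd]
    rcases Nat.lt_or_ge n F.card with hlt | hcard'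
    · have hn : F.card = n + 1 := by omega
      have hne : F ≠ ∅ := by
        rintro rfl
        simp at hn
      have hF' := disjoint_swapFactors hF
      have hn' : (swapFactors F).card = n + 1 := by rw [card_swapFactors, hn]
      have hsum : ∑ x ∈ swapFactors F, g ((swapFactors F).erase x) =
          map swapPoint (∑ x ∈ F, g (F.erase x)) := by
        rw [sum_swapFactors, map_sum]
        refine Finset.sum_congr rfl fun x hx => (hg _ (disjoint_erase hF x) ?_).2.1
        rw [Finset.card_erase_of_mem hx]
        omega
      have h1 := hh F hF hn
      have h2 := hh _ hF' hn'
      by_cases hhF : half F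
      · have e1 : g' F = h F := by simp [hg', hlt.not_ge, hhF]
        have e2 : g' (swapFactors F) = map swapPoint (h F) := by
          simp [hg', hlt.not_ge, hhF, hhalf F hF hne]
        rw [e1, e2]
        exact ⟨h1.1, rfl, h1.2⟩
      · have e1 : g' F = map swapPoint (h (swapFactors F)) := by simp [hg', hlt.not_ge, hhF]
        have e2 : g' (swapFactors F) = h (swapFactors F) := by
          simp [hg', hlt.not_ge, hhF, hhalf F hF hne]
        rw [e1, e2, map_swapPoint_map_swapPoint]
        refine ⟨?_, rfl, ?_⟩
        · refine map_mem_on (fun l hl => ?_) h2.1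
          have := map_swapPoint_mem_smallLists hl
          rwa [swapFactors_swapFactors, card_swapFactors] at this
        · rw [bdry_map, h2.2, hsum, map_swapPoint_map_swapPoint]
    · have hcard'' : (swapFactors F).card ≤ n := by rwa [card_swapFactors]
      rw [hle F hcard', hle _ hcard'']
      exact hg F hF hcard'

/-- The universal almost invariant cochain. -/
theorem exists_universal_cochain (L : Type*) [DecidableEq L] [Fintype L] :
    ∃ A : Chain (L ⊕ L), A ∅ = 1 ∧ ∀ F : Finset (L ⊕ L), Disjoint F.toLeft F.toRight →
      A F + A (swapFactors F) = cobd A F := by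
  classical
  suffices H : ∀ n : ℕ, ∃ A : Chain (L ⊕ L), A ∅ = 1 ∧
      ∀ F : Finset (L ⊕ L), Disjoint F.toLeft F.toRight → F.card ≤ n →
        A F + A (swapFactors F) = cobd A F by
    obtain ⟨A, h0, hA⟩ := H (Fintype.card (L ⊕ L))
    exact ⟨A, h0, fun F hF => hA F hF (Finset.card_le_univ F)⟩
  obtain ⟨half, hhalf⟩ := exists_half L
  intro n
  induction n with
  | zero =>
    refine ⟨fun _ => 1, rfl, fun F _ hF => ?_⟩
    obtain rfl := Finset.card_eq_zero.1 (Nat.le_zero.1 hF)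
    simp [cobd, zmod_two_add_self]
  | succ n ih =>
    obtain ⟨A, h0, hA⟩ := ih
    set A' : Chain (L ⊕ L) := fun F =>
      if F.card ≤ n then A F else if half F then cobd A F else 0 with hA'
    have hle : ∀ F, F.card ≤ n → A' F = A F := fun F hF => if_pos hF
    refine ⟨A', by rw [hle ∅ (by simp), h0], fun F hF hcard => ?_⟩
    have hbd : cobd A' F = cobd A F :=
      Finset.sum_congr rfl fun x hx => hle _ (by
        rw [Finset.card_erase_of_mem hx]
        omega)
    rw [hbd]
    rcases Nat.lt_or_ge n F.card with hlt | hcard'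
    · have hne : F ≠ ∅ := by
        rintro rfl
        simp at hlt
      by_cases hhF : half F
      · simp [hA', hlt.not_ge, hhF, hhalf F hF hne]
      · simp only [hA', not_le.2 hlt, hhF, hhalf F hF hne, card_swapFactors, not_false_eq_true,
          if_true, if_false, zero_add]
        refine zmod_two_eq_of_add_eq_zero ?_
        have h1 : cobd (cobd A) F = 0 := by rw [cobd_cobd]; rfl
        rw [← h1]
        unfold cobd
        rw [sum_swapFactors, ← Finset.sum_add_distrib]
        refine Finset.sum_congr rfl fun x hx => ?_
        rw [add_comm]
        exact hA _ (disjoint_erase hF x) (by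
          rw [Finset.card_erase_of_mem hx]
          omega)
    · rw [hle F hcard', hle _ (by rwa [card_swapFactors])]
      exact hA F hF hcard'

end EquivariantMap

section Labelling

open ListChain

/-- The submodule of the chains that vanish outside a family. -/
def suppOnSubmodule {W : Type*} (Q : Set (Finset W)) : Submodule (ZMod 2) (Chain W) where
  carrier := {c | SuppOn Q c}
  add_mem' h h' := h.add h'
  zero_mem' _ _ := rfl
  smul_mem' r _ h := h.smul r

/-- The cone with a given apex, as a linear map. -/
def coneHom {W : Type*} [DecidableEq W] (x : W) : Chain W →ₗ[ZMod 2] Chain W where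
  toFun := cone x
  map_add' c c' := by
    funext F
    simp only [cone, Pi.add_apply]
    split_ifs <;> simp
  map_smul' r c := by
    funext F
    simp [cone]

theorem SuppOn.cone {W : Type*} [DecidableEq W] {Q : Set (Finset W)} {c : Chain W} (x : W)
    (h : SuppOn Q c) : SuppOn {F | x ∈ F ∧ F.erase x ∈ Q} (cone x c) := by
  intro F hF
  unfold _root_.cone
  split_ifs with hx
  · exact h _ fun h' => hF ⟨hx, h'⟩
  · rfl

/-- The simplicial chain underlying a list: its set of entries if they are distinct, and zero
otherwise. -/
def entriesList {W : Type*} [DecidableEq W] : List W → Chain W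
  | [] => Pi.single ∅ 1
  | x :: l => coneHom x (entriesList l)

/-- The simplicial chain underlying a chain of lists. -/
noncomputable def entries {W : Type*} [DecidableEq W] : ListChain W →ₗ[ZMod 2] Chain W :=
  Finsupp.linearCombination (ZMod 2) entriesList

theorem entries_single {W : Type*} [DecidableEq W] (l : List W) :
    entries (Finsupp.single l 1) = entriesList l := by
  simp [entries]

theorem entries_cons {W : Type*} [DecidableEq W] (x : W) (c : ListChain W) :
    entries (cons x c) = coneHom x (entries c) := by
  suffices entries ∘ₗ cons x = coneHom x ∘ₗ entries from LinearMap.congr_fun this c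
  exact hom_ext fun l => by simp [entries_single, entriesList]

theorem bd_entries {W : Type*} [DecidableEq W] [Fintype W] (c : ListChain W) :
    bd (entries c) = entries (bdry c) := by
  suffices bd ∘ₗ entries = (entries : ListChain W →ₗ[ZMod 2] Chain W) ∘ₗ bdry from
    LinearMap.congr_fun this c
  refine hom_ext fun l => ?_
  induction l with
  | nil =>
    simp only [LinearMap.comp_apply, entries_single, bdry_single, bdList, entriesList, map_zero]
    funext G
    refine bd_eq_zero_of_forall fun x _ => ?_
    simp
  | cons x l ih =>
    simp only [LinearMap.comp_apply, entries_single, bdry_single, bdList, entriesList,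
      map_add, entries_cons] at ih ⊢
    rw [← ih]
    exact bd_cone x _

theorem suppOn_entriesList {W : Type*} [DecidableEq W] (l : List W) :
    SuppOn {G | (∀ x ∈ G, x ∈ l) ∧ G.card = l.length} (entriesList l) := by
  induction l with
  | nil =>
    intro F hF
    refine Pi.single_eq_of_ne ?_ _
    rintro rfl
    exact hF ⟨by simp, by simp⟩
  | cons x l ih =>
    refine (ih.cone x).mono fun F hF => ⟨fun y hy => ?_, ?_⟩
    · by_cases hyx : y = x
      · simp [hyx]
      · exact List.mem_cons_of_mem _ (hF.2.1 y (Finset.mem_erase.2 ⟨hyx, hy⟩))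
    · rw [← Finset.card_erase_add_one hF.1, hF.2.2, List.length_cons]

theorem entriesList_map_swap {L : Type*} [DecidableEq L] (l : List (L ⊕ L)) :
    entriesList (l.map Sum.swap) = swapChain (entriesList l) := by
  induction l with
  | nil =>
    funext F
    have : F = ∅ ↔ swapFactors F = ∅ := by
      rw [← Finset.card_eq_zero, ← Finset.card_eq_zero, card_swapFactors]
    simp [entriesList, swapChain, Pi.single_apply, this]
  | cons x l ih =>
    funext F
    rw [List.map_cons, entriesList, entriesList, ih]
    change cone x.swap (swapChain (entriesList l)) F = cone x (entriesList l) (swapFactors F)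
    simp [cone, swapChain, swapFactors_erase]

/-- A labelling of the deleted join, equivariant and without small complementary edges, gives
an almost invariant cochain that vanishes in large degrees. -/
theorem exists_cochain_of_labelling {V L : Type*} [DecidableEq V] [Fintype V] [DecidableEq L]
    [Fintype L] {P : Set (Finset V)} {ε : ℝ}
    (hε : 0 < ε) {label : (V ⊕ V → ℝ) → L ⊕ L}
    (hswap : ∀ F ∈ deletedJoin P, ∀ p ∈ simplexOn F, label (swapPoint p) = (label p).swap)
    (hopp : ∀ F ∈ deletedJoin P, ∀ p ∈ simplexOn F, ∀ q ∈ simplexOn F, dist p q < ε →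
      label p ≠ (label q).swap) :
    ∃ a : Chain (V ⊕ V), a ∅ = 1 ∧
      (∀ F ∈ deletedJoin P, a F + a (swapFactors F) = cobd a F) ∧
      ∀ F ∈ deletedJoin P, Fintype.card L < F.card → a F = 0 := by
  obtain ⟨g, hg0, hg⟩ := exists_equivariant_chainMap V hε
  obtain ⟨A, hA0, hA⟩ := exists_universal_cochain L
  have hsupp : ∀ F ∈ deletedJoin P, SuppOn {G | Disjoint G.toLeft G.toRight ∧ G.card = F.card}
      (entries (map label (g F))) := by
    intro F hF
    refine apply_mem (φ := entries ∘ₗ map label) (W := suppOnSubmodule _) (fun l hl => ?_)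
      (hg F hF.2.2).1
    change SuppOn _ (entries (map label (Finsupp.single l 1)))
    rw [map_single, entries_single]
    refine (suppOn_entriesList _).mono fun G hG => ⟨?_, ?_⟩
    · rw [Finset.disjoint_left]
      intro x hx hx'
      rw [Finset.mem_toLeft] at hx
      rw [Finset.mem_toRight] at hx'
      obtain ⟨p, hp, hpx⟩ := List.mem_map.1 (hG.1 _ hx)
      obtain ⟨q, hq, hqx⟩ := List.mem_map.1 (hG.1 _ hx')
      refine hopp F hF p (hl.2.1 p hp) q (hl.2.1 q hq) (hl.2.2 p hp q hq) ?_
      rw [hpx, hqx, Sum.swap_inr]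
    · rw [hG.2, List.length_map, hl.1]
  have hequiv : ∀ F ∈ deletedJoin P, entries (map label (g (swapFactors F))) =
      swapChain (entries (map label (g F))) := by
    intro F hF
    rw [(hg F hF.2.2).2.1]
    let T : Chain (L ⊕ L) →ₗ[ZMod 2] Chain (L ⊕ L) :=
      { toFun := swapChain
        map_add' := swapChain_add
        map_smul' := swapChain_smul }
    refine apply_eq (φ := entries ∘ₗ map label ∘ₗ map swapPoint) (ψ := T ∘ₗ entries ∘ₗ map label)
      (fun l hl => ?_) (hg F hF.2.2).1
    simp only [LinearMap.comp_apply, map_single, entries_single]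
    change _ = swapChain _
    rw [← entriesList_map_swap, List.map_map, List.map_map]
    congr 1
    exact List.map_congr_left fun p hp => hswap F hF p (hl.2.1 p hp)
  refine ⟨fun F => pairing A (entries (map label (g F))), ?_, fun F hF => ?_,
    fun F hF hcard => ?_⟩
  · simp [hg0, entries_single, entriesList, pairing, Pi.single_apply, hA0]
  · beta_reduce
    rw [hequiv F hF, pairing_swapChain, ← pairing_add_left]
    rw [pairing_congr (a := A + swapChain A) (a' := cobd A) (hsupp F hF) fun G hG => hA G hG.1,
      ← pairing_bd, bd_entries,
      bdry_map, (hg F hF.2.2).2.2, map_sum, map_sum]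
    unfold cobd
    simp only [pairing, Finset.sum_apply, Finset.mul_sum]
    exact Finset.sum_comm
  · refine pairing_eq_zero (hsupp F hF) fun G hG => ?_
    have h1 := Finset.card_toLeft_add_card_toRight (u := G)
    have h2 := Finset.card_union_of_disjoint hG.1
    have h3 := Finset.card_le_univ (G.toLeft ∪ G.toRight)
    have h4 := hG.2
    omega

end Labelling

section Realization

/-- The points of the geometric realization, as a subset of the ambient space. -/
def realizationSet {V : Type} [Fintype V] (K : Finset (Finset V)) : Set (V → ℝ) :=
  {x | (∀ v, 0 ≤ x v) ∧ (∀ v, x v ≤ 1) ∧ (∑ v, x v) = 1 ∧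
    (Finset.univ.filter fun v => x v ≠ 0) ∈ K}

/-- A point of the geometric realization. -/
def toGeomRep {V : Type} [Fintype V] {K : Finset (Finset V)} (x : V → ℝ)
    (h : x ∈ realizationSet K) : GeomRep K := ⟨x, h⟩

open Classical in
/-- A map from the realization, extended by zero to the ambient space. -/
noncomputable def extendMap {V N : Type} [Fintype V] [Zero N] {K : Finset (Finset V)}
    (f : GeomRep K → N) (x : V → ℝ) : N :=
  if h : x ∈ realizationSet K then f (toGeomRep x h) else 0

/-- The cone over a map from the realization. -/
noncomputable def coneMap {V : Type} [Fintype V] {n : ℕ} {K : Finset (Finset V)}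
    (f : GeomRep K → EuclideanSpace ℝ (Fin n)) (u : V → ℝ) : EuclideanSpace ℝ (Fin n) :=
  (∑ v, u v) • extendMap f ((∑ v, u v)⁻¹ • u)

variable {V : Type} [Fintype V] {K : Finset (Finset V)} {n : ℕ}

/-- The cone over the realization. -/
def coneSet (K : Finset (Finset V)) : Set (V → ℝ) :=
  {u | (∀ v, 0 ≤ u v) ∧ (Finset.univ.filter fun v => u v ≠ 0) ∈ withEmpty K}

theorem smul_mem_realization {u : V → ℝ} (hu : u ∈ coneSet K) (hs : ∑ v, u v ≠ 0) :
    (∑ v, u v)⁻¹ • u ∈ realizationSet K := by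
  have h0 : 0 ≤ ∑ v, u v := Finset.sum_nonneg fun v _ => hu.1 v
  simp only [realizationSet, Set.mem_ofPred_eq, Pi.smul_apply, smul_eq_mul]
  refine ⟨fun v => mul_nonneg (inv_nonneg.2 h0) (hu.1 v), fun v => ?_, ?_, ?_⟩
  · rw [inv_mul_le_iff₀ (lt_of_le_of_ne h0 hs.symm), mul_one]
    exact Finset.single_le_sum (fun v _ => hu.1 v) (Finset.mem_univ v)
  · rw [← Finset.mul_sum, inv_mul_cancel₀ hs]
  · simp only [ne_eq, mul_eq_zero, inv_eq_zero, hs, false_or]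
    refine hu.2.resolve_left fun h => hs (Finset.sum_eq_zero fun v _ => ?_)
    by_contra hv
    have : v ∈ (Finset.univ.filter fun v => u v ≠ 0) := by simpa using hv
    rw [h] at this
    simp at this

theorem norm_extendMap_le {f : GeomRep K → EuclideanSpace ℝ (Fin n)} (hf : ∀ x, ‖f x‖ = 1)
    (x : V → ℝ) : ‖extendMap f x‖ ≤ 1 := by
  unfold extendMap
  split_ifs with h
  · exact (hf _).le
  · simp

theorem norm_coneMap {f : GeomRep K → EuclideanSpace ℝ (Fin n)} (hf : ∀ x, ‖f x‖ = 1)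
    {u : V → ℝ} (hu : u ∈ coneSet K) : ‖coneMap f u‖ = ∑ v, u v := by
  have h0 : 0 ≤ ∑ v, u v := Finset.sum_nonneg fun v _ => hu.1 v
  rw [coneMap, norm_smul, Real.norm_of_nonneg h0]
  by_cases hs : ∑ v, u v = 0
  · rw [hs, zero_mul]
  · rw [extendMap, dif_pos (smul_mem_realization hu hs), hf, mul_one]

theorem continuousOn_coneMap {f : GeomRep K → EuclideanSpace ℝ (Fin n)} (hc : Continuous f)
    (hf : ∀ x, ‖f x‖ = 1) : ContinuousOn (coneMap f) (coneSet K) := by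
  have hsum : Continuous fun u : V → ℝ => ∑ v, u v :=
    continuous_finsetSum _ fun v _ => continuous_apply v
  intro u hu
  by_cases hs : ∑ v, u v = 0
  · refine ContinuousAt.continuousWithinAt ?_
    have h0 : coneMap f u = 0 := by rw [coneMap, hs, zero_smul]
    rw [ContinuousAt, h0]
    refine squeeze_zero_norm (a := fun u => |∑ v, u v|) (fun w => ?_) ?_
    · rw [coneMap, norm_smul, Real.norm_eq_abs]
      exact mul_le_of_le_one_right (abs_nonneg _) (norm_extendMap_le hf _)
    · have := (continuous_abs.comp hsum).tendsto u
      simpa [hs, Function.comp_def] using this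
  · have hext : ContinuousOn (extendMap f) (realizationSet K) := by
      rw [continuousOn_iff_continuous_domRestrict]
      have : (realizationSet K).domRestrict (extendMap f) = fun x => f (toGeomRep x.1 x.2) := by
        funext x
        exact dif_pos x.2
      rw [this]
      exact hc
    have hnhds : {w : V → ℝ | ∑ v, w v ≠ 0} ∈ nhds u :=
      (isOpen_ne.preimage hsum).mem_nhds hs
    rw [← continuousWithinAt_inter hnhds]
    refine hsum.continuousWithinAt.smul ?_
    refine ContinuousWithinAt.comp (f := fun w : V → ℝ => (∑ v, w v)⁻¹ • w)
      (t := realizationSet K) (hext _ (smul_mem_realization hu hs)) ?_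
      fun w hw => smul_mem_realization hw.1 hw.2
    exact (hsum.continuousWithinAt.inv₀ hs).smul continuousWithinAt_id

theorem eq_of_coneMap_eq {f : GeomRep K → EuclideanSpace ℝ (Fin n)} (hf : ∀ x, ‖f x‖ = 1)
    (hinj : Function.Injective f) {u w : V → ℝ} (hu : u ∈ coneSet K) (hw : w ∈ coneSet K)
    (hs : ∑ v, u v ≠ 0) (h : coneMap f u = coneMap f w) : u = w := by
  have h1 := congrArg norm h
  rw [norm_coneMap hf hu, norm_coneMap hf hw] at h1
  have hs' : ∑ v, w v ≠ 0 := h1 ▸ hs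
  rw [coneMap, coneMap, extendMap, extendMap, dif_pos (smul_mem_realization hu hs),
    dif_pos (smul_mem_realization hw hs')] at h
  have h3 : toGeomRep _ (smul_mem_realization hu hs) =
      toGeomRep _ (smul_mem_realization hw hs') :=
    hinj (smul_right_injective _ hs (h.trans (congrArg (fun r : ℝ => r • _) h1.symm)))
  have h2 : (∑ v, u v)⁻¹ • u = (∑ v, w v)⁻¹ • w :=
    congrArg (fun x : GeomRep K => x.1) h3
  rw [← h1] at h2
  exact smul_right_injective _ (inv_ne_zero hs) h2

theorem isCompact_simplexOn {W : Type*} [Fintype W] (F : Finset W) : IsCompact (simplexOn F) := by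
  have h : simplexOn F = stdSimplex ℝ W ∩ ⋂ i : {i // i ∉ F}, {p | p i = 0} := by
    ext p
    simp [simplexOn, stdSimplex, and_assoc]
  rw [h]
  exact (isCompact_stdSimplex ℝ W).inter_right
    (isClosed_iInter fun i => isClosed_eq (continuous_apply _) continuous_const)

variable [DecidableEq V]

theorem left_mem_coneSet (hK : ∀ F ∈ withEmpty K, ∀ G, G ⊆ F → G ∈ withEmpty K)
    {F : Finset (V ⊕ V)} (hF : F.toLeft ∈ withEmpty K) {p : V ⊕ V → ℝ} (hp : p ∈ simplexOn F) :
    (fun v => p (Sum.inl v)) ∈ coneSet K := by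
  refine ⟨fun v => hp.1 _, hK _ hF _ fun v hv => ?_⟩
  by_contra h
  simp only [Finset.mem_filter] at hv
  exact hv.2 (hp.2.2 _ fun h' => h (Finset.mem_toLeft.2 h'))

theorem exists_labelling {m : ℕ} (hK : ∀ F ∈ withEmpty K, ∀ G, G ⊆ F → G ∈ withEmpty K)
    {f : GeomRep K → EuclideanSpace ℝ (Fin (m + 1))} (hc : Continuous f) (hf : ∀ x, ‖f x‖ = 1)
    (hinj : Function.Injective f) :
    ∃ ε > 0, ∃ label : (V ⊕ V → ℝ) → Fin (m + 1) ⊕ Fin (m + 1),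
      (∀ F ∈ deletedJoin (withEmpty K), ∀ p ∈ simplexOn F,
        label (swapPoint p) = (label p).swap) ∧
      ∀ F ∈ deletedJoin (withEmpty K), ∀ p ∈ simplexOn F, ∀ q ∈ simplexOn F, dist p q < ε →
        label p ≠ (label q).swap := by
  classical
  set X : Set (V ⊕ V → ℝ) := ⋃ F ∈ deletedJoin (withEmpty K), simplexOn F with hX
  have hXc : IsCompact X := (Set.toFinite _).isCompact_biUnion fun F _ => isCompact_simplexOn F
  have hmem : ∀ F ∈ deletedJoin (withEmpty K), ∀ p ∈ simplexOn F, p ∈ X := fun F hF p hp =>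
    Set.mem_biUnion hF hp
  have hswap : ∀ p ∈ X, swapPoint p ∈ X := by
    intro p hp
    obtain ⟨F, hF, hpF⟩ := Set.mem_iUnion₂.1 hp
    exact hmem _ (swapFactors_mem_deletedJoin hF) _ (swapPoint_mem_simplexOn hpF)
  have hleft : ∀ p ∈ X, (fun v => p (Sum.inl v)) ∈ coneSet K := by
    intro p hp
    obtain ⟨F, hF, hpF⟩ := Set.mem_iUnion₂.1 hp
    exact left_mem_coneSet hK hF.1 hpF
  have hright : ∀ p ∈ X, (fun v => p (Sum.inr v)) ∈ coneSet K := fun p hp => hleft _ (hswap p hp)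
  set Ψ : (V ⊕ V → ℝ) → Fin (m + 1) → ℝ := fun p j =>
    (coneMap f (fun v => p (Sum.inl v)) - coneMap f (fun v => p (Sum.inr v))) j with hΨ
  have hodd : ∀ p j, Ψ (swapPoint p) j = - Ψ p j := by
    intro p j
    simp [hΨ, swapPoint]
  have hΨc : ContinuousOn Ψ X := by
    refine continuousOn_pi.2 fun j => ?_
    have h1 : ContinuousOn (fun p : V ⊕ V → ℝ => coneMap f fun v => p (Sum.inl v)) X :=
      (continuousOn_coneMap hc hf).comp
        (continuous_pi fun v => continuous_apply _).continuousOn hleft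
    have h2 : ContinuousOn (fun p : V ⊕ V → ℝ => coneMap f fun v => p (Sum.inr v)) X :=
      (continuousOn_coneMap hc hf).comp
        (continuous_pi fun v => continuous_apply _).continuousOn hright
    exact (EuclideanSpace.proj (𝕜 := ℝ) j).continuous.comp_continuousOn (h1.sub h2)
  have hne : ∀ p ∈ X, Ψ p ≠ 0 := by
    intro p hp h
    have h1 : coneMap f (fun v => p (Sum.inl v)) = coneMap f (fun v => p (Sum.inr v)) := by
      rw [← sub_eq_zero]
      ext j
      exact congrFun h j
    have h2 := congrArg norm h1
    rw [norm_coneMap hf (hleft p hp), norm_coneMap hf (hright p hp)] at h2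
    obtain ⟨F, hF, hpF⟩ := Set.mem_iUnion₂.1 hp
    have h3 := hpF.2.1
    rw [Fintype.sum_sum_type, ← h2] at h3
    have hs : ∑ v, p (Sum.inl v) ≠ 0 := by
      intro h0
      rw [h0] at h3
      norm_num at h3
    have h4 := eq_of_coneMap_eq hf hinj (hleft p hp) (hright p hp) hs h1
    obtain ⟨v, -, hv⟩ := Finset.exists_ne_zero_of_sum_ne_zero hs
    have hv' : p (Sum.inr v) ≠ 0 := by
      rw [← congrFun h4 v]
      exact hv
    have e1 : v ∈ F.toLeft := by
      by_contra h5
      exact hv (hpF.2.2 _ fun h6 => h5 (Finset.mem_toLeft.2 h6))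
    have e2 : v ∈ F.toRight := by
      by_contra h5
      exact hv' (hpF.2.2 _ fun h6 => h5 (Finset.mem_toRight.2 h6))
    exact Finset.disjoint_left.1 hF.2.2 e1 e2
  obtain ⟨δ, hδ, hball⟩ : ∃ δ > 0, ∀ p ∈ X, δ ≤ ‖Ψ p‖ := by
    have h1 : (Ψ '' X)ᶜ ∈ nhds (0 : Fin (m + 1) → ℝ) := by
      refine (hXc.image_of_continuousOn hΨc).isClosed.isOpen_compl.mem_nhds ?_
      rintro ⟨p, hp, h⟩
      exact hne p hp h
    obtain ⟨δ, hδ, h⟩ := Metric.mem_nhds_iff.1 h1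
    refine ⟨δ, hδ, fun p hp => ?_⟩
    by_contra hlt
    exact h (mem_ball_zero_iff.2 (not_le.1 hlt)) ⟨p, hp, rfl⟩
  have hcoord : ∀ p ∈ X, ∃ j, δ ≤ |Ψ p j| := by
    intro p hp
    by_contra! h
    exact ((pi_norm_lt_iff hδ).2 h).not_ge (hball p hp)
  obtain ⟨ε, hε, hunif⟩ := Metric.uniformContinuousOn_iff.1
    (hXc.uniformContinuousOn_of_continuous hΨc) δ hδ
  set J : Set (Fin (m + 1)) → Fin (m + 1) := fun s => if h : s.Nonempty then h.some else 0
  have hJ : ∀ s, s.Nonempty → J s ∈ s := by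
    intro s hs
    simp only [J, dif_pos hs]
    exact hs.some_mem
  set idx : (V ⊕ V → ℝ) → Fin (m + 1) := fun p => J {j | δ ≤ |Ψ p j|} with hidx
  have hidxmem : ∀ p ∈ X, δ ≤ |Ψ p (idx p)| := fun p hp => hJ _ (hcoord p hp)
  have hidxswap : ∀ p, idx (swapPoint p) = idx p := by
    intro p
    simp only [hidx, hodd, abs_neg]
  refine ⟨ε, hε, fun p => if 0 < Ψ p (idx p) then Sum.inl (idx p) else Sum.inr (idx p), ?_, ?_⟩
  · intro F hF p hp
    have h1 := hidxmem p (hmem F hF p hp)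
    simp only [hidxswap, hodd]
    by_cases h : 0 < Ψ p (idx p)
    · rw [if_pos h, if_neg (by linarith)]
      rfl
    · have h2 : Ψ p (idx p) ≠ 0 := by
        intro h0
        rw [h0, abs_zero] at h1
        linarith
      have h3 := lt_of_le_of_ne (not_lt.1 h) h2
      rw [if_neg h, if_pos (by linarith)]
      rfl
  · intro F hF p hp q hq hpq heq
    have hp' := hmem F hF p hp
    have hq' := hmem F hF q hq
    have h1 := hidxmem p hp'
    have h2 := hidxmem q hq'
    have h3 := (dist_le_pi_dist (Ψ p) (Ψ q) (idx p)).trans_lt (hunif p hp' q hq' hpq)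
    rw [Real.dist_eq, abs_lt] at h3
    by_cases hp0 : 0 < Ψ p (idx p) <;> by_cases hq0 : 0 < Ψ q (idx q) <;>
      simp only [hp0, hq0, if_true, if_false, Sum.swap_inl, Sum.swap_inr, reduceCtorEq,
        Sum.inl.injEq, Sum.inr.injEq] at heq
    · rw [abs_of_pos hp0] at h1
      rw [abs_of_nonpos (not_lt.1 hq0), ← heq] at h2
      linarith
    · rw [abs_of_nonpos (not_lt.1 hp0)] at h1
      rw [abs_of_pos hq0, ← heq] at h2
      linarith

end Realization

/-- Theorem 1.2: if `S` is a piecewise linear `2d`-sphere and `M` is a missing `d`-face of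
`S`, then `K := S_{≤ d} ∪ {M}` does not embed in the `2d`-sphere. -/
theorem skeleton_plus_missing_face_not_embeddable
    {V : Type} [DecidableEq V] [Fintype V] (d : ℕ) (hd : 1 ≤ d)
    (S : Finset (Finset V)) (hS : IsPLSphere (2 * d) S)
    (M : Finset V) (hMcard : M.card = d + 1) (hMnot : M ∉ S)
    (hMbd : ∀ τ : Finset V, τ ⊂ M → τ.Nonempty → τ ∈ S) :
    ¬ ∃ f : GeomRep ((S.filter fun σ => σ.card ≤ d + 1) ∪ {M}) →
        Metric.sphere (0 : EuclideanSpace ℝ (Fin (2 * d + 1))) 1,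
      Continuous f ∧ Function.Injective f := by
  rintro ⟨f, hc, hinj⟩
  obtain ⟨hne, hP⟩ := hS.nonempty_and_sphereLike
  have hMne : M ≠ ∅ := by
    rintro rfl
    simp at hMcard
  have hMP : M ∉ withEmpty S := fun h => h.elim hMne hMnot
  have hMbd' : ∀ τ, τ ⊂ M → τ ∈ withEmpty S := fun τ hτ =>
    τ.eq_empty_or_nonempty.imp_right (hMbd τ hτ)
  have hskel : ∀ F ∈ withEmpty S, F.card ≤ d + 1 →
      F ∈ withEmpty ((S.filter fun σ => σ.card ≤ d + 1) ∪ {M}) := fun F hF hcard =>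
    hF.imp_right fun h => Finset.mem_union_left _ (Finset.mem_filter.2 ⟨h, hcard⟩)
  have hMK : M ∈ withEmpty ((S.filter fun σ => σ.card ≤ d + 1) ∪ {M}) :=
    Or.inr (Finset.mem_union_right _ (Finset.mem_singleton_self M))
  have hK : ∀ F ∈ withEmpty ((S.filter fun σ => σ.card ≤ d + 1) ∪ {M}), ∀ G, G ⊆ F →
      G ∈ withEmpty ((S.filter fun σ => σ.card ≤ d + 1) ∪ {M}) := by
    rintro F (rfl | hF) G hG
    · exact Or.inl (Finset.subset_empty.1 hG)
    rcases Finset.mem_union.1 hF with hF | hF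
    · obtain ⟨hFS, hcard⟩ := Finset.mem_filter.1 hF
      exact hskel G (hP.down F (Or.inr hFS) G hG) ((Finset.card_le_card hG).trans hcard)
    · obtain rfl := Finset.mem_singleton.1 hF
      rcases hG.eq_or_ssubset with rfl | hG'
      · exact hMK
      · exact hskel G (hMbd' G hG') ((Finset.card_le_card hG).trans hMcard.le)
  obtain ⟨ε, hε, label, hswap, hopp⟩ := exists_labelling hK (f := fun x => (f x).1)
    (continuous_subtype_val.comp hc) (fun x => mem_sphere_zero_iff_norm.1 (f x).2)
    (Subtype.val_injective.comp hinj)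
  obtain ⟨a, ha0, ha, ha'⟩ := exists_cochain_of_labelling hε hswap hopp
  rw [Fintype.card_fin] at ha'
  refine hP.not_exists_cochain hd hMcard hMP hMbd' ha0 (fun F hF h1 h2 _ => ?_)
    (fun F hF h1 h2 h3 => ?_) fun F hFM hR hRcard hdisj => ?_
  · exact ha F ⟨hskel _ hF.1 h1, hskel _ hF.2.1 h2, hF.2.2⟩
  · exact ha' F ⟨hskel _ hF.1 h1, hskel _ hF.2.1 h2, hF.2.2⟩ (by omega)
  · have hF : F ∈ deletedJoin (withEmpty ((S.filter fun σ => σ.card ≤ d + 1) ∪ {M})) :=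
      ⟨hFM ▸ hMK, hskel _ hR hRcard.le, hFM ▸ hdisj⟩
    have hcard := F.card_toLeft_add_card_toRight
    rw [hFM] at hcard
    rw [← ha F hF, ha' F hF (by omega),
      ha' _ (swapFactors_mem_deletedJoin hF) (by rw [card_swapFactors]; omega), add_zero]
end
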